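/- Let f ∈ ℤ[x] be a square-free polynomial of degree d = 4k with k ≥ 1, such that f(t) > 0 for all t ∈ ℝ. Then there exists ℓ₀ ∈ ℕ such that for every ℓ ≥ ℓ₀ the polynomial f(x) − 2^{−2ℓ}·(x² + x + 1)^{2k} is a sum of four squares in ℚ[x]. -/

import Mathlib

section partPA

open Polynomial

/-- Sum of four squares. -/
def IsS4 {R : Type*} [CommRing R] (f : R) : Prop := ∃ a b c d : R, f = a^2+b^2+c^2+d^2

lemma IsS4.mul {R : Type*} [CommRing R] {f g : R} (hf : IsS4 f) (hg : IsS4 g) : IsS4 (f * g) := by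
  obtain ⟨a, b, c, d, rfl⟩ := hf
  obtain ⟨x, y, z, w, rfl⟩ := hg
  exact ⟨a*x+b*y+c*z+d*w, a*y-b*x+c*w-d*z, a*z-c*x+d*y-b*w, a*w-d*x+b*z-c*y, by ring⟩

lemma isS4_one {R : Type*} [CommRing R] : IsS4 (1 : R) := ⟨1, 0, 0, 0, by ring⟩

lemma isS4_multiset_prod {R : Type*} [CommRing R] (s : Multiset R) (h : ∀ x ∈ s, IsS4 x) :
    IsS4 s.prod := by
  induction s using Multiset.induction_on with
  | empty => simpa using isS4_one
  | cons a s ih =>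
    rw [Multiset.prod_cons]
    exact (h a (by simp)).mul (ih fun x hx => h x (by simp [hx]))

lemma isS4_rat (r : ℚ) (hr : 0 < r) : IsS4 r := by
  obtain ⟨a, b, c, d, h⟩ := Nat.sum_four_squares (r.num.toNat * r.den)
  have hd : (r.den : ℚ) ≠ 0 := by exact_mod_cast r.den_ne_zero
  have hn : ((r.num.toNat : ℕ) : ℚ) = r.num := by
    have : ((r.num.toNat : ℕ) : ℤ) = r.num := Int.toNat_of_nonneg (Rat.num_pos.mpr hr).le
    exact_mod_cast this
  have h' : (a:ℚ)^2+b^2+c^2+d^2 = r.num * r.den := by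
    rw [← hn]; exact_mod_cast h
  have hr' : r * r.den = r.num := Rat.mul_den_eq_num r
  refine ⟨a / r.den, b / r.den, c / r.den, d / r.den, ?_⟩
  field_simp
  rw [h', ← hr']; ring

lemma isS4_C (r : ℚ) (hr : 0 < r) : IsS4 (C r : ℚ[X]) := by
  obtain ⟨a, b, c, d, h⟩ := isS4_rat r hr
  exact ⟨C a, C b, C c, C d, by rw [h]; simp⟩

lemma four_sq_zero {a b c d : ℚ[X]} (h : a^2+b^2+c^2+d^2 = 0) : a = 0 ∧ b = 0 ∧ c = 0 ∧ d = 0 := by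
  have key : ∀ x : ℚ, a.eval x = 0 ∧ b.eval x = 0 ∧ c.eval x = 0 ∧ d.eval x = 0 := by
    intro x
    have := congrArg (eval x) h
    simp only [eval_add, eval_pow, eval_zero] at this
    refine ⟨?_, ?_, ?_, ?_⟩ <;> nlinarith [sq_nonneg (a.eval x), sq_nonneg (b.eval x), sq_nonneg (c.eval x), sq_nonneg (d.eval x)]
  refine ⟨?_, ?_, ?_, ?_⟩ <;> apply Polynomial.funext <;> intro x <;> simp [key x]

lemma cassels (n : ℕ) : ∀ (f t : ℚ[X]), t ≠ 0 → t.natDegree = n → IsS4 (f * t^2) → IsS4 f := by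
  induction n using Nat.strong_induction_on with
  | _ n ih =>
  intro f t ht hn ⟨a, b, c, d, h⟩
  by_cases hn0 : n = 0
  · obtain ⟨q, rfl⟩ := natDegree_eq_zero.mp (hn.trans hn0)
    have hq : q ≠ 0 := by rintro rfl; simp at ht
    have hC : (C q * C q⁻¹ : ℚ[X]) = 1 := by rw [← C_mul, mul_inv_cancel₀ hq, C_1]
    refine ⟨C q⁻¹ * a, C q⁻¹ * b, C q⁻¹ * c, C q⁻¹ * d, ?_⟩
    calc f = f * C q ^ 2 * (C q⁻¹)^2 := by
          linear_combination (-f * (C q * C q⁻¹ + 1)) * hC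
      _ = _ := by rw [h]; ring
  have hdeg : ∀ u : ℚ[X], (u % t).natDegree ≤ n - 1 := by
    intro u
    have := natDegree_mod_lt u (q := t) (by omega)
    omega
  have e1 := EuclideanDomain.div_add_mod a t
  have e2 := EuclideanDomain.div_add_mod b t
  have e3 := EuclideanDomain.div_add_mod c t
  have e4 := EuclideanDomain.div_add_mod d t
  have d1 := hdeg a
  have d2 := hdeg b
  have d3 := hdeg c
  have d4 := hdeg d
  set v1 := a / t
  set v2 := b / t
  set v3 := c / t
  set v4 := d / t
  set r1 := a % t
  set r2 := b % t
  set r3 := c % t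
  set r4 := d % t
  set B := a*v1+b*v2+c*v3+d*v4 with hB
  set V := v1^2+v2^2+v3^2+v4^2 with hV
  set t' := f*t - 2*B + t*V with ht'
  have htt : t * t' = r1^2+r2^2+r3^2+r4^2 := by
    have : r1 = a - t*v1 := by linear_combination e1
    have : r2 = b - t*v2 := by linear_combination e2
    have : r3 = c - t*v3 := by linear_combination e3
    have : r4 = d - t*v4 := by linear_combination e4
    simp only [*]
    linear_combination h
  by_cases ht0 : t' = 0
  · rw [ht0, mul_zero] at htt
    obtain ⟨h1, h2, h3, h4⟩ := four_sq_zero htt.symm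
    refine ⟨v1, v2, v3, v4, ?_⟩
    have : t^2 * f = t^2 * (v1^2+v2^2+v3^2+v4^2) := by
      rw [h1, add_zero] at e1; rw [h2, add_zero] at e2; rw [h3, add_zero] at e3; rw [h4, add_zero] at e4
      rw [mul_comm, h, ← e1, ← e2, ← e3, ← e4]; ring
    exact mul_left_cancel₀ (pow_ne_zero 2 ht) this
  · have hlt : t'.natDegree < n := by
      have h1 : (t*t').natDegree = n + t'.natDegree := by rw [natDegree_mul ht ht0, hn]
      have h2 : (r1^2+r2^2+r3^2+r4^2).natDegree ≤ 2*(n-1) := by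
        have : ∀ r : ℚ[X], r.natDegree ≤ n-1 → (r^2).natDegree ≤ 2*(n-1) := fun r hr =>
          natDegree_pow_le.trans (Nat.mul_le_mul_left 2 hr)
        refine natDegree_add_le_of_degree_le (natDegree_add_le_of_degree_le (natDegree_add_le_of_degree_le ?_ ?_) ?_) ?_ <;> apply this <;> assumption
      rw [htt] at h1
      omega
    refine ih _ hlt f t' ht0 rfl ?_
    set α := V - f with hα
    set β := 2*(f*t - B) with hβ
    refine ⟨α*a+β*v1, α*b+β*v2, α*c+β*v3, α*d+β*v4, ?_⟩
    have h5 : t' = α*t+β := by rw [ht', hα, hβ]; ring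
    rw [h5]
    have h6 : (α*a+β*v1)^2+(α*b+β*v2)^2+(α*c+β*v3)^2+(α*d+β*v4)^2
       = α^2*(a^2+b^2+c^2+d^2)+2*α*β*B+β^2*V := by rw [hB, hV]; ring
    rw [h6, ← h, hα, hβ]; ring

lemma isS4_of_irreducible (n : ℕ) : ∀ (p A B : ℚ[X]), Irreducible p → p.Monic → p.natDegree = n →
    p ∣ A^2+B^2+1 → IsS4 p := by
  induction n using Nat.strong_induction_on with
  | _ n ih =>
  intro p A B hp hm hn hdvd
  have hp0 : p ≠ 0 := hp.ne_zero
  have hpd : 0 < p.natDegree := hp.natDegree_pos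
  have hdvd' : p ∣ (A % p)^2+(B % p)^2+1 := by
    have : (A % p)^2+(B % p)^2+1 = A^2+B^2+1 - p*((A/p)*(A + A%p) + (B/p)*(B+B%p)) := by
      have e1 := EuclideanDomain.div_add_mod A p
      have e2 := EuclideanDomain.div_add_mod B p
      linear_combination (A + A%p) * e1 + (B + B%p) * e2
    rw [this]
    exact dvd_sub hdvd (dvd_mul_right _ _)
  have dA := natDegree_mod_lt A (q := p) (by omega)
  have dB := natDegree_mod_lt B (q := p) (by omega)
  set a := A % p
  set b := B % p
  obtain ⟨h, hh⟩ := hdvd'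
  have hne : a^2+b^2+1 ≠ 0 := by
    intro h0
    have := four_sq_zero (a := a) (b := b) (c := 1) (d := 0) (by linear_combination h0)
    exact one_ne_zero this.2.2.1
  have hh0 : h ≠ 0 := by rintro rfl; exact hne (by rw [hh, mul_zero])
  have hhd : h.natDegree < n := by
    have h1 : (p*h).natDegree = n + h.natDegree := by rw [natDegree_mul hp0 hh0, hn]
    have h2 : (a^2+b^2+1).natDegree ≤ 2*(n-1) := by
      have : ∀ r : ℚ[X], r.natDegree < p.natDegree → (r^2).natDegree ≤ 2*(n-1) := fun r hr =>
          natDegree_pow_le.trans (Nat.mul_le_mul_left 2 (by omega))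
      refine natDegree_add_le_of_degree_le (natDegree_add_le_of_degree_le (this _ dA) (this _ dB)) (by simp)
    rw [hh] at h2
    omega
  have hlead : 0 < h.leadingCoeff := by
    have h1 : (p*h).leadingCoeff = h.leadingCoeff := by rw [leadingCoeff_mul, hm.leadingCoeff, one_mul]
    rw [← h1, ← hh]
    by_contra hneg
    have hneg' : (a^2+b^2+1).leadingCoeff < 0 := lt_of_le_of_ne (not_lt.mp hneg) (leadingCoeff_ne_zero.mpr hne)
    by_cases hd0 : (a^2+b^2+1).natDegree = 0
    · obtain ⟨q, hq⟩ := natDegree_eq_zero.mp hd0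
      rw [← hq, leadingCoeff_C] at hneg'
      have := congrArg (eval 0) hq
      simp at this
      nlinarith [sq_nonneg (eval 0 a), sq_nonneg (eval 0 b)]
    · have := tendsto_atBot_of_leadingCoeff_nonpos (a^2+b^2+1) (natDegree_pos_iff_degree_pos.mp (Nat.pos_of_ne_zero hd0)) hneg'.le
      obtain ⟨x, hx⟩ := (this.eventually (Filter.eventually_lt_atBot 0)).exists
      simp at hx
      nlinarith [sq_nonneg (eval x a), sq_nonneg (eval x b)]
  have hS : IsS4 h := by
    have := leadingCoeff_mul_prod_normalizedFactors h
    rw [← this]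
    refine (isS4_C _ hlead).mul (isS4_multiset_prod _ fun q hq => ?_)
    have hqi := UniqueFactorizationMonoid.irreducible_of_normalized_factor q hq
    have hqd := UniqueFactorizationMonoid.dvd_of_mem_normalizedFactors hq
    refine ih q.natDegree ((natDegree_le_of_dvd hqd hh0).trans_lt hhd) q a b hqi ?_ rfl ?_
    · have := UniqueFactorizationMonoid.normalize_normalized_factor q hq
      rw [← this]; exact monic_normalize hqi.ne_zero
    · exact hqd.trans (hh ▸ dvd_mul_left h p)
  have h3 : IsS4 (p * h^2) := by
    have : p*h^2 = (a^2+b^2+1)*h := by rw [hh]; ring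
    rw [this]
    exact IsS4.mul ⟨a, b, 1, 0, by ring⟩ hS
  exact cassels _ p h hh0 rfl h3

lemma isS4_poly (g : ℚ[X]) (hg : 0 < g.leadingCoeff)
    (H : ∀ p : ℚ[X], Irreducible p → p ∣ g → ∃ A B : ℚ[X], p ∣ A^2+B^2+1) : IsS4 g := by
  rw [← leadingCoeff_mul_prod_normalizedFactors g]
  refine (isS4_C _ hg).mul (isS4_multiset_prod _ fun q hq => ?_)
  have hqi := UniqueFactorizationMonoid.irreducible_of_normalized_factor q hq
  have hqd := UniqueFactorizationMonoid.dvd_of_mem_normalizedFactors hq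
  obtain ⟨A, B, h⟩ := H q hqi hqd
  refine isS4_of_irreducible _ q A B hqi ?_ rfl h
  have := UniqueFactorizationMonoid.normalize_normalized_factor q hq
  rw [← this]; exact monic_normalize hqi.ne_zero

end partPA

section partPB

/-- squaring -/
abbrev sqHom (A : Type*) [CommGroup A] : A →* A := powMonoidHom 2

/-- rank of an abelian group -/
noncomputable def rk (A : Type*) [CommGroup A] : ℕ := Module.finrank ℤ (Additive A)

lemma finrank_of_finite_group (T : Type*) [AddCommGroup T] [Finite T] : Module.finrank ℤ T = 0 := by
  rw [Module.finrank_eq_zero_iff_isTorsion]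
  intro x
  refine ⟨⟨(Nat.card T : ℤ), ?_⟩, ?_⟩
  · rw [mem_nonZeroDivisors_iff_ne_zero]; exact_mod_cast Nat.card_pos.ne'
  · simp [Submonoid.smul_def]

lemma add_index_two_prod (A B : Type*) [AddCommGroup A] [AddCommGroup B] :
    (nsmulAddMonoidHom 2 : A × B →+ A × B).range.index =
     (nsmulAddMonoidHom 2 : A →+ A).range.index * (nsmulAddMonoidHom 2 : B →+ B).range.index := by
  rw [← AddSubgroup.index_prod]
  congr 1
  ext ⟨a, b⟩
  simp [AddSubgroup.mem_prod]

lemma add_ker_two_prod (A B : Type*) [AddCommGroup A] [AddCommGroup B] :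
    Nat.card (nsmulAddMonoidHom 2 : A × B →+ A × B).ker =
     Nat.card (nsmulAddMonoidHom 2 : A →+ A).ker * Nat.card (nsmulAddMonoidHom 2 : B →+ B).ker := by
  rw [← Nat.card_prod]
  refine Nat.card_congr ⟨fun x => (⟨x.1.1, ?_⟩, ⟨x.1.2, ?_⟩), fun x => ⟨(x.1.1, x.2.1), ?_⟩, fun x => rfl, fun x => rfl⟩
  · exact congrArg Prod.fst (AddMonoidHom.mem_ker.mp x.2)
  · exact congrArg Prod.snd (AddMonoidHom.mem_ker.mp x.2)
  · have h1 := AddMonoidHom.mem_ker.mp x.1.2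
    have h2 := AddMonoidHom.mem_ker.mp x.2.2
    exact AddMonoidHom.mem_ker.mpr (Prod.ext h1 h2)

lemma add_index_two (A : Type*) [AddCommGroup A] [Module.Finite ℤ A] :
    (nsmulAddMonoidHom 2 : A →+ A).range.index =
      2 ^ Module.finrank ℤ A * Nat.card (nsmulAddMonoidHom 2 : A →+ A).ker := by
  have : AddGroup.FG A := Module.Finite.iff_addGroup_fg.mp inferInstance
  obtain ⟨n, ι, _, p, hp, e, ⟨φ⟩⟩ := AddCommGroup.equiv_free_prod_directSum_zmod A
  have : ∀ i, NeZero (p i ^ e i) := fun i => ⟨pow_ne_zero _ (hp i).ne_zero⟩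
  have : ∀ i, Fintype (ZMod (p i ^ e i)) := fun i => ZMod.fintype _
  classical
  have : Finite (DirectSum ι fun i => ZMod (p i ^ e i)) :=
    Finite.of_equiv _ (DirectSum.addEquivProd fun i => ZMod (p i ^ e i)).symm.toEquiv
  set T := DirectSum ι fun i => ZMod (p i ^ e i)
  have h1 : (nsmulAddMonoidHom 2 : A →+ A).range.index = (nsmulAddMonoidHom 2 : (Fin n →₀ ℤ) × T →+ (Fin n →₀ ℤ) × T).range.index := by
    rw [← AddSubgroup.index_map_equiv _ φ, AddEquiv.map_range_nsmulAddMonoidHom]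
  have h2 : Nat.card (nsmulAddMonoidHom 2 : A →+ A).ker = Nat.card (nsmulAddMonoidHom 2 : (Fin n →₀ ℤ) × T →+ (Fin n →₀ ℤ) × T).ker := by
    refine Nat.card_congr (φ.toEquiv.subtypeEquiv fun a => ?_)
    simp only [AddMonoidHom.mem_ker, nsmulAddMonoidHom_apply]
    change _ ↔ 2 • φ a = 0
    rw [← map_nsmul, map_eq_zero_iff _ φ.injective]
  have h3 : Module.finrank ℤ A = n := by
    rw [LinearEquiv.finrank_eq φ.toIntLinearEquiv]
    rw [← Submodule.finrank_quotient_add_finrank (LinearMap.ker (LinearMap.fst ℤ (Fin n →₀ ℤ) T))]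
    have a1 : Module.finrank ℤ (LinearMap.ker (LinearMap.fst ℤ (Fin n →₀ ℤ) T)) = 0 := by
      have : Finite (LinearMap.ker (LinearMap.fst ℤ (Fin n →₀ ℤ) T)) := by
        refine Finite.of_injective (fun x => x.1.2) ?_
        rintro ⟨⟨a, b⟩, h⟩ ⟨⟨a', b'⟩, h'⟩ hh
        simp at h h' hh
        subst h h' hh
        rfl
      have h0 := finrank_of_finite_group (LinearMap.ker (LinearMap.fst ℤ (Fin n →₀ ℤ) T))
      convert h0
    rw [a1, add_zero, LinearEquiv.finrank_eq (LinearMap.quotKerEquivOfSurjective _ LinearMap.fst_surjective)]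
    simp
  rw [h1, h2, h3, add_index_two_prod, add_ker_two_prod, AddSubgroup.index_range_nsmul]
  have h4 : Nat.card (nsmulAddMonoidHom 2 : (Fin n →₀ ℤ) →+ (Fin n →₀ ℤ)).ker = 1 := by
    rw [Nat.card_eq_one_iff_unique]
    refine ⟨⟨fun a b => ?_⟩, ⟨0⟩⟩
    have ha := AddMonoidHom.mem_ker.mp a.2
    have hb := AddMonoidHom.mem_ker.mp b.2
    rw [nsmulAddMonoidHom_apply, smul_eq_zero] at ha hb
    exact Subtype.ext ((ha.resolve_left (by norm_num)).trans (hb.resolve_left (by norm_num)).symm)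
  rw [h4, AddSubgroup.index_range]
  simp

lemma fg_additive (A : Type*) [CommGroup A] [Group.FG A] : Module.Finite ℤ (Additive A) :=
  Module.Finite.iff_addGroup_fg.mpr inferInstance

lemma index_sq (A : Type*) [CommGroup A] [Group.FG A] :
    (sqHom A).range.index = 2 ^ rk A * Nat.card (sqHom A).ker := by
  have := fg_additive A
  have h := add_index_two (Additive A)
  exact h

instance subgroup_fg {A : Type*} [CommGroup A] [Group.FG A] (H : Subgroup A) : Group.FG H := by
  have := fg_additive A
  have : Module.Finite ℤ (AddSubgroup.toIntSubmodule (Subgroup.toAddSubgroup H)) := inferInstance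
  have h2 : AddGroup.FG (AddSubgroup.toIntSubmodule (Subgroup.toAddSubgroup H)) := Module.Finite.iff_addGroup_fg.mp this
  have h3 : AddGroup.FG (Additive H) := h2
  exact GroupFG.iff_add_fg.mpr h3

lemma relIndex_sq {A : Type*} [CommGroup A] (H : Subgroup A) [Group.FG H] :
    (H.map (sqHom A)).relIndex H = 2 ^ rk H * Nat.card (sqHom H).ker := by
  rw [← index_sq, Subgroup.relIndex]
  congr 1
  ext x
  simp only [Subgroup.mem_subgroupOf, Subgroup.mem_map, powMonoidHom_apply, MonoidHom.mem_range]
  constructor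
  · rintro ⟨y, hy, h⟩; exact ⟨⟨y, hy⟩, Subtype.ext h⟩
  · rintro ⟨y, h⟩; exact ⟨y, y.2, by rw [← h]; rfl⟩

lemma rk_range_add_rk_ker {A B : Type*} [CommGroup A] [CommGroup B] [Group.FG A] (f : A →* B) :
    rk f.range + rk f.ker = rk A := by
  have := fg_additive A
  have h := Submodule.finrank_quotient_add_finrank (LinearMap.ker (MonoidHom.toAdditive f).toIntLinearMap)
  rw [LinearEquiv.finrank_eq (LinearMap.quotKerEquivRange _)] at h
  exact h

lemma rk_congr {A B : Type*} [CommGroup A] [CommGroup B] (e : A ≃* B) : rk A = rk B :=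
  LinearEquiv.finrank_eq (MulEquiv.toAdditive e).toIntLinearEquiv

lemma herbrand {A : Type*} [CommGroup A] [Group.FG A] (σ : A →* A) (hσ : ∀ x, σ (σ x) = x)
    (h90 : ∀ y, y * σ y = 1 → ∃ z, y = z / σ z) (F : Subgroup A) (hF : ∀ x, x ∈ F ↔ σ x = x) :
    (MonoidHom.id A * σ).range.relIndex F * 2 ^ rk A = 2 ^ (2 * rk F) := by
  set N := MonoidHom.id A * σ with hN
  set D := MonoidHom.id A / σ with hD
  have hNa : ∀ x, N x = x * σ x := fun x => rfl
  have hDa : ∀ x, D x = x / σ x := fun x => rfl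
  have hFD : D.ker = F := by
    ext x; rw [MonoidHom.mem_ker, hDa, div_eq_one, hF, eq_comm]
  have hDN : D.range = N.ker := by
    ext x
    rw [MonoidHom.mem_ker, hNa]
    constructor
    · rintro ⟨y, rfl⟩
      rw [hDa, map_div, hσ]; simp
    · intro h
      obtain ⟨z, hz⟩ := h90 x h
      exact ⟨z, hz.symm⟩
  have hNF : N.range ≤ F := by
    rintro _ ⟨y, rfl⟩
    rw [hF, hNa, map_mul, hσ, mul_comm]
  have i1 : F.map N = F.map (sqHom A) := by
    ext x
    simp only [Subgroup.mem_map]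
    refine exists_congr fun y => and_congr_right fun hy => ?_
    rw [hNa, (hF y).mp hy]; simp [sq]
  have i2 : N.ker.map D = N.ker.map (sqHom A) := by
    ext x
    simp only [Subgroup.mem_map]
    refine exists_congr fun y => and_congr_right fun hy => ?_
    rw [MonoidHom.mem_ker, hNa] at hy
    rw [hDa, ← inv_eq_of_mul_eq_one_right hy]; simp [sq]
  have j1 := relIndex_sq F
  have j2 := relIndex_sq N.ker
  have k1 : (F.map N).relIndex N.range = (F ⊔ N.ker).index := by
    rw [MonoidHom.range_eq_map, Subgroup.relIndex_map_map]; simp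
  have k2 : (N.ker.map D).relIndex D.range = (F ⊔ N.ker).index := by
    rw [MonoidHom.range_eq_map, Subgroup.relIndex_map_map, hFD, sup_comm]; simp
  rw [← i1, ← Subgroup.relIndex_mul_relIndex _ N.range _ (Subgroup.map_le_range _ _) hNF, k1] at j1
  rw [← i2] at j2
  rw [hDN] at k2
  rw [k2] at j2
  have hcard : Nat.card (sqHom F).ker = Nat.card (sqHom N.ker).ker := by
    refine Nat.card_congr ⟨fun x => ⟨⟨x.1.1, ?_⟩, ?_⟩, fun x => ⟨⟨x.1.1, ?_⟩, ?_⟩, fun x => rfl, fun x => rfl⟩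
    · have h1 := (hF _).mp x.1.2
      have h2 := x.2
      rw [MonoidHom.mem_ker] at h2
      have h2 : (x.1.1)^2 = 1 := congrArg Subtype.val h2
      rw [MonoidHom.mem_ker, hNa, h1, ← sq, h2]
    · have h2 := x.2
      rw [MonoidHom.mem_ker] at h2 ⊢
      exact Subtype.ext (congrArg Subtype.val h2 :)
    · have h1 := x.1.2
      have h2 := x.2
      rw [MonoidHom.mem_ker] at h2
      have h2 : (x.1.1)^2 = 1 := congrArg Subtype.val h2
      rw [MonoidHom.mem_ker, hNa] at h1
      rw [hF, ← inv_eq_of_mul_eq_one_right h1]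
      exact inv_eq_of_mul_eq_one_right (by rw [← sq, h2])
    · have h2 := x.2
      rw [MonoidHom.mem_ker] at h2 ⊢
      exact Subtype.ext (congrArg Subtype.val h2 :)
  have hfin : Nat.card (sqHom F).ker ≠ 0 := by
    have : Finite (sqHom F).ker := by
      have := fg_additive (sqHom F).ker
      have hT : Module.IsTorsion ℤ (Additive (sqHom F).ker) := by
        intro x
        refine ⟨⟨2, by simp⟩, ?_⟩
        have h2 := (Additive.toMul x).2
        rw [MonoidHom.mem_ker] at h2
        change (2:ℤ) • x = 0
        rw [two_zsmul]
        apply Additive.toMul.injective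
        apply Subtype.ext
        rw [← two_nsmul]
        simpa using h2
      exact Module.finite_of_fg_torsion (Additive (sqHom F).ker) hT
    exact Nat.card_pos.ne'
  have hrk : rk A = rk N.ker + rk F := by
    rw [← rk_range_add_rk_ker D, hFD, hDN]
  rw [← hcard] at j2
  rw [j2] at j1
  have j3 : N.range.relIndex F * 2 ^ rk N.ker = 2 ^ rk F := by
    have : Nat.card (sqHom F).ker * (N.range.relIndex F * 2 ^ rk N.ker) = Nat.card (sqHom F).ker * 2 ^ rk F := by
      linarith
    exact Nat.eq_of_mul_eq_mul_left (Nat.pos_of_ne_zero hfin) this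
  rw [hrk, pow_add, ← mul_assoc, j3]; ring

/-- independence lemma -/
lemma indep_index {A ι : Type*} [CommGroup A] (s : Finset ι) (Nn : ι → Subgroup A) (G H : Subgroup A)
    (x : ι → A) (hxG : ∀ i ∈ s, x i ∈ G)
    (hH : ∀ i ∈ s, H ≤ Nn i) (hx : ∀ i ∈ s, x i ∉ Nn i) (hx' : ∀ i ∈ s, ∀ j ∈ s, i ≠ j → x i ∈ Nn j)
    (hfin : H.relIndex G ≠ 0) : 2 ^ s.card ≤ H.relIndex G := by
  classical
  rw [← Finset.card_powerset]
  have : (H.subgroupOf G).FiniteIndex := ⟨hfin⟩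
  have hF : Finite (G ⧸ H.subgroupOf G) := inferInstance
  rw [Subgroup.relIndex, Subgroup.index]
  have := Fintype.ofFinite (G ⧸ H.subgroupOf G)
  rw [Nat.card_eq_fintype_card]
  have hmem : ∀ t ∈ s.powerset, ∏ i ∈ t, x i ∈ G := fun t ht =>
    Subgroup.prod_mem _ fun i hi => hxG i (Finset.mem_powerset.mp ht hi)
  refine Finset.card_le_card_of_injOn (t := Finset.univ)
    (fun t => if h : ∏ i ∈ t, x i ∈ G then (QuotientGroup.mk ⟨∏ i ∈ t, x i, h⟩ : G ⧸ H.subgroupOf G) else 1) (fun _ _ => by simp) ?_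
  intro t ht u hu htu
  have ht' := hmem t ht
  have hu' := hmem u hu
  simp only [ht', hu', dif_pos] at htu
  rw [QuotientGroup.eq, Subgroup.mem_subgroupOf] at htu
  have htu : (∏ i ∈ t, x i)⁻¹ * ∏ i ∈ u, x i ∈ H := htu
  rw [Finset.mem_coe, Finset.mem_powerset] at ht hu
  have key : ∀ i ∈ s, ∀ t : Finset ι, t ⊆ s → (∏ j ∈ t, x j ∈ Nn i ↔ i ∉ t) := by
    intro i hi t ht
    by_cases hit : i ∈ t
    · rw [← Finset.mul_prod_erase t x hit]
      have : ∏ j ∈ t.erase i, x j ∈ Nn i := Subgroup.prod_mem _ fun j hj =>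
        hx' j (ht (Finset.mem_of_mem_erase hj)) i hi (Finset.ne_of_mem_erase hj)
      simp only [hit, not_true_eq_false, iff_false]
      rw [Subgroup.mul_mem_cancel_right _ this]
      exact hx i hi
    · simp only [hit, not_false_eq_true, iff_true]
      exact Subgroup.prod_mem _ fun j hj => hx' j (ht hj) i hi (by rintro rfl; exact hit hj)
  ext i
  by_cases hi : i ∈ s
  · have h1 := hH i hi htu
    have h2 := key i hi t ht
    have h3 := key i hi u hu
    have : ∏ j ∈ t, x j ∈ Nn i ↔ ∏ j ∈ u, x j ∈ Nn i := by
      constructor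
      · intro h
        have := Subgroup.mul_mem _ h h1
        simpa using this
      · intro h
        have := Subgroup.mul_mem _ h (Subgroup.inv_mem _ h1)
        simpa using this
    tauto
  · exact ⟨fun h => absurd (ht h) hi, fun h => absurd (hu h) hi⟩

end partPB

section partPC

open IsDedekindDomain NumberField WithZero
set_option linter.unusedSectionVars false

section LocalAbstract
variable {K Γ : Type*} [Field K] [LinearOrderedCommGroupWithZero Γ]

lemma val_nat_le_one (V : Valuation K Γ) (n : ℕ) : V (n : K) ≤ 1 := by
  induction n with
  | zero => simp
  | succ n ih =>
    push_cast
    exact (V.map_add _ _).trans (max_le ih (by simp))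

lemma val_four_le_one (V : Valuation K Γ) : V (4 : K) ≤ 1 := by
  simpa using val_nat_le_one V 4

lemma val_four (V : Valuation K Γ) : V (4 : K) = V 2 ^ 2 := by
  rw [← map_pow]; norm_num

lemma val_eq_one_of_sub_lt (V : Valuation K Γ) {a : K} (h : V (a - 1) < 1) : V a = 1 := by
  have := V.map_one_add_of_lt h
  simpa using this

/-- local squares -/
def Qg [CharZero K] (V : Valuation K Γ) : Subgroup Kˣ where
  carrier := {x | ∃ y : K, V (x * y ^ 2 - 1) < V 4}
  one_mem' := ⟨1, by simp [zero_lt_iff]⟩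
  mul_mem' := by
    rintro x x' ⟨y, hy⟩ ⟨y', hy'⟩
    refine ⟨y * y', ?_⟩
    have h4 := val_four_le_one V
    have e : ((x * x' : Kˣ) : K) * (y * y') ^ 2 - 1 =
      (x * y ^ 2 - 1) * (x' * y' ^ 2 - 1) + ((x * y ^ 2 - 1) + (x' * y' ^ 2 - 1)) := by
      push_cast; ring
    rw [e]
    refine V.map_add_lt ?_ (V.map_add_lt hy hy')
    rw [map_mul]
    calc V (x * y ^ 2 - 1) * V (x' * y' ^ 2 - 1) ≤ V (x * y ^ 2 - 1) * 1 := by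
          gcongr; exact (hy'.le.trans h4)
      _ < V 4 := by simpa using hy
  inv_mem' := by
    rintro x ⟨y, hy⟩
    refine ⟨x * y, ?_⟩
    have : ((x⁻¹ : Kˣ) : K) * (x * y) ^ 2 - 1 = x * y ^ 2 - 1 := by
      have := x.ne_zero
      push_cast; field_simp
    rw [this]; exact hy

/-- even valuation -/
def Evg (V : Valuation K Γ) : Subgroup Kˣ where
  carrier := {x | ∃ t : K, V x = V t ^ 2}
  one_mem' := ⟨1, by simp⟩
  mul_mem' := by
    rintro x x' ⟨y, hy⟩ ⟨y', hy'⟩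
    exact ⟨y * y', by push_cast; rw [map_mul, map_mul, hy, hy', mul_pow]⟩
  inv_mem' := by
    rintro x ⟨y, hy⟩
    exact ⟨y⁻¹, by push_cast; rw [map_inv₀, map_inv₀, hy, inv_pow]⟩

/-- values of norm form -/
def Nm (c : K) : Subgroup Kˣ where
  carrier := {x | ∃ u w : K, (x : K) = u ^ 2 - c * w ^ 2}
  one_mem' := ⟨1, 0, by simp⟩
  mul_mem' := by
    rintro x x' ⟨u, w, h⟩ ⟨u', w', h'⟩
    exact ⟨u * u' + c * w * w', u * w' + w * u', by push_cast; rw [h, h']; ring⟩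
  inv_mem' := by
    rintro x ⟨u, w, h⟩
    refine ⟨u / x, w / x, ?_⟩
    have := x.ne_zero
    have e : (u / (x:K)) ^ 2 - c * (w / x) ^ 2 = (u ^ 2 - c * w ^ 2) / x ^ 2 := by field_simp
    rw [e, ← h]; push_cast; field_simp

variable [CharZero K] (V : Valuation K Γ)

lemma mem_Qg {x : Kˣ} : x ∈ Qg V ↔ ∃ y : K, V (x * y ^ 2 - 1) < V 4 := Iff.rfl
lemma mem_Evg {x : Kˣ} : x ∈ Evg V ↔ ∃ t : K, V x = V t ^ 2 := Iff.rfl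
lemma mem_Nm {c : K} {x : Kˣ} : x ∈ Nm c ↔ ∃ u w : K, (x : K) = u ^ 2 - c * w ^ 2 := Iff.rfl

lemma sq_mem_Qg (x : Kˣ) : x ^ 2 ∈ Qg V :=
  ⟨(x⁻¹ : Kˣ), by
    have : ((x ^ 2 : Kˣ) : K) * ((x⁻¹ : Kˣ) : K) ^ 2 = 1 := by
      rw [← Units.val_pow_eq_pow_val, ← Units.val_mul]; simp
    rw [this]; simp [zero_lt_iff]⟩

lemma Qg_of_near {x a : Kˣ} (h : V ((x : K) - a) < V (4 * a)) : x * a⁻¹ ∈ Qg V := by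
  refine ⟨1, ?_⟩
  have ha := a.ne_zero
  have : ((x * a⁻¹ : Kˣ) : K) * 1 ^ 2 - 1 = (x - a) / a := by push_cast; field_simp
  rw [this, map_div₀, div_lt_iff₀ (by simp [zero_lt_iff]), ← map_mul]
  exact h

lemma Qg_le_Evg : Qg V ≤ Evg V := by
  rintro x ⟨y, hy⟩
  have h1 : V (x * y ^ 2) = 1 := val_eq_one_of_sub_lt V (hy.trans_le (val_four_le_one V))
  refine ⟨y⁻¹, ?_⟩
  rw [map_mul, map_pow] at h1
  rw [map_inv₀, inv_pow]
  exact eq_inv_of_mul_eq_one_left h1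

/-- odd place, `c` of even valuation, not a local square: norms have even valuation -/
lemma localA (h2 : V 2 = 1) (c : Kˣ) (hc : c ∈ Evg V) (hcQ : c ∉ Qg V) :
    Qg V ⊔ Nm (c : K) ≤ Evg V := by
  refine sup_le (Qg_le_Evg V) ?_
  rintro x ⟨u, w, h⟩
  have h4 : V 4 = 1 := by rw [val_four, h2, one_pow]
  obtain ⟨t, ht⟩ := hc
  have e1 : V (c * w ^ 2) = V (t * w) ^ 2 := by rw [map_mul, ht, map_pow, map_mul, mul_pow]
  by_cases hlt : V (u ^ 2 - c * w ^ 2) < max (V (u ^ 2)) (V (c * w ^ 2))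
  · exfalso
    have heq : V (u ^ 2) = V (c * w ^ 2) := by
      by_contra hne
      rcases lt_or_gt_of_ne hne with h' | h'
      · rw [V.map_sub_eq_of_lt_right h', max_eq_right h'.le] at hlt
        exact hlt.false
      · rw [V.map_sub_eq_of_lt_left h', max_eq_left h'.le] at hlt
        exact hlt.false
    rw [heq, max_self, ← heq] at hlt
    have hu : u ≠ 0 := by
      rintro rfl
      simp at hlt
    apply hcQ
    refine ⟨w / u, ?_⟩
    rw [h4]
    have : (c : K) * (w / u) ^ 2 - 1 = - (u ^ 2 - c * w ^ 2) / u ^ 2 := by field_simp; ring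
    rw [this, map_div₀, Valuation.map_neg, div_lt_one₀ (by simp [zero_lt_iff, hu])]
    exact hlt
  · have := le_antisymm (V.map_sub (u ^ 2) (c * w ^ 2)) (not_lt.mp hlt)
    rcases le_total (V (u ^ 2)) (V (c * w ^ 2)) with h' | h'
    · exact ⟨t * w, by rw [h, this, max_eq_right h', e1]⟩
    · exact ⟨u, by rw [h, this, max_eq_left h', map_pow]⟩

/-- odd place, `c` of odd valuation: norms of even valuation are local squares -/
lemma localB (h2 : V 2 = 1) (c : Kˣ) (hc : c ∉ Evg V) {x : Kˣ} (hx : x ∈ Qg V ⊔ Nm (c : K))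
    (hxe : x ∈ Evg V) : x ∈ Qg V := by
  have h4 : V 4 = 1 := by rw [val_four, h2, one_pow]
  obtain ⟨q, hq, n, hn, rfl⟩ := Subgroup.mem_sup.mp hx
  have hne : n ∈ Evg V := by
    have := Qg_le_Evg V hq
    exact (Subgroup.mul_mem_cancel_left _ this).mp hxe
  refine Subgroup.mul_mem _ hq ?_
  obtain ⟨u, w, h⟩ := hn
  have h0 := n.ne_zero
  rcases lt_trichotomy (V (u ^ 2)) (V (c * w ^ 2)) with hl | hl | hl
  · exfalso
    have hw : w ≠ 0 := by
      rintro rfl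
      simp at hl
    apply hc
    have := V.map_sub_eq_of_lt_right hl
    rw [← h] at this
    obtain ⟨t, ht⟩ := hne
    refine ⟨t / w, ?_⟩
    rw [map_div₀, div_pow, ← ht, this, map_mul, map_pow]
    have : V w ≠ 0 := by simpa using hw
    field_simp
  · by_cases hw : w = 0
    · subst hw
      have : u = 0 := by simpa using hl
      subst this
      simp at h
    · exfalso
      apply hc
      refine ⟨u / w, ?_⟩
      rw [map_mul, map_pow, map_pow] at hl
      have : V w ≠ 0 := by simpa using hw
      rw [map_div₀, div_pow, hl]
      field_simp
  · have hu : u ≠ 0 := by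
      rintro rfl
      simp at hl
    refine ⟨u⁻¹, ?_⟩
    have : (n : K) * u⁻¹ ^ 2 - 1 = - (c * w ^ 2) / u ^ 2 := by rw [h]; field_simp; ring
    rw [h4, this, map_div₀, Valuation.map_neg, div_lt_one₀ (by simp [zero_lt_iff, hu])]
    exact hl

end LocalAbstract

end partPC

section partPD

open IsDedekindDomain NumberField WithZero
set_option linter.unusedSectionVars false

section NF
variable {K : Type*} [Field K] [NumberField K]

/-- local squares at `v` -/
noncomputable abbrev Qv (v : HeightOneSpectrum (𝓞 K)) : Subgroup Kˣ := Qg (v.valuation K)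
/-- even valuation at `v` -/
noncomputable abbrev Ev (v : HeightOneSpectrum (𝓞 K)) : Subgroup Kˣ := Evg (v.valuation K)

lemma exists_exp_lt (γ : ℤᵐ⁰) (h : γ ≠ 0) : ∃ n : ℕ, exp (-(n : ℤ)) < γ := by
  rw [← exp_log h]
  refine ⟨(1 - log γ).toNat, ?_⟩
  rw [exp_lt_exp]
  have := Int.self_le_toNat (1 - log γ)
  omega

lemma exp_of_ne_zero (γ : ℤᵐ⁰) (h : γ ≠ 0) : ∃ n : ℤ, γ = exp n := ⟨log γ, (exp_log h).symm⟩

lemma approx (S : Finset (HeightOneSpectrum (𝓞 K))) (a : HeightOneSpectrum (𝓞 K) → Kˣ) :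
    ∃ x : Kˣ, ∀ v ∈ S, x * (a v)⁻¹ ∈ Qv v := by
  classical
  rcases S.eq_empty_or_nonempty with rfl | hne
  · exact ⟨1, by simp⟩
  have h1 : ∀ v, ∃ n d : 𝓞 K, d ≠ 0 ∧ n ≠ 0 ∧ (a v : K) = algebraMap (𝓞 K) K n / algebraMap (𝓞 K) K d := by
    intro v
    obtain ⟨n, d, hd, h⟩ := IsFractionRing.div_surjective (A := 𝓞 K) (a v : K)
    refine ⟨n, d, nonZeroDivisors.ne_zero hd, ?_, h.symm⟩
    rintro rfl
    have := (a v).ne_zero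
    simp at h
    exact this h.symm
  choose n d hd hn h using h1
  have h2 : ∀ v : HeightOneSpectrum (𝓞 K), ∃ e : ℕ, exp (-(e : ℤ)) < v.valuation K (4 * algebraMap (𝓞 K) K (n v * d v)) := by
    intro v
    apply exists_exp_lt
    simp [hn v, hd v]
  choose e he using h2
  obtain ⟨y, hy⟩ := IsDedekindDomain.exists_forall_sub_mem_ideal (s := S) (fun v => v.asIdeal) e
    (fun v _ => v.prime) (fun v _ w _ hvw h' => hvw (HeightOneSpectrum.ext h')) (fun v => n v.1 * d v.1)
  have h3 : ∀ v ∈ S, v.valuation K (algebraMap (𝓞 K) K y - algebraMap (𝓞 K) K (n v * d v)) < v.valuation K (4 * algebraMap (𝓞 K) K (n v * d v)) := by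
    intro v hv
    refine lt_of_le_of_lt ?_ (he v)
    rw [← map_sub, HeightOneSpectrum.valuation_of_algebraMap, HeightOneSpectrum.intValuation_le_pow_iff_mem]
    exact hy v hv
  have hy0 : algebraMap (𝓞 K) K y ≠ 0 := by
    obtain ⟨v, hv⟩ := hne
    intro h0
    have := h3 v hv
    rw [h0, zero_sub, Valuation.map_neg] at this
    have h4 := val_four_le_one (v.valuation K)
    rw [map_mul _ (4 : K)] at this
    exact absurd this (not_lt.mpr (mul_le_of_le_one_left' h4))
  refine ⟨Units.mk0 _ hy0, fun v hv => ?_⟩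
  have hn' : algebraMap (𝓞 K) K (n v) ≠ 0 := by simpa using hn v
  have hd' : algebraMap (𝓞 K) K (d v) ≠ 0 := by simpa using hd v
  have h4 := Qg_of_near (v.valuation K) (x := Units.mk0 _ hy0)
    (a := Units.mk0 (algebraMap (𝓞 K) K (n v * d v)) (by simp [hn v, hd v])) (h3 v hv)
  have h5 := Subgroup.mul_mem _ h4 (sq_mem_Qg (v.valuation K) (Units.mk0 _ hd'))
  convert h5 using 1
  ext
  push_cast
  rw [h v]
  simp only [Units.val_mk0]
  field_simp

/-- criterion -/
lemma mem_Qv_iff (v : HeightOneSpectrum (𝓞 K)) (h2 : v.valuation K 2 = 1) (x : Kˣ) (a : 𝓞 K) (ha : a ∉ v.asIdeal)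
    (hxa : v.valuation K (x - algebraMap (𝓞 K) K a) < 1) : x ∈ Qv v ↔ IsSquare (Ideal.Quotient.mk v.asIdeal a) := by
  have h4 : v.valuation K 4 = 1 := by rw [val_four, h2, one_pow]
  have hva : v.valuation K (algebraMap (𝓞 K) K a) = 1 := by
    exact (HeightOneSpectrum.valuation_eq_one_iff_notMem v).mpr ha
  have hvx : v.valuation K x = 1 := by
    have := Valuation.map_add_eq_of_lt_right (v.valuation K) (x := x - algebraMap (𝓞 K) K a) (y := algebraMap (𝓞 K) K a) (by rw [hva]; exact hxa)
    rw [hva] at this; simpa using this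
  constructor
  · rintro ⟨y, hy⟩
    rw [h4] at hy
    have h1 := val_eq_one_of_sub_lt _ hy
    rw [map_mul, hvx, one_mul, map_pow] at h1
    have hvy : v.valuation K y = 1 := by
      exact (pow_eq_one_iff.mp h1).resolve_right (by norm_num)
    obtain ⟨b, hb⟩ := v.exists_valuation_sub_lt_of_integer (K := K) hvy.le (γ := 1) 
    have hvb : v.valuation K (algebraMap (𝓞 K) K b) ≤ 1 := v.valuation_le_one b
    have key : v.valuation K (algebraMap (𝓞 K) K (a * b ^ 2 - 1)) < 1 := by
      have e : algebraMap (𝓞 K) K (a * b ^ 2 - 1) = (x * y ^ 2 - 1) - (x - algebraMap (𝓞 K) K a) * y ^ 2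
          - algebraMap (𝓞 K) K a * (y - algebraMap (𝓞 K) K b) * (y + algebraMap (𝓞 K) K b) := by
        push_cast; ring
      rw [e]
      refine Valuation.map_sub_lt _ (Valuation.map_sub_lt _ hy ?_) ?_
      · rw [map_mul, map_pow, hvy]; simpa using hxa
      · rw [map_mul, map_mul, hva, one_mul]
        have : v.valuation K (y + algebraMap (𝓞 K) K b) ≤ 1 := Valuation.map_add_le _ hvy.le hvb
        exact mul_lt_one_of_lt_of_le (by rw [Valuation.map_sub_swap]; simpa using hb) this
    rw [HeightOneSpectrum.valuation_lt_one_iff_mem] at key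
    have key2 : Ideal.Quotient.mk v.asIdeal a * Ideal.Quotient.mk v.asIdeal b ^ 2 = 1 := by
      rw [← map_pow, ← map_mul, ← map_one (Ideal.Quotient.mk v.asIdeal), Ideal.Quotient.eq]; exact key
    refine ⟨Ideal.Quotient.mk v.asIdeal a * Ideal.Quotient.mk v.asIdeal b, ?_⟩
    linear_combination (-(Ideal.Quotient.mk v.asIdeal a)) * key2
  · rintro ⟨b, hb⟩
    obtain ⟨b, rfl⟩ := Ideal.Quotient.mk_surjective b
    have hab : a - b * b ∈ v.asIdeal := by rw [← Ideal.Quotient.eq, map_mul]; exact hb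
    have hvb0 : b ∉ v.asIdeal := fun h => ha (by
      have := v.asIdeal.add_mem hab (v.asIdeal.mul_mem_left b h); simpa using this)
    have hvb : v.valuation K (algebraMap (𝓞 K) K b) = 1 := 
      (HeightOneSpectrum.valuation_eq_one_iff_notMem v).mpr hvb0
    have hb0 : algebraMap (𝓞 K) K b ≠ 0 := by
      intro h; rw [h] at hvb; simp at hvb
    refine ⟨(algebraMap (𝓞 K) K b)⁻¹, ?_⟩
    have e : (x : K) * (algebraMap (𝓞 K) K b)⁻¹ ^ 2 - 1 = ((x - algebraMap (𝓞 K) K a) + algebraMap (𝓞 K) K (a - b * b)) / algebraMap (𝓞 K) K b ^ 2 := by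
      field_simp; simp only [map_sub, map_mul]; ring
    rw [e, map_div₀, map_pow, hvb, h4, one_pow, div_one]
    exact Valuation.map_add_lt _ hxa ((v.valuation_lt_one_iff_mem _).mpr hab)

lemma exists_int_unit (v : HeightOneSpectrum (𝓞 K)) (x : K) (hx : v.valuation K x = 1) :
    ∃ a : 𝓞 K, a ∉ v.asIdeal ∧ v.valuation K (x - algebraMap (𝓞 K) K a) < 1 := by
  obtain ⟨a, ha⟩ := v.exists_valuation_sub_lt_of_integer (K := K) hx.le (γ := 1)
  have ha : v.valuation K (x - algebraMap (𝓞 K) K a) < 1 := by rw [Valuation.map_sub_swap]; simpa using ha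
  refine ⟨a, fun h => ?_, ha⟩
  have h1 := (v.valuation_lt_one_iff_mem (K := K) _).mpr h
  have := Valuation.map_add_lt _ ha h1
  rw [sub_add_cancel, hx] at this
  exact this.false

noncomputable instance residueField (v : HeightOneSpectrum (𝓞 K)) : Field (𝓞 K ⧸ v.asIdeal) :=
  haveI := v.isMaximal
  Ideal.Quotient.field v.asIdeal

instance residueFinite (v : HeightOneSpectrum (𝓞 K)) : Finite (𝓞 K ⧸ v.asIdeal) :=
  Ideal.finiteQuotientOfFreeOfNeBot _ v.ne_bot

lemma ringChar_ne_two (v : HeightOneSpectrum (𝓞 K)) (h2 : v.valuation K 2 = 1) : ringChar (𝓞 K ⧸ v.asIdeal) ≠ 2 := by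
  intro h
  have h3 : ((2 : ℕ) : 𝓞 K ⧸ v.asIdeal) = 0 := by rw [← h]; exact ringChar.Nat.cast_ringChar
  have h4 : (2 : 𝓞 K) ∈ v.asIdeal := by
    rw [← Ideal.Quotient.eq_zero_iff_mem]; exact (map_ofNat (Ideal.Quotient.mk v.asIdeal) 2).trans h3
  have := (v.valuation_lt_one_iff_mem (K := K) _).mpr h4
  change v.valuation K (algebraMap (𝓞 K) K 2) < 1 at this
  rw [map_ofNat (algebraMap (𝓞 K) K), h2] at this
  exact this.false

lemma unit_mul_mem_Qv (v : HeightOneSpectrum (𝓞 K)) (h2 : v.valuation K 2 = 1) (x y : Kˣ)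
    (hx : v.valuation K x = 1) (hy : v.valuation K y = 1) (hxQ : x ∉ Qv v) (hyQ : y ∉ Qv v) : x * y ∈ Qv v := by
  classical
  obtain ⟨a, ha, hxa⟩ := exists_int_unit v x hx
  obtain ⟨b, hb, hyb⟩ := exists_int_unit v y hy
  rw [mem_Qv_iff v h2 x a ha hxa] at hxQ
  rw [mem_Qv_iff v h2 y b hb hyb] at hyQ
  have := v.isPrime
  have hab : a * b ∉ v.asIdeal := fun h => (this.mem_or_mem h).elim ha hb
  have := Fintype.ofFinite (𝓞 K ⧸ v.asIdeal)
  rw [mem_Qv_iff v h2 (x * y) (a * b) hab]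
  · rw [← quadraticChar_neg_one_iff_not_isSquare] at hxQ hyQ
    have : Ideal.Quotient.mk v.asIdeal (a * b) ≠ 0 := by rwa [Ne, Ideal.Quotient.eq_zero_iff_mem]
    rw [← quadraticChar_one_iff_isSquare this, map_mul, map_mul, hxQ, hyQ]; norm_num
  · have e : ((x * y : Kˣ) : K) - algebraMap (𝓞 K) K (a * b) = (x - algebraMap (𝓞 K) K a) * y + algebraMap (𝓞 K) K a * (y - algebraMap (𝓞 K) K b) := by
      push_cast; ring
    rw [e]
    refine Valuation.map_add_lt _ ?_ ?_
    · rw [map_mul, hy, mul_one]; exact hxa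
    · rw [map_mul]; exact (mul_le_of_le_one_left' (v.valuation_le_one a)).trans_lt hyb

lemma exists_nonsquare_unit (v : HeightOneSpectrum (𝓞 K)) (h2 : v.valuation K 2 = 1) :
    ∃ x : Kˣ, v.valuation K x = 1 ∧ x ∉ Qv v := by
  obtain ⟨b, hb⟩ := FiniteField.exists_nonsquare (ringChar_ne_two v h2)
  obtain ⟨b, rfl⟩ := Ideal.Quotient.mk_surjective b
  have hbv : b ∉ v.asIdeal := by
    intro h
    apply hb
    rw [Ideal.Quotient.eq_zero_iff_mem.mpr h]
    exact IsSquare.zero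
  have hvb : v.valuation K (algebraMap (𝓞 K) K b) = 1 := 
      (HeightOneSpectrum.valuation_eq_one_iff_notMem v).mpr hbv
  have hb0 : algebraMap (𝓞 K) K b ≠ 0 := by
      intro h; rw [h] at hvb; simp at hvb
  refine ⟨Units.mk0 _ hb0, hvb, ?_⟩
  rwa [mem_Qv_iff v h2 (Units.mk0 _ hb0) b hbv (by simp)]

lemma not_mem_Ev (v : HeightOneSpectrum (𝓞 K)) (x : Kˣ) (hx : v.valuation K x = exp (-1 : ℤ)) : x ∉ Ev v := by
  rintro ⟨t, ht⟩
  have h0 : v.valuation K t ≠ 0 := by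
    intro h
    rw [h, hx] at ht
    simp at ht
  obtain ⟨n, hn⟩ := exp_of_ne_zero _ h0
  rw [hx, hn, ← exp_nsmul, exp_inj] at ht
  simp at ht
  omega

lemma exists_nonnorm (v : HeightOneSpectrum (𝓞 K)) (h2 : v.valuation K 2 = 1) (c : Kˣ) (hc : c ∉ Qv v) :
    ∃ x : Kˣ, x ∉ Qv v ⊔ Nm (c : K) := by
  by_cases hce : c ∈ Ev v
  · obtain ⟨π, hπ⟩ := v.valuation_exists_uniformizer K
    have h0 : π ≠ 0 := by
      rintro rfl; simp [eq_comm (a := (0 : ℤᵐ⁰)), exp_ne_zero] at hπ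
    refine ⟨Units.mk0 π h0, fun h => ?_⟩
    exact not_mem_Ev v (Units.mk0 π h0) hπ (localA _ h2 c hce hc h)
  · obtain ⟨x, hx, hxQ⟩ := exists_nonsquare_unit v h2
    exact ⟨x, fun h => hxQ (localB _ h2 c hce h ⟨1, by simp [hx]⟩)⟩

end NF

end partPD

section partPE

open IsDedekindDomain NumberField WithZero
set_option linter.unusedSectionVars false

section NF
variable {K : Type*} [Field K] [NumberField K]

lemma lt_exp_iff' (γ : ℤᵐ⁰) (m : ℕ) : γ < exp (-(m : ℤ)) ↔ γ ≤ exp (-((m + 1 : ℕ) : ℤ)) := by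
  by_cases h : γ = 0
  · subst h; simp [zero_lt_iff]
  · obtain ⟨n, rfl⟩ := exp_of_ne_zero γ h
    rw [exp_lt_exp, exp_le_exp]; push_cast; omega

lemma mem_pow_iff_lt (v : HeightOneSpectrum (𝓞 K)) (m : ℕ) (a : 𝓞 K) :
    a ∈ v.asIdeal ^ (m + 1) ↔ v.valuation K (algebraMap (𝓞 K) K a) < exp (-(m : ℤ)) := by
  rw [lt_exp_iff', HeightOneSpectrum.valuation_of_algebraMap, HeightOneSpectrum.intValuation_le_pow_iff_mem]

lemma Ev_index (v : HeightOneSpectrum (𝓞 K)) : (Ev v).index = 2 := by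
  rw [Subgroup.index_eq_two_iff]
  obtain ⟨π, hπ⟩ := v.valuation_exists_uniformizer K
  have h0 : π ≠ 0 := by
    rintro rfl; simp [eq_comm (a := (0 : ℤᵐ⁰)), exp_ne_zero] at hπ
  have hch : ∀ (x : Kˣ) (n : ℤ), v.valuation K x = exp n → (x ∈ Ev v ↔ Even n) := by
    intro x n hn
    constructor
    · rintro ⟨t, ht⟩
      have h0 : v.valuation K t ≠ 0 := by
        intro h
        rw [h, hn] at ht
        simp at ht
      obtain ⟨m, hm⟩ := exp_of_ne_zero _ h0
      rw [hn, hm, ← exp_nsmul, exp_inj] at ht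
      exact ⟨m, by simpa [two_mul] using ht⟩
    · rintro ⟨m, rfl⟩
      obtain ⟨t, ht⟩ := v.valuation_surjective K (exp m)
      exact ⟨t, by rw [hn, ht, ← exp_nsmul]; simp [two_mul]⟩
  refine ⟨Units.mk0 π h0, fun b => ?_⟩
  obtain ⟨n, hn⟩ := exp_of_ne_zero (v.valuation K b) (by simp)
  rw [hch b n hn, hch (b * Units.mk0 π h0) (n + -1) (by
    push_cast; rw [map_mul, hn, Units.val_mk0, hπ, ← exp_add])]
  rw [xor_iff_iff_not]
  have : ¬ Even (-1 : ℤ) := by decide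
  rw [Int.even_add]
  tauto

lemma card_quot_pow (v : HeightOneSpectrum (𝓞 K)) (m : ℕ) :
    Nat.card (𝓞 K ⧸ v.asIdeal ^ m) = (Ideal.absNorm v.asIdeal) ^ m := by
  rw [← map_pow, Ideal.absNorm_apply, Submodule.cardQuot_apply]

lemma local_torsion (v : HeightOneSpectrum (𝓞 K)) (e : ℕ) (he : v.valuation K 2 = exp (-(e : ℤ))) :
    Nat.card (sqHom (𝓞 K ⧸ v.asIdeal ^ (2 * e + 1))ˣ).ker ≤ 2 * (Ideal.absNorm v.asIdeal) ^ e := by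
  classical
  set J := v.asIdeal ^ (2 * e + 1) with hJ
  set J' := v.asIdeal ^ (e + 1) with hJ'
  have hJJ : J ≤ J' := Ideal.pow_le_pow_right (by omega)
  have : Finite (𝓞 K ⧸ J) := Ideal.finiteQuotientOfFreeOfNeBot _ (pow_ne_zero _ v.ne_bot)
  have : Finite (𝓞 K ⧸ J') := Ideal.finiteQuotientOfFreeOfNeBot _ (pow_ne_zero _ v.ne_bot)
  set φ := (Ideal.Quotient.factor hJJ).toAddMonoidHom
  have hsurj : Function.Surjective φ := Ideal.Quotient.factor_surjective hJJ
  have hker : Nat.card φ.ker = Ideal.absNorm v.asIdeal ^ e := by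
    have h1 := φ.ker.card_mul_index
    rw [AddSubgroup.index_ker, AddMonoidHom.range_eq_top.mpr hsurj, AddSubgroup.card_top, card_quot_pow, card_quot_pow] at h1
    have hpos : 0 < Ideal.absNorm v.asIdeal ^ (e + 1) := by
      apply pow_pos
      rw [Nat.pos_iff_ne_zero, Ne, Ideal.absNorm_eq_zero_iff]; exact v.ne_bot
    apply Nat.eq_of_mul_eq_mul_right hpos
    rw [h1, ← pow_add]; congr 1; omega
  rw [← hker]
  have h2 : 2 * Nat.card φ.ker = Nat.card (Bool × φ.ker) := by simp [Nat.card_prod]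
  rw [h2]
  have hpm : ∀ u : (sqHom (𝓞 K ⧸ J)ˣ).ker, φ (u.1.1 - 1) = 0 ∨ φ (u.1.1 + 1) = 0 := by
    intro u
    obtain ⟨b, hb⟩ := Ideal.Quotient.mk_surjective u.1.1
    have hu := congrArg Units.val (MonoidHom.mem_ker.mp u.2)
    have hu : u.1.1 ^ 2 = 1 := by simpa using hu
    rw [← hb] at hu ⊢
    have hbJ : (b - 1) * (b + 1) ∈ J := by
      have : b ^ 2 - 1 ∈ J := by rw [← Ideal.Quotient.eq]; simpa using hu
      convert this using 1; ring
    rw [hJ, mem_pow_iff_lt, map_mul, map_mul] at hbJ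
    have : v.valuation K (algebraMap (𝓞 K) K (b - 1)) < exp (-(e : ℤ)) ∨ v.valuation K (algebraMap (𝓞 K) K (b + 1)) < exp (-(e : ℤ)) := by
      by_contra! hcon
      have h3 := mul_le_mul' hcon.1 hcon.2
      rw [← exp_add] at h3
      have h4 := h3.trans_lt hbJ
      rw [exp_lt_exp] at h4
      push_cast at h4; omega
    rw [← mem_pow_iff_lt, ← mem_pow_iff_lt] at this
    rcases this with h | h
    · left
      change Ideal.Quotient.factor hJJ (Ideal.Quotient.mk J b - 1) = 0
      rw [← map_one (Ideal.Quotient.mk J), ← map_sub, Ideal.Quotient.factor_mk, Ideal.Quotient.eq_zero_iff_mem]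
      exact h
    · right
      change Ideal.Quotient.factor hJJ (Ideal.Quotient.mk J b + 1) = 0
      rw [← map_one (Ideal.Quotient.mk J), ← map_add, Ideal.Quotient.factor_mk, Ideal.Quotient.eq_zero_iff_mem]
      exact h
  refine Nat.card_le_card_of_injective (fun u => if h : φ (u.1.1 - 1) = 0 then (true, ⟨u.1.1 - 1, h⟩) else
    (false, ⟨u.1.1 + 1, (hpm u).resolve_left h⟩)) ?_
  intro u u' h
  apply Subtype.ext
  apply Units.ext
  simp only at h
  split_ifs at h with h1 h2 h2
  · have h3 := congrArg (fun z => z.2.1) h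
    exact sub_left_injective h3
  · simp at h
  · simp at h
  · have h3 := congrArg (fun z => z.2.1) h
    exact add_left_injective _ h3

lemma local_index (v : HeightOneSpectrum (𝓞 K)) (e : ℕ) (he : v.valuation K 2 = exp (-(e : ℤ))) :
    (Qv v).index ≠ 0 ∧ (Qv v).index ≤ 4 * (Ideal.absNorm v.asIdeal) ^ e := by
  classical
  set J := v.asIdeal ^ (2 * e + 1) with hJ
  have hJv : J ≤ v.asIdeal := Ideal.pow_le_self (by omega)
  have : Finite (𝓞 K ⧸ J) := Ideal.finiteQuotientOfFreeOfNeBot _ (pow_ne_zero _ v.ne_bot)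
  have h4 : v.valuation K 4 = exp (-((2 * e : ℕ) : ℤ)) := by
    rw [val_four, he, ← exp_nsmul]; congr 1; simp
  have hmem : ∀ a : 𝓞 K, a ∈ J ↔ v.valuation K (algebraMap (𝓞 K) K a) < v.valuation K 4 := by
    intro a; rw [h4, hJ, mem_pow_iff_lt]
  choose a ha using fun u : (𝓞 K ⧸ J)ˣ => Ideal.Quotient.mk_surjective u.1
  have hav : ∀ u, a u ∉ v.asIdeal := by
    intro u hu
    have h1 : a u * a u⁻¹ - 1 ∈ J := by
      rw [← Ideal.Quotient.eq, map_mul, ha, ha]; simp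
    have h2 := v.asIdeal.sub_mem (v.asIdeal.mul_mem_right (a u⁻¹) hu) (hJv h1)
    simp at h2
    exact v.isPrime.ne_top (Ideal.eq_top_of_isUnit_mem _ h2 isUnit_one)
  have hval : ∀ u, v.valuation K (algebraMap (𝓞 K) K (a u)) = 1 := fun u =>
    (HeightOneSpectrum.valuation_eq_one_iff_notMem v).mpr (hav u)
  have ha0 : ∀ u, algebraMap (𝓞 K) K (a u) ≠ 0 := fun u h => by
    have := hval u; rw [h] at this; simp at this
  let g : (𝓞 K ⧸ J)ˣ → Kˣ := fun u => Units.mk0 _ (ha0 u)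
  have hg : ∀ u u', g (u * u') * (g u * g u')⁻¹ ∈ Qv v := by
    intro u u'
    apply Qg_of_near
    have : ((g (u * u') : Kˣ) : K) - ((g u * g u' : Kˣ) : K) = algebraMap (𝓞 K) K (a (u * u') - a u * a u') := by
      simp [g]
    rw [this, map_mul]
    have h1 : v.valuation K ((g u * g u' : Kˣ) : K) = 1 := by simp [g, hval]
    rw [h1, mul_one, ← hmem, ← Ideal.Quotient.eq, map_mul, ha, ha, ha]; simp
  let Ψ : (𝓞 K ⧸ J)ˣ →* Kˣ ⧸ Qv v := MonoidHom.mk' (fun u => (g u : Kˣ ⧸ Qv v)) (fun u u' => by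
    rw [← QuotientGroup.mk_mul, eq_comm, QuotientGroup.eq, mul_comm]; exact hg u u')
  have hsq : (sqHom (𝓞 K ⧸ J)ˣ).range ≤ Ψ.ker := by
    rintro _ ⟨u, rfl⟩
    rw [MonoidHom.mem_ker, powMonoidHom_apply, map_pow]
    change ((g u : Kˣ ⧸ Qv v)) ^ 2 = 1
    rw [← QuotientGroup.mk_pow, QuotientGroup.eq_one_iff]
    exact sq_mem_Qg _ _
  have hrange : (Ev v).map (QuotientGroup.mk' (Qv v)) ≤ Ψ.range := by
    rintro _ ⟨x, ⟨t, ht⟩, rfl⟩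
    have ht0 : t ≠ 0 := by
      rintro rfl; simp at ht
    have hxt : v.valuation K ((x : K) / t ^ 2) = 1 := by
      rw [map_div₀, ht, map_pow, div_self]; simpa using ht0
    obtain ⟨b, hb⟩ := v.exists_valuation_sub_lt_of_integer (K := K) hxt.le (γ := Units.mk0 (v.valuation K 4) (by simp))
    have hb : v.valuation K (algebraMap (𝓞 K) K b - x / t ^ 2) < v.valuation K 4 := hb
    have hbv : v.valuation K (algebraMap (𝓞 K) K b) = 1 := by
      have := Valuation.map_add_eq_of_lt_right (v.valuation K) (x := algebraMap (𝓞 K) K b - x / t ^ 2) (y := x / t ^ 2) (by rw [hxt]; exact hb.trans_le (val_four_le_one _))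
      rw [hxt] at this; simpa using this
    have hbI : b ∉ v.asIdeal := (HeightOneSpectrum.valuation_eq_one_iff_notMem v).mp hbv
    have hbu : IsUnit (Ideal.Quotient.mk J b) := by
      rw [Ideal.Quotient.isUnit_mk_pow_iff_notMem]
      · exact hbI
      · omega
    obtain ⟨u, hu⟩ := hbu
    refine ⟨u, ?_⟩
    change (g u : Kˣ ⧸ Qv v) = (x : Kˣ ⧸ Qv v)
    rw [eq_comm, QuotientGroup.eq, mul_comm]
    have h1 : g u * (x * (Units.mk0 t ht0)⁻¹ ^ 2)⁻¹ ∈ Qv v := by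
      apply Qg_of_near
      have e1 : ((x * (Units.mk0 t ht0)⁻¹ ^ 2 : Kˣ) : K) = x / t ^ 2 := by push_cast; simp [div_eq_mul_inv]
      rw [e1, map_mul, hxt, mul_one]
      have : ((g u : Kˣ) : K) - x / t ^ 2 = algebraMap (𝓞 K) K (a u - b) + (algebraMap (𝓞 K) K b - x / t ^ 2) := by
        simp [g]
      rw [this]
      refine Valuation.map_add_lt _ ?_ hb
      rw [← hmem, ← Ideal.Quotient.eq, ha, hu]
    have h2 := Subgroup.mul_mem _ h1 (sq_mem_Qg (v.valuation K) (Units.mk0 t ht0)⁻¹)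
    convert h2 using 1
    rw [mul_inv, mul_assoc, mul_assoc]; simp
  have hfin : Finite Ψ.range := Set.finite_range Ψ
  have hc : (Qv v).relIndex (Ev v) = Nat.card ((Ev v).map (QuotientGroup.mk' (Qv v))) := by
    rw [← Subgroup.relIndex_ker, QuotientGroup.ker_mk']
  have hfin2 : Finite ((Ev v).map (QuotientGroup.mk' (Qv v))) := Finite.of_injective _ (Subgroup.inclusion_injective hrange)
  have hle : (Qv v).relIndex (Ev v) ≤ 2 * (Ideal.absNorm v.asIdeal) ^ e := by
    rw [hc]
    calc _ ≤ Nat.card Ψ.range := Nat.card_le_card_of_injective _ (Subgroup.inclusion_injective hrange)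
      _ = Ψ.ker.index := (Subgroup.index_ker Ψ).symm
      _ ≤ (sqHom (𝓞 K ⧸ J)ˣ).range.index := Nat.le_of_dvd (Nat.pos_of_ne_zero Subgroup.FiniteIndex.index_ne_zero) (Subgroup.index_dvd_of_le hsq)
      _ = Nat.card (sqHom (𝓞 K ⧸ J)ˣ).ker := by rw [Subgroup.index_range]
      _ ≤ _ := local_torsion v e he
  have hmul := Subgroup.relIndex_mul_index (Qg_le_Evg (v.valuation K))
  rw [Ev_index] at hmul
  constructor
  · rw [← hmul, hc]
    have := Nat.card_pos (α := ((Ev v).map (QuotientGroup.mk' (Qv v))))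
    positivity
  · rw [← hmul]; linarith

lemma prod_norm_two (S : Finset (HeightOneSpectrum (𝓞 K))) (hS : ∀ v : HeightOneSpectrum (𝓞 K), v.valuation K 2 ≠ 1 → v ∈ S) :
    ∃ e : HeightOneSpectrum (𝓞 K) → ℕ, (∀ v, v.valuation K 2 = exp (-(e v : ℤ))) ∧
      ∏ v ∈ S, (Ideal.absNorm v.asIdeal) ^ e v = 2 ^ Module.finrank ℚ K := by
  classical
  set I : Ideal (𝓞 K) := Ideal.span {2} with hI
  have hI0 : I ≠ 0 := by simp [hI]
  have he : ∀ v : HeightOneSpectrum (𝓞 K), v.valuation K 2 = exp (-(((Associates.mk v.asIdeal).count (Associates.mk I).factors : ℕ) : ℤ)) := by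
    intro v
    have : (2 : K) = algebraMap (𝓞 K) K 2 := (map_ofNat _ 2).symm
    rw [this, HeightOneSpectrum.valuation_of_algebraMap, HeightOneSpectrum.intValuation_if_neg _ (by norm_num)]
  refine ⟨fun v => (Associates.mk v.asIdeal).count (Associates.mk I).factors, he, ?_⟩
  have h1 := Ideal.finprod_heightOneSpectrum_factorization hI0
  rw [finprod_eq_prod_of_mulSupport_subset (s := S)] at h1
  · have h2 := congrArg Ideal.absNorm h1
    rw [map_prod] at h2
    simp only [HeightOneSpectrum.maxPowDividing, map_pow] at h2
    rw [h2, hI, Ideal.absNorm_span_singleton]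
    have : (2 : 𝓞 K) = algebraMap ℤ (𝓞 K) 2 := (map_ofNat _ 2).symm
    rw [this, Algebra.norm_algebraMap, RingOfIntegers.rank]
    simp [Int.natAbs_pow]
  · intro v hv
    apply hS
    rw [he]
    intro h
    apply hv
    rw [← exp_zero, exp_inj] at h
    have h : (Associates.mk v.asIdeal).count (Associates.mk I).factors = 0 := by omega
    simp [HeightOneSpectrum.maxPowDividing, h]

lemma index_bound (S : Finset (HeightOneSpectrum (𝓞 K))) (hS : ∀ v : HeightOneSpectrum (𝓞 K), v.valuation K 2 ≠ 1 → v ∈ S) :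
    (⨅ v ∈ S, Qv v).index ≠ 0 ∧ (⨅ v ∈ S, Qv v).index ≤ 2 ^ (2 * S.card + Module.finrank ℚ K) := by
  classical
  obtain ⟨e, he, hprod⟩ := prod_norm_two S hS
  have key : ∀ T : Finset (HeightOneSpectrum (𝓞 K)), (⨅ v ∈ T, Qv v).index ≠ 0 ∧ (⨅ v ∈ T, Qv v).index ≤ ∏ v ∈ T, (4 * (Ideal.absNorm v.asIdeal) ^ e v) := by
    intro T
    induction T using Finset.induction_on with
    | empty => simp
    | insert v T hv ih =>
      rw [Finset.iInf_insert, Finset.prod_insert hv]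
      obtain ⟨h1, h2⟩ := local_index v (e v) (he v)
      exact ⟨Subgroup.index_inf_ne_zero h1 ih.1, Subgroup.index_inf_le.trans (Nat.mul_le_mul h2 ih.2)⟩
  refine ⟨(key S).1, (key S).2.trans (le_of_eq ?_)⟩
  rw [Finset.prod_mul_distrib, hprod, Finset.prod_const, pow_add, pow_mul]; norm_num

end NF

end partPE

section partPF

open IsDedekindDomain NumberField WithZero
set_option linter.unusedSectionVars false

lemma ext_int_fg {A : Type*} [CommGroup A] (f : A →* Multiplicative ℤ) (hf : f ≠ 1) (h : Group.FG f.ker) :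
    Group.FG A ∧ rk A = rk f.ker + 1 := by
  set L := (MonoidHom.toAdditive f).toIntLinearMap with hL
  have h1 : Module.Finite ℤ (LinearMap.ker L) := fg_additive f.ker
  have h2 : Module.Finite ℤ (Additive A ⧸ LinearMap.ker L) := by
    have : Module.Finite ℤ (LinearMap.range L) := 
      Module.Finite.equiv (LinearEquiv.refl ℤ (LinearMap.range L : Submodule ℤ ℤ))
    exact Module.Finite.equiv L.quotKerEquivRange.symm
  have h3 : Module.Finite ℤ (Additive A) := Module.Finite.of_submodule_quotient (LinearMap.ker L)
  have h4 : Group.FG A := GroupFG.iff_add_fg.mpr (Module.Finite.iff_addGroup_fg.mp h3)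
  refine ⟨h4, ?_⟩
  rw [← rk_range_add_rk_ker f, add_comm]
  congr 1
  let N : Submodule ℤ ℤ := LinearMap.range L
  have hN : rk f.range = Module.finrank ℤ N := rfl
  rw [hN]
  have hle : Module.finrank ℤ N ≤ 1 := by
    have := Submodule.finrank_le N
    simpa using this
  have hne : N ≠ ⊥ := by
    intro hN
    apply hf
    ext x
    have : L (Additive.ofMul x) ∈ N := ⟨_, rfl⟩
    rw [hN] at this
    exact this
  have hnt : Nontrivial N := Submodule.nontrivial_iff_ne_bot.mpr hne
  have : 0 < Module.finrank ℤ N := Module.finrank_pos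
  omega

section NF
variable {K : Type*} [Field K] [NumberField K]

/-- `S`-units -/
def SU (S : Finset (HeightOneSpectrum (𝓞 K))) : Subgroup Kˣ where
  carrier := {x | ∀ v ∉ S, v.valuation K x = 1}
  one_mem' := fun v _ => by simp
  mul_mem' := fun {x y} hx hy v hv => by push_cast; rw [map_mul, hx v hv, hy v hv, one_mul]
  inv_mem' := fun {x} hx v hv => by push_cast; rw [map_inv₀, hx v hv, inv_one]

lemma mem_SU {S : Finset (HeightOneSpectrum (𝓞 K))} {x : Kˣ} : x ∈ SU S ↔ ∀ v ∉ S, v.valuation K x = 1 := Iff.rfl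

lemma SU_mono {S T : Finset (HeightOneSpectrum (𝓞 K))} (h : S ⊆ T) : SU S ≤ SU T :=
  fun _ hx v hv => hx v fun hv' => hv (h hv')

lemma SU_empty : SU (∅ : Finset (HeightOneSpectrum (𝓞 K))) = (Units.map (algebraMap (𝓞 K) K : 𝓞 K →* K)).range := by
  ext x
  constructor
  · intro hx
    obtain ⟨a, ha⟩ := HeightOneSpectrum.mem_integers_of_valuation_le_one K (x : K) (R := 𝓞 K) (fun v => (hx v (by simp)).le)
    obtain ⟨b, hb⟩ := HeightOneSpectrum.mem_integers_of_valuation_le_one K ((x⁻¹ : Kˣ) : K) (R := 𝓞 K)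
      (fun v => ((SU ∅).inv_mem hx v (by simp)).le)
    have hab : a * b = 1 := by
      apply FaithfulSMul.algebraMap_injective (𝓞 K) K
      rw [map_mul, ha, hb, map_one]; simp
    exact ⟨⟨a, b, hab, by rw [mul_comm, hab]⟩, Units.ext ha⟩
  · rintro ⟨u, rfl⟩ v _
    have h1 := v.valuation_le_one (K := K) (u : 𝓞 K)
    have h2 := v.valuation_le_one (K := K) ((u⁻¹ : (𝓞 K)ˣ) : 𝓞 K)
    have h3 : v.valuation K (algebraMap (𝓞 K) K u) * v.valuation K (algebraMap (𝓞 K) K ((u⁻¹ : (𝓞 K)ˣ) : 𝓞 K)) = 1 := by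
      rw [← map_mul, ← map_mul]; simp
    exact eq_one_of_one_le_mul_left h1 h2 h3.ge

lemma exists_prime_gen (v : HeightOneSpectrum (𝓞 K)) : ∃ x : Kˣ, v.valuation K x ≠ 1 ∧ ∀ w ≠ v, w.valuation K x = 1 := by
  classical
  have h0 : v.asIdeal ≠ ⊥ := v.ne_bot
  set I : nonZeroDivisors (Ideal (𝓞 K)) := ⟨v.asIdeal, mem_nonZeroDivisors_of_ne_zero h0⟩
  have h1 : ClassGroup.mk0 I ^ (Fintype.card (ClassGroup (𝓞 K))) = 1 := pow_card_eq_one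
  rw [← map_pow, ClassGroup.mk0_eq_one_iff] at h1
  set h := Fintype.card (ClassGroup (𝓞 K)) with hh
  have hpos : h ≠ 0 := Fintype.card_ne_zero
  obtain ⟨α, hα⟩ := h1.principal
  have hα : v.asIdeal ^ h = Ideal.span {α} := hα
  have hα0 : α ≠ 0 := by
    rintro rfl
    rw [Ideal.span_singleton_eq_bot.mpr rfl] at hα
    exact pow_ne_zero h h0 hα
  have hα0' : algebraMap (𝓞 K) K α ≠ 0 := by simpa using hα0
  refine ⟨Units.mk0 _ hα0', ?_, ?_⟩
  · have : α ∈ v.asIdeal := by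
      have : α ∈ v.asIdeal ^ h := by rw [hα]; exact Ideal.mem_span_singleton_self α
      exact Ideal.pow_le_self hpos this
    exact ((v.valuation_lt_one_iff_mem (K := K) _).mpr this).ne
  · intro w hw
    rw [Units.val_mk0]
    refine (HeightOneSpectrum.valuation_eq_one_iff_notMem w).mpr fun hm => hw ?_
    have : v.asIdeal ^ h ≤ w.asIdeal := by rw [hα, Ideal.span_singleton_le_iff_mem]; exact hm
    have := (Ideal.IsPrime.pow_le_iff hpos).mp this
    exact HeightOneSpectrum.ext (v.isMaximal.eq_of_le w.isPrime.ne_top this).symm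

lemma SU_fg_rk (S : Finset (HeightOneSpectrum (𝓞 K))) : Group.FG (SU S) ∧ rk (SU S) = Units.rank K + S.card := by
  classical
  induction S using Finset.induction_on with
  | empty =>
    have hinj : Function.Injective (Units.map (algebraMap (𝓞 K) K : 𝓞 K →* K)) :=
      Units.map_injective (FaithfulSMul.algebraMap_injective (𝓞 K) K)
    have e : (𝓞 K)ˣ ≃* SU (∅ : Finset (HeightOneSpectrum (𝓞 K))) :=
      (MonoidHom.ofInjective hinj).trans (MulEquiv.subgroupCongr SU_empty.symm)
    have h0 : Group.FG (𝓞 K)ˣ := Group.fg_iff_monoid_fg.mpr inferInstance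
    constructor
    · exact Group.fg_of_surjective (f := e.toMonoidHom) e.surjective
    · rw [← rk_congr e]; exact Units.finrank_eq K
  | insert v S hv ih =>
    let f : SU (insert v S) →* Multiplicative ℤ := MonoidHom.mk' (fun x => Multiplicative.ofAdd (log (v.valuation K ((x : Kˣ) : K)))) (by
      intro x y
      push_cast
      rw [map_mul, log_mul (by simp) (by simp), ofAdd_add])
    have hf : ∀ x, f x = Multiplicative.ofAdd (log (v.valuation K ((x : Kˣ) : K))) := fun _ => rfl
    have hker : ∀ x : SU (insert v S), x ∈ f.ker ↔ v.valuation K ((x : Kˣ) : K) = 1 := by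
      intro x
      rw [MonoidHom.mem_ker, hf]
      obtain ⟨n, hn⟩ := exp_of_ne_zero (v.valuation K ((x : Kˣ) : K)) (by simp)
      rw [hn, log_exp, ← exp_zero, exp_inj]; rfl
    have e : SU S ≃* f.ker := 
      { toFun := fun x => ⟨⟨x.1, SU_mono (Finset.subset_insert v S) x.2⟩, (hker _).mpr (x.2 v hv)⟩
        invFun := fun x => ⟨x.1.1, fun w hw => by
          by_cases h : w = v
          · subst h; exact (hker _).mp x.2
          · exact x.1.2 w (by simp [h, hw])⟩
        left_inv := fun x => rfl
        right_inv := fun x => rfl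
        map_mul' := fun x y => rfl }
    have hne : f ≠ 1 := by
      obtain ⟨x, hx, hx'⟩ := exists_prime_gen v
      have hxm : x ∈ SU (insert v S) := fun w hw => hx' w (by rintro rfl; simp at hw)
      intro h
      apply hx
      have : (⟨x, hxm⟩ : SU (insert v S)) ∈ f.ker := by rw [h]; rfl
      exact (hker _).mp this
    have := ih.1
    have hkf : Group.FG f.ker := Group.fg_of_surjective (f := e.toMonoidHom) e.surjective
    obtain ⟨h1, h2⟩ := ext_int_fg f hne hkf
    refine ⟨h1, ?_⟩
    rw [h2, ← rk_congr e, ih.2, Finset.card_insert_of_notMem hv]; ring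

instance SU_fg (S : Finset (HeightOneSpectrum (𝓞 K))) : Group.FG (SU S) := (SU_fg_rk S).1

lemma SU_torsion (S : Finset (HeightOneSpectrum (𝓞 K))) : Nat.card (sqHom (SU S)).ker = 2 := by
  have h1 : (-1 : Kˣ) ∈ SU S := fun v _ => by simp
  rw [Nat.card_eq_two_iff]
  refine ⟨1, ⟨⟨-1, h1⟩, ?_⟩, ?_, ?_⟩
  · rw [MonoidHom.mem_ker]; ext; simp
  · intro h
    have h : (1 : Kˣ) = -1 := congrArg (fun x : (sqHom (SU S)).ker => x.1.1) h
    have h : (1 : K) = -1 := by simpa using congrArg Units.val h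
    norm_num at h
  · ext x
    have hx := MonoidHom.mem_ker.mp x.2
    have hx : (x.1.1 : K) ^ 2 = 1 := by
      have := congrArg (fun y : SU S => ((y : Kˣ) : K)) hx
      simpa using this
    simp only [Set.mem_univ, iff_true, Set.mem_insert_iff, Set.mem_singleton_iff]
    have hx2 : (x.1.1 : K) * (x.1.1 : K) = 1 := by rw [← sq]; exact hx
    rcases mul_self_eq_one_iff.mp hx2 with h | h
    · left; apply Subtype.ext; apply Subtype.ext; apply Units.ext; simpa using h
    · right; apply Subtype.ext; apply Subtype.ext; apply Units.ext; simpa using h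

lemma rank_add_one [IsTotallyComplex K] : 2 * (Units.rank K + 1) = Module.finrank ℚ K := by
  rw [IsTotallyComplex.finrank, Units.rank]
  have h1 : 0 < Fintype.card (InfinitePlace K) := Fintype.card_pos
  have h2 := IsTotallyComplex.nrRealPlaces_eq_zero K
  have h3 := InfinitePlace.card_eq_nrRealPlaces_add_nrComplexPlaces K
  omega

lemma SU_sq_index (S : Finset (HeightOneSpectrum (𝓞 K))) :
    ((SU S).map (sqHom Kˣ)).relIndex (SU S) = 2 ^ (Units.rank K + 1 + S.card) := by
  rw [relIndex_sq, (SU_fg_rk S).2, SU_torsion]; ring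

/-- trivial `S`-class group -/
def ClS (S : Finset (HeightOneSpectrum (𝓞 K))) : Prop :=
  ∀ v ∉ S, ∃ π : Kˣ, v.valuation K π = exp (-1 : ℤ) ∧ ∀ w ∉ S, w ≠ v → w.valuation K π = 1

lemma ClS.mono {S T : Finset (HeightOneSpectrum (𝓞 K))} (h : ClS S) (hST : S ⊆ T) : ClS T := by
  intro v hv
  obtain ⟨π, h1, h2⟩ := h v fun h => hv (hST h)
  exact ⟨π, h1, fun w hw => h2 w fun h => hw (hST h)⟩

lemma exists_ClS : ∃ S : Finset (HeightOneSpectrum (𝓞 K)), ClS S := by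
  classical
  choose I hI using ClassGroup.mk0_surjective (R := 𝓞 K)
  have hfin : ∀ C, {v : HeightOneSpectrum (𝓞 K) | v.asIdeal ∣ (I C : Ideal (𝓞 K))}.Finite := fun C =>
    Ideal.finite_factors (nonZeroDivisors.ne_zero (I C).2)
  refine ⟨Finset.univ.biUnion fun C => (hfin C).toFinset, ?_⟩
  intro v hv
  set J : nonZeroDivisors (Ideal (𝓞 K)) := ⟨v.asIdeal, mem_nonZeroDivisors_of_ne_zero v.ne_bot⟩
  have hprin : ClassGroup.mk0 (J * I (ClassGroup.mk0 J)⁻¹) = 1 := by rw [map_mul, hI, mul_inv_cancel]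
  set A := I (ClassGroup.mk0 J)⁻¹ with hA
  rw [ClassGroup.mk0_eq_one_iff] at hprin
  obtain ⟨α, hα⟩ := hprin.principal
  have hα : v.asIdeal * (A : Ideal (𝓞 K)) = Ideal.span {α} := hα
  have hA0 : (A : Ideal (𝓞 K)) ≠ 0 := nonZeroDivisors.ne_zero A.2
  have hα0 : α ≠ 0 := by
    rintro rfl
    rw [Ideal.span_singleton_eq_bot.mpr rfl] at hα
    exact (mul_ne_zero v.ne_bot hA0) hα
  have hα0' : algebraMap (𝓞 K) K α ≠ 0 := by simpa using hα0
  have hnot : ∀ w, w ∉ (Finset.univ.biUnion fun C => (hfin C).toFinset) → ¬ w.asIdeal ∣ (A : Ideal (𝓞 K)) := by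
    intro w hw h
    apply hw
    simp only [Finset.mem_biUnion, Finset.mem_univ, true_and, Set.Finite.mem_toFinset]
    exact ⟨_, h⟩
  refine ⟨Units.mk0 _ hα0', ?_, ?_⟩
  · have h1 : v.valuation K (algebraMap (𝓞 K) K α) ≤ exp (-((1 : ℕ) : ℤ)) := by
      rw [HeightOneSpectrum.valuation_of_algebraMap, HeightOneSpectrum.intValuation_le_pow_iff_mem, pow_one,
        ← Ideal.span_singleton_le_iff_mem, ← hα]
      exact Ideal.mul_le_left (I := v.asIdeal)
    have h2 : ¬ v.valuation K (algebraMap (𝓞 K) K α) < exp (-((1 : ℕ) : ℤ)) := by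
      rw [← mem_pow_iff_lt, ← Ideal.span_singleton_le_iff_mem, ← hα, ← Ideal.dvd_iff_le, pow_two]
      intro h
      exact hnot v hv ((mul_dvd_mul_iff_left (show v.asIdeal ≠ 0 from v.ne_bot)).mp h)
    exact le_antisymm h1 (not_lt.mp h2)
  · intro w hw hwv
    rw [Units.val_mk0]
    refine (HeightOneSpectrum.valuation_eq_one_iff_notMem w).mpr fun hm => ?_
    rw [← Ideal.span_singleton_le_iff_mem, ← hα, Ideal.IsPrime.mul_le w.isPrime] at hm
    rcases hm with h | h
    · exact hwv (HeightOneSpectrum.ext (v.isMaximal.eq_of_le w.isPrime.ne_top h).symm)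
    · exact hnot w hw (Ideal.dvd_iff_le.mpr h)

end NF

end partPF

section partPG

open IsDedekindDomain NumberField WithZero
set_option linter.unusedSectionVars false

section tower
variable {K M : Type*} [Field K] [NumberField K] [Field M] [NumberField M] [Algebra K M]

/-- prime below -/
noncomputable abbrev dn (K : Type*) {M : Type*} [Field K] [NumberField K] [Field M] [NumberField M] [Algebra K M]
    (P : HeightOneSpectrum (𝓞 M)) : HeightOneSpectrum (𝓞 K) := P.under (𝓞 K)

lemma dn_fib_finite (v : HeightOneSpectrum (𝓞 K)) :
    {P : HeightOneSpectrum (𝓞 M) | dn K P = v}.Finite := by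
  have h := IsDedekindDomain.primesOver_finite (A := 𝓞 K) v.asIdeal (𝓞 M)
  refine Set.Finite.of_finite_image (f := HeightOneSpectrum.asIdeal) (h.subset ?_) ?_
  · rintro _ ⟨P, hP, rfl⟩
    refine ⟨P.isPrime, ⟨?_⟩⟩
    rw [← show dn K P = v from hP]; rfl
  · intro P _ Q _ h; exact HeightOneSpectrum.ext h

lemma dn_preimage_finite (S : Finset (HeightOneSpectrum (𝓞 K))) :
    {P : HeightOneSpectrum (𝓞 M) | dn K P ∈ S}.Finite := by
  have : {P : HeightOneSpectrum (𝓞 M) | dn K P ∈ S} = ⋃ v ∈ S, {P | dn K P = v} := by ext; simp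
  rw [this]
  exact Set.Finite.biUnion S.finite_toSet fun v _ => dn_fib_finite v

/-- primes above S -/
noncomputable def up (M : Type*) [Field M] [NumberField M] [Algebra K M] (S : Finset (HeightOneSpectrum (𝓞 K))) :
    Finset (HeightOneSpectrum (𝓞 M)) := (dn_preimage_finite S).toFinset

lemma mem_up {S : Finset (HeightOneSpectrum (𝓞 K))} {P : HeightOneSpectrum (𝓞 M)} : P ∈ up M S ↔ dn K P ∈ S := by
  simp [up]

lemma dn_surj (v : HeightOneSpectrum (𝓞 K)) : ∃ P : HeightOneSpectrum (𝓞 M), dn K P = v := by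
  have := v.isMaximal
  obtain ⟨Q, hQ, hl⟩ := Ideal.exists_maximal_ideal_liesOver_of_isIntegral (S := 𝓞 M) v.asIdeal
  refine ⟨⟨Q, hQ.isPrime, Ideal.ne_bot_of_liesOver_of_ne_bot v.ne_bot Q⟩, ?_⟩
  exact HeightOneSpectrum.ext hl.over.symm

lemma dn_val (P : HeightOneSpectrum (𝓞 M)) : ∃ e : ℕ, e ≠ 0 ∧ ∀ x : K, P.valuation M (algebraMap K M x) = (dn K P).valuation K x ^ e := by
  have : P.asIdeal.LiesOver (dn K P).asIdeal := ⟨rfl⟩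
  refine ⟨_, Ideal.IsDedekindDomain.ramificationIdx'_ne_zero_of_liesOver P.asIdeal (dn K P).ne_bot, fun x => ?_⟩
  exact (HeightOneSpectrum.valuation_liesOver M (dn K P) P x).symm

lemma dn_val_lt (P : HeightOneSpectrum (𝓞 M)) (x : K) (y : K) :
    P.valuation M (algebraMap K M x) < P.valuation M (algebraMap K M y) ↔ (dn K P).valuation K x < (dn K P).valuation K y := by
  obtain ⟨e, he, h⟩ := dn_val (K := K) P
  rw [h, h]
  exact pow_lt_pow_iff_left₀ zero_le zero_le he

lemma dn_val_eq_one (P : HeightOneSpectrum (𝓞 M)) (x : K) :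
    P.valuation M (algebraMap K M x) = 1 ↔ (dn K P).valuation K x = 1 := by
  obtain ⟨e, he, h⟩ := dn_val (K := K) P
  rw [h]
  exact pow_eq_one_iff_of_nonneg zero_le he

lemma dn_Q (P : HeightOneSpectrum (𝓞 M)) (x : Kˣ) (hx : x ∈ Qv (dn K P)) : Units.map (algebraMap K M : K →* M) x ∈ Qv P := by
  obtain ⟨y, hy⟩ := hx
  refine ⟨algebraMap K M y, ?_⟩
  have := (dn_val_lt P _ _).mpr hy
  rw [show algebraMap K M 4 = 4 from map_ofNat _ 4] at this
  simpa using this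

lemma SU_up {S : Finset (HeightOneSpectrum (𝓞 K))} (x : Kˣ) : Units.map (algebraMap K M : K →* M) x ∈ SU (up M S) ↔ x ∈ SU S := by
  constructor
  · intro h v hv
    obtain ⟨P, rfl⟩ := dn_surj (M := M) v
    exact (dn_val_eq_one P _).mp (h P (by rwa [mem_up]))
  · intro h P hP
    exact (dn_val_eq_one P _).mpr (h _ (by rwa [mem_up] at hP))

end tower

section conj
variable {K M : Type*} [Field K] [NumberField K] [Field M] [NumberField M] [Algebra K M]

/-- conjugate prime -/
noncomputable def cj (σ : M ≃ₐ[K] M) (P : HeightOneSpectrum (𝓞 M)) : HeightOneSpectrum (𝓞 M) :=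
  HeightOneSpectrum.comap (RingOfIntegers.mapAlgEquiv (k := K) σ).toRingEquiv.toRingHom (RingOfIntegers.mapAlgEquiv (k := K) σ).surjective P

lemma mem_cj (σ : M ≃ₐ[K] M) (P : HeightOneSpectrum (𝓞 M)) (x : 𝓞 M) :
    x ∈ (cj σ P).asIdeal ↔ RingOfIntegers.mapAlgEquiv (k := K) σ x ∈ P.asIdeal := Iff.rfl

lemma dn_cj (σ : M ≃ₐ[K] M) (P : HeightOneSpectrum (𝓞 M)) : dn K (cj σ P) = dn K P := by
  apply HeightOneSpectrum.ext
  ext x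
  change algebraMap (𝓞 K) (𝓞 M) x ∈ (cj σ P).asIdeal ↔ algebraMap (𝓞 K) (𝓞 M) x ∈ P.asIdeal
  rw [mem_cj, AlgEquiv.commutes]

lemma mem_cj_pow (σ : M ≃ₐ[K] M) (P : HeightOneSpectrum (𝓞 M)) (n : ℕ) (x : 𝓞 M) :
    x ∈ (cj σ P).asIdeal ^ n ↔ RingOfIntegers.mapAlgEquiv (k := K) σ x ∈ P.asIdeal ^ n := by
  set e := (RingOfIntegers.mapAlgEquiv (k := K) σ).toRingEquiv with he
  have h1 : (cj σ P).asIdeal = Ideal.map e.symm P.asIdeal := (Ideal.map_symm e).symm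
  rw [h1, ← Ideal.map_pow, Ideal.map_symm]; rfl

lemma val_cj (σ : M ≃ₐ[K] M) (P : HeightOneSpectrum (𝓞 M)) (x : M) :
    (cj σ P).valuation M x = P.valuation M (σ x) := by
  have key : ∀ a : 𝓞 M, (cj σ P).valuation M a = P.valuation M (σ a) := by
    intro a
    by_cases ha : a = 0
    · simp [ha]
    have : σ (a : M) = ((RingOfIntegers.mapAlgEquiv (k := K) σ a : 𝓞 M) : M) := rfl
    rw [this]
    set b := RingOfIntegers.mapAlgEquiv (k := K) σ a with hb
    have hb0 : b ≠ 0 := by simpa [hb] using ha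
    rw [show ((a : M)) = algebraMap (𝓞 M) M a from rfl, show ((b : M)) = algebraMap (𝓞 M) M b from rfl,
      HeightOneSpectrum.valuation_of_algebraMap, HeightOneSpectrum.valuation_of_algebraMap]
    apply le_antisymm
    · rw [HeightOneSpectrum.intValuation_eq_exp_neg_multiplicity _ hb0, HeightOneSpectrum.intValuation_le_pow_iff_mem,
        mem_cj_pow, ← HeightOneSpectrum.intValuation_le_pow_iff_mem, HeightOneSpectrum.intValuation_eq_exp_neg_multiplicity _ hb0]
    · rw [HeightOneSpectrum.intValuation_eq_exp_neg_multiplicity _ ha, HeightOneSpectrum.intValuation_le_pow_iff_mem,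
        ← mem_cj_pow, ← HeightOneSpectrum.intValuation_le_pow_iff_mem, HeightOneSpectrum.intValuation_eq_exp_neg_multiplicity _ ha]
  obtain ⟨a, b, hb, rfl⟩ := IsFractionRing.div_surjective (A := 𝓞 M) x
  rw [map_div₀, map_div₀, map_div₀]
  rw [show algebraMap (𝓞 M) M a = (a : M) from rfl, show algebraMap (𝓞 M) M b = (b : M) from rfl, key, key]

lemma SU_cj (σ : M ≃ₐ[K] M) (S : Finset (HeightOneSpectrum (𝓞 K))) (x : Mˣ) (hx : x ∈ SU (up M S)) :
    Units.map (σ : M →* M) x ∈ SU (up M S) := by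
  intro P hP
  have := hx (cj σ P) (by rwa [mem_up, dn_cj, ← mem_up])
  rw [val_cj] at this
  exact this

end conj

section S_lemmas
variable {K : Type*} [Field K] [NumberField K]

lemma val_ne_one_finite (x : Kˣ) : {v : HeightOneSpectrum (𝓞 K) | v.valuation K x ≠ 1}.Finite := by
  obtain ⟨a, b, hb, hab⟩ := IsFractionRing.div_surjective (A := 𝓞 K) (x : K)
  have hb0 : b ≠ 0 := nonZeroDivisors.ne_zero hb
  have ha0 : a ≠ 0 := by
    rintro rfl
    rw [map_zero, zero_div] at hab
    exact x.ne_zero hab.symm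
  have hf : ∀ a : 𝓞 K, a ≠ 0 → {v : HeightOneSpectrum (𝓞 K) | v.asIdeal ∣ Ideal.span {a}}.Finite := fun a ha =>
    Ideal.finite_factors (by simpa using ha)
  refine ((hf a ha0).union (hf b hb0)).subset ?_
  intro v hv
  by_contra h
  apply hv
  simp only [Set.mem_union, Set.mem_ofPred_eq, not_or, Ideal.dvd_span_singleton] at h
  rw [← hab, map_div₀, v.valuation_eq_one_iff_notMem.mpr h.1, v.valuation_eq_one_iff_notMem.mpr h.2, div_one]

lemma exists_SU (x : Kˣ) : ∃ S : Finset (HeightOneSpectrum (𝓞 K)), x ∈ SU S :=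
  ⟨(val_ne_one_finite x).toFinset, fun v hv => by simpa using hv⟩

lemma exists_with_val {S : Finset (HeightOneSpectrum (𝓞 K))} (hS : ClS S) (n : HeightOneSpectrum (𝓞 K) → ℤ)
    (T : Finset (HeightOneSpectrum (𝓞 K))) (hn : ∀ v ∉ T, n v = 0) :
    ∃ x : Kˣ, ∀ v ∉ S, v.valuation K x = exp (n v) := by
  classical
  induction T using Finset.induction_on generalizing n with
  | empty => exact ⟨1, fun v _ => by simp [hn v]⟩
  | insert v T hv ih =>
    obtain ⟨x, hx⟩ := ih (fun w => if w = v then 0 else n w) (fun w hw => by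
      by_cases h : w = v
      · simp [h]
      · simp only [h, if_false]; exact hn w (by simp [h, hw]))
    by_cases hvS : v ∈ S
    · refine ⟨x, fun w hw => ?_⟩
      have : w ≠ v := by rintro rfl; exact hw hvS
      rw [hx w hw, if_neg this]
    · obtain ⟨π, h1, h2⟩ := hS v hvS
      refine ⟨x * π ^ (- n v), fun w hw => ?_⟩
      push_cast
      rw [map_mul, hx w hw, map_zpow₀]
      by_cases h : w = v
      · subst h
        rw [if_pos rfl, h1, exp_zero, one_mul, ← exp_zsmul]; simp
      · rw [if_neg h, h2 w hw h, one_zpow, mul_one]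

lemma exists_max_val {S : Finset (HeightOneSpectrum (𝓞 K))} (hS : ClS S) (u w : K) (h : u ≠ 0 ∨ w ≠ 0) :
    ∃ x : Kˣ, ∀ v ∉ S, v.valuation K x = max (v.valuation K u) (v.valuation K w) := by
  classical
  have hne : ∀ v : HeightOneSpectrum (𝓞 K), max (v.valuation K u) (v.valuation K w) ≠ 0 := by
    intro v
    rcases h with h | h
    · exact ((zero_lt_iff.mpr ((v.valuation K).ne_zero_iff.mpr h)).trans_le (le_max_left _ _)).ne'
    · exact ((zero_lt_iff.mpr ((v.valuation K).ne_zero_iff.mpr h)).trans_le (le_max_right _ _)).ne'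
  have key : ∀ u : K, {v : HeightOneSpectrum (𝓞 K) | ¬ (v.valuation K u = 0 ∨ v.valuation K u = 1)}.Finite ∧
      (u ≠ 0 → {v : HeightOneSpectrum (𝓞 K) | v.valuation K u ≠ 1}.Finite) := by
    intro u
    by_cases hu : u = 0
    · simp [hu]
    · have := val_ne_one_finite (Units.mk0 u hu)
      refine ⟨this.subset ?_, fun _ => this⟩
      intro v hv
      simp only [Set.mem_ofPred_eq, not_or] at hv ⊢
      exact hv.2
  have hfin : {v : HeightOneSpectrum (𝓞 K) | max (v.valuation K u) (v.valuation K w) ≠ 1}.Finite := by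
    rcases h with h | h
    · refine (((key u).2 h).union (key w).1).subset ?_
      intro v hv
      by_contra hc
      simp only [Set.mem_union, Set.mem_ofPred_eq, not_or, not_not] at hc hv
      apply hv
      obtain ⟨h1, h2⟩ := hc
      rcases (by tauto : v.valuation K w = 0 ∨ v.valuation K w = 1) with h2 | h2 <;> rw [h1, h2] <;> simp
    · refine (((key w).2 h).union (key u).1).subset ?_
      intro v hv
      by_contra hc
      simp only [Set.mem_union, Set.mem_ofPred_eq, not_or, not_not] at hc hv
      apply hv
      obtain ⟨h1, h2⟩ := hc
      rcases (by tauto : v.valuation K u = 0 ∨ v.valuation K u = 1) with h2 | h2 <;> rw [h1, h2] <;> simp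
  obtain ⟨x, hx⟩ := exists_with_val hS (fun v => log (max (v.valuation K u) (v.valuation K w))) hfin.toFinset (by
    intro v hv
    simp only [Set.Finite.mem_toFinset, Set.mem_ofPred_eq, not_not] at hv
    rw [hv, log_one])
  exact ⟨x, fun v hv => by rw [hx v hv, exp_log (hne v)]⟩

end S_lemmas

end partPG

section partPH

open IsDedekindDomain NumberField WithZero Polynomial
set_option linter.unusedSectionVars false

/-- quadratic extension data -/
structure QE (K M : Type*) [Field K] [Field M] [Algebra K M] (c : K) where
  δ : M
  hδ : δ ^ 2 = algebraMap K M c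
  σ : M ≃ₐ[K] M
  hσ : σ δ = - δ
  rep : ∀ x, ∃ u w : K, x = algebraMap K M u + algebraMap K M w * δ
  hfin : Module.finrank K M = 2

lemma exists_QE.{u} {K : Type u} [Field K] [NumberField K] (c : K) (hc : ¬ IsSquare c) :
    ∃ (M : Type u) (_ : Field M) (_ : NumberField M) (_ : Algebra K M), Nonempty (QE K M c) := by
  have hm : (X ^ 2 - C c : K[X]).Monic := monic_X_pow_sub_C c two_ne_zero
  have hirr : Irreducible (X ^ 2 - C c : K[X]) := by
    refine (X_pow_sub_C_irreducible_iff_of_prime Nat.prime_two).mpr ?_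
    intro b hb
    exact hc ⟨b, by rw [← hb, sq]⟩
  have : Fact (Irreducible (X ^ 2 - C c : K[X])) := ⟨hirr⟩
  let M := AdjoinRoot (X ^ 2 - C c : K[X])
  have hfd : FiniteDimensional K M := (AdjoinRoot.powerBasis hirr.ne_zero).finite
  have hcz : CharZero M := charZero_of_injective_algebraMap (algebraMap K M).injective
  have hQ : FiniteDimensional ℚ M := FiniteDimensional.trans ℚ K M
  have hnf : NumberField M := { to_charZero := hcz, to_finiteDimensional := hQ }
  refine ⟨M, inferInstance, hnf, inferInstance, ?_⟩
  let δ : M := AdjoinRoot.root _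
  have hδ : δ ^ 2 = algebraMap K M c := by
    have := AdjoinRoot.eval₂_root (X ^ 2 - C c : K[X])
    rw [eval₂_sub, eval₂_X_pow, eval₂_C, sub_eq_zero] at this
    exact this
  have hroot : aeval (-δ) (X ^ 2 - C c : K[X]) = 0 := by
    simp only [map_sub, map_pow, aeval_X, aeval_C, neg_sq, hδ, sub_self]
  let φ : M →ₐ[K] M := AdjoinRoot.liftAlgHom (X ^ 2 - C c : K[X]) (Algebra.ofId K M) (-δ) hroot
  have hφ : φ δ = -δ := AdjoinRoot.liftAlgHom_root _ _ _ _
  have hφφ : φ.comp φ = AlgHom.id K M := by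
    apply AdjoinRoot.algHom_ext
    change φ (φ δ) = δ
    rw [hφ, map_neg, hφ, neg_neg]
  refine ⟨⟨δ, hδ, AlgEquiv.ofAlgHom φ φ hφφ hφφ, hφ, ?_, ?_⟩⟩
  · intro x
    obtain ⟨p, rfl⟩ := AdjoinRoot.mk_surjective x
    have h1 : AdjoinRoot.mk (X ^ 2 - C c : K[X]) p = AdjoinRoot.mk (X ^ 2 - C c : K[X]) (p %ₘ (X ^ 2 - C c)) := by
      conv_lhs => rw [← modByMonic_add_div p (X ^ 2 - C c : K[X])]
      simp
    have h2 : (p %ₘ (X ^ 2 - C c)).degree ≤ 1 := by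
      have := degree_modByMonic_lt p hm
      rw [degree_X_pow_sub_C (by norm_num) c] at this
      exact Order.le_of_lt_succ this
    have hab := eq_X_add_C_of_degree_le_one h2
    generalize (p %ₘ (X ^ 2 - C c)).coeff 1 = a at hab
    generalize (p %ₘ (X ^ 2 - C c)).coeff 0 = b at hab
    refine ⟨b, a, ?_⟩
    rw [h1, hab, map_add, map_mul, AdjoinRoot.mk_X, AdjoinRoot.mk_C, AdjoinRoot.mk_C, add_comm]
    rfl
  · have := (AdjoinRoot.powerBasis hirr.ne_zero).finrank
    rw [this, AdjoinRoot.powerBasis_dim, natDegree_X_pow_sub_C]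

section QEs
variable {K M : Type*} [Field K] [NumberField K] [Field M] [NumberField M] [Algebra K M] {c : Kˣ} (q : QE K M (c : K))

namespace QE

lemma δ_ne : q.δ ≠ 0 := by
  intro h
  have := q.hδ
  rw [h] at this
  have h2 : algebraMap K M c ≠ 0 := by simp
  exact h2 (by rw [← this]; simp)

lemma σ_rep (u w : K) : q.σ (algebraMap K M u + algebraMap K M w * q.δ) = algebraMap K M u - algebraMap K M w * q.δ := by
  rw [map_add, map_mul, AlgEquiv.commutes, AlgEquiv.commutes, q.hσ]; ring

lemma σσ (x : M) : q.σ (q.σ x) = x := by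
  obtain ⟨u, w, rfl⟩ := q.rep x
  rw [q.σ_rep, map_sub, map_mul, AlgEquiv.commutes, AlgEquiv.commutes, q.hσ]; ring

lemma fixed (x : M) : q.σ x = x ↔ ∃ u : K, x = algebraMap K M u := by
  constructor
  · intro h
    obtain ⟨u, w, rfl⟩ := q.rep x
    rw [q.σ_rep] at h
    have h1 : 2 * (algebraMap K M w * q.δ) = 0 := by linear_combination -h
    have h2 : algebraMap K M w * q.δ = 0 := by simpa using h1
    exact ⟨u, by rw [h2, add_zero]⟩
  · rintro ⟨u, rfl⟩; exact q.σ.commutes u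

lemma norm_rep (u w : K) : (algebraMap K M u + algebraMap K M w * q.δ) * q.σ (algebraMap K M u + algebraMap K M w * q.δ)
    = algebraMap K M (u ^ 2 - c * w ^ 2) := by
  rw [q.σ_rep]; push_cast [map_sub, map_mul, map_pow]; rw [← q.hδ]; ring

lemma split (P : HeightOneSpectrum (𝓞 M)) (h : c ∈ Qv (dn K P)) : cj q.σ P ≠ P := by
  intro hP
  obtain ⟨y, hy⟩ := h
  have h4 : (dn K P).valuation K (((c : K) * y ^ 2 - 1) / 4) < 1 := by
    rw [map_div₀]
    exact (div_lt_one₀ (zero_lt_iff.mpr (((dn K P).valuation K).ne_zero_iff.mpr (OfNat.ofNat_ne_zero 4 : (4 : K) ≠ 0)))).mpr hy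
  have h4' : P.valuation M (algebraMap K M (((c : K) * y ^ 2 - 1) / 4)) < 1 := by
    have := (dn_val_lt P (((c : K) * y ^ 2 - 1) / 4) 1).mpr (by rwa [map_one])
    rwa [map_one, map_one] at this
  set t : M := (1 + algebraMap K M y * q.δ) / 2 with ht
  have hst : q.σ t = (1 - algebraMap K M y * q.δ) / 2 := by
    rw [ht, map_div₀, map_add, map_mul, AlgEquiv.commutes, q.hσ, map_one, map_ofNat]; ring
  have hval : P.valuation M (q.σ t) = P.valuation M t := by rw [← val_cj, hP]
  have h1 : t + q.σ t = 1 := by rw [hst, ht]; ring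
  have h2 : t * q.σ t = - algebraMap K M (((c : K) * y ^ 2 - 1) / 4) := by
    rw [hst, ht]; push_cast [map_sub, map_mul, map_pow, map_div₀]; rw [← q.hδ]
    rw [show algebraMap K M 4 = 4 from map_ofNat _ 4]; ring
  have h3 : P.valuation M t * P.valuation M t < 1 := by
    conv_lhs => rw [← hval, mul_comm]; rw [hval]
    have := congrArg (P.valuation M) h2
    rw [map_mul, hval, Valuation.map_neg] at this
    rw [this]; exact h4'
  have h5 : P.valuation M t < 1 := by
    by_contra h
    exact absurd h3 (not_lt.mpr (one_le_mul (not_lt.mp h) (not_lt.mp h)))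
  have h6 := (P.valuation M).map_add_lt h5 (hval ▸ h5 : P.valuation M (q.σ t) < 1)
  rw [h1, map_one] at h6
  exact lt_irrefl _ h6

lemma card_up (q : QE K M (c : K)) (S : Finset (HeightOneSpectrum (𝓞 K))) [DecidablePred fun v : HeightOneSpectrum (𝓞 K) => c ∉ Qv v] :
    2 * S.card ≤ (up M S).card + (S.filter fun v => c ∉ Qv v).card := by
  classical
  have h1 := Finset.card_eq_sum_card_fiberwise (s := up M S) (t := S) (f := dn K) (fun P hP => mem_up.mp hP)
  rw [h1, Finset.card_filter, ← Finset.sum_add_distrib, mul_comm, ← smul_eq_mul, ← Finset.sum_const]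
  refine Finset.sum_le_sum fun v hv => ?_
  obtain ⟨P, hP⟩ := dn_surj (M := M) v
  by_cases hc : c ∈ Qv v
  · have h2 : cj q.σ P ≠ P := q.split P (by rwa [hP])
    have h3 : ({cj q.σ P, P} : Finset _) ⊆ (up M S).filter (fun P => dn K P = v) := by
      intro R hR
      simp only [Finset.mem_insert, Finset.mem_singleton] at hR
      rw [Finset.mem_filter, mem_up]
      rcases hR with rfl | rfl
      · rw [dn_cj, hP]; exact ⟨hv, rfl⟩
      · rw [hP]; exact ⟨hv, rfl⟩
    have h4 := Finset.card_le_card h3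
    rw [Finset.card_pair h2] at h4
    omega
  · have h3 : ({P} : Finset _) ⊆ (up M S).filter (fun P => dn K P = v) := by
      intro R hR
      rw [Finset.mem_singleton] at hR
      subst hR
      rw [Finset.mem_filter, mem_up, hP]; exact ⟨hv, rfl⟩
    have h4 := Finset.card_le_card h3
    simp only [hc, not_false_eq_true, if_true]
    rw [Finset.card_singleton] at h4
    omega

lemma h90 (q : QE K M (c : K)) {S : Finset (HeightOneSpectrum (𝓞 K))} (hS : ClS S)
    (h2 : ∀ v ∉ S, v.valuation K 2 = 1) (hc : c ∈ SU S)
    (y : Mˣ) (hy : y ∈ SU (up M S)) (hN : (y : M) * q.σ y = 1) :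
    ∃ z : Mˣ, z ∈ SU (up M S) ∧ (y : M) = z / q.σ z := by
  obtain ⟨z, hz0, hz⟩ : ∃ z : M, z ≠ 0 ∧ z = y * q.σ z := by
    by_cases h : (y : M) = -1
    · exact ⟨q.δ, q.δ_ne, by rw [h, q.hσ]; ring⟩
    · refine ⟨1 + y, fun h' => h (by linear_combination h'), ?_⟩
      rw [map_add, map_one, mul_add, hN]; ring
  have hσz0 : q.σ z ≠ 0 := by simpa using hz0
  obtain ⟨u, w, huw⟩ := q.rep z
  have hσz : q.σ z = algebraMap K M u - algebraMap K M w * q.δ := by rw [huw, q.σ_rep]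
  have huw0 : u ≠ 0 ∨ w ≠ 0 := by
    by_contra h
    push Not at h
    apply hz0; rw [huw, h.1, h.2]; simp
  obtain ⟨x, hx⟩ := exists_max_val hS u w huw0
  have hx0 : algebraMap K M x ≠ 0 := by simp
  refine ⟨Units.mk0 (z / algebraMap K M x) (div_ne_zero hz0 hx0), ?_, ?_⟩
  · intro P hP
    rw [mem_up] at hP
    have hval : P.valuation M (q.σ z) = P.valuation M z := by
      conv_rhs => rw [hz, map_mul, hy P (by rwa [mem_up]), one_mul]
    obtain ⟨e, he, hPe⟩ := dn_val (K := K) P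
    have hδ1 : P.valuation M q.δ = 1 := by
      have h3 : P.valuation M (q.δ) ^ 2 = 1 := by
        rw [← map_pow, q.hδ, dn_val_eq_one]; exact hc _ hP
      exact (pow_eq_one_iff_of_nonneg zero_le two_ne_zero).mp h3
    have h21 : P.valuation M 2 = 1 := by
      have := (dn_val_eq_one P (2 : K)).mpr (h2 _ hP)
      rwa [map_ofNat] at this
    have hu : P.valuation M (algebraMap K M u) ≤ P.valuation M z := by
      have : P.valuation M (2 * algebraMap K M u) ≤ P.valuation M z := by
        rw [show 2 * algebraMap K M u = z + q.σ z by rw [hσz, huw]; ring]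
        exact (P.valuation M).map_add_le le_rfl hval.le
      rwa [map_mul, h21, one_mul] at this
    have hw : P.valuation M (algebraMap K M w) ≤ P.valuation M z := by
      have : P.valuation M (2 * (algebraMap K M w * q.δ)) ≤ P.valuation M z := by
        rw [show 2 * (algebraMap K M w * q.δ) = z - q.σ z by rw [hσz, huw]; ring]
        exact (P.valuation M).map_sub_le le_rfl hval.le
      rwa [map_mul, map_mul, h21, hδ1, one_mul, mul_one] at this
    have hz' : P.valuation M z = max (P.valuation M (algebraMap K M u)) (P.valuation M (algebraMap K M w)) := by
      apply le_antisymm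
      · conv_lhs => rw [huw]
        refine ((P.valuation M).map_add _ _).trans ?_
        rw [map_mul, hδ1, mul_one]
      · exact max_le hu hw
    have hmax : P.valuation M (algebraMap K M x) = P.valuation M z := by
      rw [hz', hPe, hPe, hPe, hx _ hP]
      rcases le_total ((dn K P).valuation K u) ((dn K P).valuation K w) with h | h
      · rw [max_eq_right h, max_eq_right (pow_le_pow_left₀ zero_le h e)]
      · rw [max_eq_left h, max_eq_left (pow_le_pow_left₀ zero_le h e)]
    rw [Units.val_mk0, map_div₀, hmax, div_self]
    exact (P.valuation M).ne_zero_iff.mpr hz0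
  · rw [Units.val_mk0, map_div₀, AlgEquiv.commutes, div_div_div_cancel_right₀ hx0, eq_div_iff hσz0]
    exact hz.symm


lemma lemH (q : QE K M (c : K)) [IsTotallyComplex K] {S : Finset (HeightOneSpectrum (𝓞 K))} (hS : ClS S)
    (h2 : ∀ v ∉ S, v.valuation K 2 = 1) (hc : c ∈ SU S) [DecidablePred fun v : HeightOneSpectrum (𝓞 K) => c ∉ Qv v] :
    ∃ H : Subgroup Kˣ, H ≤ SU S ∧ H ≤ Nm (c : K) ∧ H.relIndex (SU S) ≠ 0 ∧
      2 * H.relIndex (SU S) ≤ 2 ^ (S.filter fun v => c ∉ Qv v).card := by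
  have : IsTotallyComplex M := isTotallyComplex_of_algebra K M
  have hrk : Units.rank M + 1 = 2 * (Units.rank K + 1) := by
    have h1 := rank_add_one (K := M)
    have h3 := rank_add_one (K := K)
    have h4 := Module.finrank_mul_finrank ℚ K M
    rw [q.hfin] at h4
    omega
  let σA : SU (up M S) →* SU (up M S) :=
    { toFun := fun x => ⟨Units.map (q.σ : M →* M) x, SU_cj q.σ S x x.2⟩
      map_one' := by ext; simp
      map_mul' := fun x y => by ext; simp }
  have hσA : ∀ x : SU (up M S), ((σA x : Mˣ) : M) = q.σ ((x : Mˣ) : M) := fun x => rfl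
  let φ : SU S →* SU (up M S) :=
    { toFun := fun x => ⟨Units.map (algebraMap K M : K →* M) x, (SU_up x.1).mpr x.2⟩
      map_one' := by ext; simp
      map_mul' := fun x y => by ext; simp }
  have hφ : ∀ x : SU S, ((φ x : Mˣ) : M) = algebraMap K M ((x : Kˣ) : K) := fun x => rfl
  have hφinj : Function.Injective φ := by
    intro x y h
    have := congrArg (fun x : SU (up M S) => ((x : Mˣ) : M)) h
    simp only [hφ] at this
    exact Subtype.ext (Units.ext ((algebraMap K M).injective this))
  have hF : ∀ x, x ∈ φ.range ↔ σA x = x := by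
    intro x
    constructor
    · rintro ⟨y, rfl⟩
      apply Subtype.ext; apply Units.ext
      rw [hσA, hφ]; exact q.σ.commutes _
    · intro h
      have h' := congrArg (fun x : SU (up M S) => ((x : Mˣ) : M)) h
      simp only [hσA] at h'
      obtain ⟨u, hu⟩ := (q.fixed _).mp h'
      have hu0 : u ≠ 0 := by
        rintro rfl
        rw [map_zero] at hu
        exact (x : Mˣ).ne_zero hu
      have hxu : Units.map (algebraMap K M : K →* M) (Units.mk0 u hu0) = x := Units.ext hu.symm
      refine ⟨⟨Units.mk0 u hu0, (SU_up (M := M) _).mp (by rw [hxu]; exact x.2)⟩, ?_⟩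
      exact Subtype.ext hxu
  have hH := herbrand σA (fun x => by apply Subtype.ext; apply Units.ext; rw [hσA, hσA, q.σσ]) (by
    intro y hy
    have hy' := congrArg (fun x : SU (up M S) => ((x : Mˣ) : M)) hy
    simp only [Subgroup.coe_mul, Units.val_mul, hσA, Subgroup.coe_one, Units.val_one] at hy'
    obtain ⟨z, hz, h⟩ := q.h90 hS h2 hc y y.2 hy'
    refine ⟨⟨z, hz⟩, ?_⟩
    apply Subtype.ext; apply Units.ext
    rw [h, Subgroup.coe_div, Units.val_div_eq_div_val, hσA]) φ.range hF
  have e : SU S ≃* φ.range := MonoidHom.ofInjective hφinj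
  rw [← rk_congr e, (SU_fg_rk S).2, (SU_fg_rk (up M S)).2] at hH
  set N := MonoidHom.id (SU (up M S)) * σA with hN
  set H : Subgroup Kˣ := (N.range.comap φ).map (SU S).subtype with hHdef
  have hidx : H.relIndex (SU S) = N.range.relIndex φ.range := by
    rw [← Subgroup.index_comap, Subgroup.relIndex, hHdef]
    congr 1
    exact Subgroup.comap_map_eq_self_of_injective (Subgroup.subtype_injective _) _
  have hcard := q.card_up S
  refine ⟨H, Subgroup.map_subtype_le _, ?_, ?_, ?_⟩
  · rintro _ ⟨x, ⟨y, hy⟩, rfl⟩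
    obtain ⟨u, w, huw⟩ := q.rep ((y : Mˣ) : M)
    refine ⟨u, w, ?_⟩
    have h1 : ((y : Mˣ) : M) * q.σ ((y : Mˣ) : M) = algebraMap K M ((x : Kˣ) : K) := by
      rw [← hφ, ← hy]; rfl
    rw [huw, q.norm_rep] at h1
    exact ((algebraMap K M).injective h1).symm
  · rw [hidx]
    intro h0
    rw [h0, zero_mul] at hH
    exact absurd hH.symm (by positivity)
  · rw [hidx]
    have h5 : (N.range.relIndex φ.range * 2) * 2 ^ (up M S).card = 2 ^ (2 * S.card) := by
      have h6 : (2 : ℕ) ^ (2 * Units.rank K) ≠ 0 := by positivity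
      apply Nat.eq_of_mul_eq_mul_right (Nat.pos_of_ne_zero h6)
      rw [show Units.rank M = 2 * Units.rank K + 1 by omega] at hH
      calc _ = N.range.relIndex φ.range * 2 ^ (2 * Units.rank K + 1 + (up M S).card) := by ring
        _ = _ := by rw [hH]; ring
    have h6 : (2 : ℕ) ^ (2 * S.card) ≤ 2 ^ (S.filter fun v => c ∉ Qv v).card * 2 ^ (up M S).card := by
      rw [← pow_add]; exact Nat.pow_le_pow_right (by norm_num) (by omega)
    rw [← h5] at h6
    rw [mul_comm]
    exact Nat.le_of_mul_le_mul_right h6 (by positivity)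

end QE
end QEs

lemma lemmaH {K : Type*} [Field K] [NumberField K] [IsTotallyComplex K] {c : Kˣ} (hsq : ¬ IsSquare (c : K))
    {S : Finset (HeightOneSpectrum (𝓞 K))} (hS : ClS S)
    (h2 : ∀ v ∉ S, v.valuation K 2 = 1) (hc : c ∈ SU S) [DecidablePred fun v : HeightOneSpectrum (𝓞 K) => c ∉ Qv v] :
    ∃ H : Subgroup Kˣ, H ≤ SU S ∧ H ≤ Nm (c : K) ∧ H.relIndex (SU S) ≠ 0 ∧
      2 * H.relIndex (SU S) ≤ 2 ^ (S.filter fun v => c ∉ Qv v).card := by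
  obtain ⟨M, _, _, _, ⟨q⟩⟩ := exists_QE (c : K) hsq
  exact q.lemH hS h2 hc

end partPH

section partPI1

open IsDedekindDomain NumberField WithZero Polynomial
set_option linter.unusedSectionVars false

section multis
open scoped ENNReal

/-- multiset sum -/
noncomputable def HH {α : Type*} (w : α → ℝ≥0∞) : ℝ≥0∞ := ∑' m : Multiset α, (m.map w).prod

lemma HH_sq {α β : Type*} (w : α → ℝ≥0∞) (w' : β → ℝ≥0∞) (f : α ⊕ α → β) (hf : Function.Injective f)
    (h1 : ∀ a, w a ≤ w' (f (Sum.inl a))) (h2 : ∀ a, w a ≤ w' (f (Sum.inr a))) : HH w * HH w ≤ HH w' := by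
  classical
  let g : Multiset α × Multiset α → Multiset β := fun m => (m.1.map Sum.inl + m.2.map Sum.inr).map f
  have hg : Function.Injective g := by
    intro m m' h
    have h3 := Multiset.map_injective hf h
    have hl := congrArg (Multiset.filterMap (Sum.elim some (fun _ => none) : α ⊕ α → Option α)) h3
    have hr := congrArg (Multiset.filterMap (Sum.elim (fun _ => none) some : α ⊕ α → Option α)) h3
    have e1 : ∀ m : Multiset α, Multiset.filterMap (Sum.elim some (fun _ => none) : α ⊕ α → Option α) (m.map Sum.inl) = m := by
      intro m; rw [Multiset.filterMap_map]; exact Multiset.filterMap_some m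
    have e2 : ∀ m : Multiset α, Multiset.filterMap (Sum.elim some (fun _ => none) : α ⊕ α → Option α) (m.map Sum.inr) = 0 := by
      intro m; induction m using Multiset.induction_on with
      | empty => simp
      | cons a m ih => rw [Multiset.map_cons, Multiset.filterMap_cons_none _ _ rfl, ih]
    have e3 : ∀ m : Multiset α, Multiset.filterMap (Sum.elim (fun _ => none) some : α ⊕ α → Option α) (m.map Sum.inr) = m := by
      intro m; rw [Multiset.filterMap_map]; exact Multiset.filterMap_some m
    have e4 : ∀ m : Multiset α, Multiset.filterMap (Sum.elim (fun _ => none) some : α ⊕ α → Option α) (m.map Sum.inl) = 0 := by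
      intro m; induction m using Multiset.induction_on with
      | empty => simp
      | cons a m ih => rw [Multiset.map_cons, Multiset.filterMap_cons_none _ _ rfl, ih]
    have eadd : ∀ (h : α ⊕ α → Option α) (s t : Multiset (α ⊕ α)), Multiset.filterMap h (s + t) = Multiset.filterMap h s + Multiset.filterMap h t := by
      intro h s t
      induction s using Multiset.induction_on with
      | empty => simp
      | cons a m ih =>
        rw [Multiset.cons_add]
        cases hh : h a with
        | none => rw [Multiset.filterMap_cons_none _ _ hh, Multiset.filterMap_cons_none _ _ hh, ih]
        | some b => rw [Multiset.filterMap_cons_some _ _ _ hh, Multiset.filterMap_cons_some _ _ _ hh, ih, Multiset.cons_add]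
    rw [eadd, eadd, e1, e2, e1, e2, add_zero, add_zero] at hl
    rw [eadd, eadd, e3, e4, e3, e4, zero_add, zero_add] at hr
    exact Prod.ext hl hr
  have hle : ∀ (m : Multiset α) (g : α → β), (∀ a, w a ≤ w' (g a)) → (m.map w).prod ≤ ((m.map g).map w').prod := by
    intro m g hg
    rw [Multiset.map_map]
    exact Multiset.prod_map_le_prod_map₀ _ _ (fun _ _ => zero_le) (fun a _ => hg a)
  calc HH w * HH w = ∑' p : Multiset α × Multiset α, (p.1.map w).prod * (p.2.map w).prod := by
        rw [ENNReal.tsum_prod (f := fun a b : Multiset α => (a.map w).prod * (b.map w).prod), HH]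
        simp_rw [ENNReal.tsum_mul_left, ENNReal.tsum_mul_right]
    _ ≤ ∑' p, ((g p).map w').prod := by
        refine ENNReal.tsum_le_tsum fun p => ?_
        simp only [g, Multiset.map_add, Multiset.prod_add, Multiset.map_map]
        have a1 := hle p.1 (fun a => f (Sum.inl a)) h1
        have a2 := hle p.2 (fun a => f (Sum.inr a)) h2
        rw [Multiset.map_map] at a1 a2
        exact mul_le_mul' a1 a2
    _ ≤ HH w' := ENNReal.tsum_comp_le_tsum_of_injective hg _

lemma HH_mono {α : Type*} {w w' : α → ℝ≥0∞} (h : ∀ a, w a ≤ w' a) : HH w ≤ HH w' :=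
  ENNReal.tsum_le_tsum fun _ => Multiset.prod_map_le_prod_map₀ _ _ (fun _ _ => zero_le) (fun a _ => h a)

open Classical in
lemma HH_remove {α : Type*} (w : α → ℝ≥0∞) (a : α) : HH w ≤ HH (Function.update w a 0) + w a * HH w := by
  have key : ∀ m : Multiset α, (m.map w).prod ≤ (m.map (Function.update w a 0)).prod +
      (Set.range (fun m : Multiset α => a ::ₘ m)).indicator (fun m => (m.map w).prod) m := by
    intro m
    by_cases h : a ∈ m
    · obtain ⟨m', rfl⟩ := Multiset.exists_cons_of_mem h
      rw [Set.indicator_of_mem (Set.mem_range_self m')]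
      exact le_add_self
    · refine le_add_right (le_of_eq ?_)
      congr 1
      refine Multiset.map_congr rfl fun x hx => ?_
      rw [Function.update_of_ne]
      rintro rfl; exact h hx
  calc HH w ≤ ∑' m : Multiset α, ((m.map (Function.update w a 0)).prod +
      (Set.range (fun m : Multiset α => a ::ₘ m)).indicator (fun m => (m.map w).prod) m) := ENNReal.tsum_le_tsum key
    _ = HH (Function.update w a 0) + ∑' m : Multiset α, (Set.range (fun m : Multiset α => a ::ₘ m)).indicator (fun m => (m.map w).prod) m :=
        ENNReal.tsum_add
    _ = _ := by
        congr 1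
        rw [← tsum_subtype, tsum_range (g := fun m : Multiset α => a ::ₘ m) (fun m => (m.map w).prod) (fun x y h => (Multiset.cons_inj_right a).mp h)]
        simp only [Multiset.map_cons, Multiset.prod_cons]
        rw [ENNReal.tsum_mul_left]; rfl

open Classical in
lemma HH_remove_finset {α : Type*} (w : α → ℝ≥0∞) (T : Finset α) (hw : ∀ a ∈ T, w a ≤ 2⁻¹) (hfin : HH w ≠ ∞) :
    HH w ≤ 2 ^ T.card * HH (fun a => if a ∈ T then 0 else w a) := by
  induction T using Finset.induction_on with
  | empty => simp
  | insert a T ha ih =>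
    have h1 := ih fun b hb => hw b (Finset.mem_insert_of_mem hb)
    set w₁ : α → ℝ≥0∞ := fun a => if a ∈ T then 0 else w a with hw₁
    have h2 := HH_remove w₁ a
    have hwa : w₁ a ≤ 2⁻¹ := by
      simp only [hw₁, ha, if_false]; exact hw a (Finset.mem_insert_self _ _)
    have hf1 : HH w₁ ≠ ∞ := ne_top_of_le_ne_top hfin (HH_mono fun b => by simp only [hw₁]; split <;> simp)
    have hup : Function.update w₁ a 0 = fun b => if b ∈ insert a T then 0 else w b := by
      ext b
      by_cases hb : b = a
      · subst hb; simp
      · rw [Function.update_of_ne hb]; simp [hw₁, hb]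
    rw [hup] at h2
    have h3 : HH w₁ ≤ 2 * HH (fun b => if b ∈ insert a T then 0 else w b) := by
      have h4 : HH w₁ ≤ HH (fun b => if b ∈ insert a T then 0 else w b) + 2⁻¹ * HH w₁ :=
        h2.trans (add_le_add le_rfl (mul_le_mul' hwa le_rfl))
      have h5 : HH w₁ = 2⁻¹ * HH w₁ + 2⁻¹ * HH w₁ := by
        rw [← add_mul, ENNReal.inv_two_add_inv_two, one_mul]
      have h6 : 2⁻¹ * HH w₁ ≠ ∞ := ENNReal.mul_ne_top (by simp) hf1
      have h7 : 2⁻¹ * HH w₁ ≤ HH (fun b => if b ∈ insert a T then 0 else w b) := by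
        rw [h5] at h4
        rw [← h5] at h4
        conv_lhs at h4 => rw [h5]
        exact (ENNReal.add_le_add_iff_right h6).mp h4
      calc HH w₁ = 2 * (2⁻¹ * HH w₁) := by
            rw [← mul_assoc, ENNReal.mul_inv_cancel (by simp) (by simp), one_mul]
        _ ≤ _ := mul_le_mul' le_rfl h7
    rw [Finset.card_insert_of_notMem ha, pow_succ, mul_assoc]
    exact h1.trans (mul_le_mul' le_rfl h3)

open Classical in
lemma HH_subtype {α : Type*} (w : α → ℝ≥0∞) (T : Finset α) :
    HH (fun a => if a ∈ T then 0 else w a) ≤ HH (fun a : {a // a ∉ T} => w a) := by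
  have hinj : Function.Injective (Multiset.map (Subtype.val : {a // a ∉ T} → α)) :=
    Multiset.map_injective Subtype.val_injective
  rw [HH, HH]
  have h1 : ∀ m : Multiset α, (m.map (fun a => if a ∈ T then 0 else w a)).prod ≤
     (Set.range (Multiset.map (Subtype.val : {a // a ∉ T} → α))).indicator (fun m => (m.map w).prod) m := by
    intro m
    by_cases h : ∃ a ∈ m, a ∈ T
    · obtain ⟨a, ha, haT⟩ := h
      refine le_of_eq_of_le ?_ zero_le
      apply Multiset.prod_eq_zero
      rw [Multiset.mem_map]
      exact ⟨a, ha, by simp [haT]⟩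
    · push Not at h
      have hm : m = Multiset.map Subtype.val (m.pmap (fun a ha => (⟨a, ha⟩ : {a // a ∉ T})) h) := by
        rw [Multiset.map_pmap, Multiset.pmap_eq_map, Multiset.map_id']
      rw [Set.indicator_of_mem (Set.mem_range.mpr ⟨_, hm.symm⟩)]
      refine le_of_eq ?_
      congr 1
      exact Multiset.map_congr rfl fun x hx => by simp [h x hx]
  refine (ENNReal.tsum_le_tsum h1).trans (le_of_eq ?_)
  rw [← tsum_subtype, tsum_range (g := Multiset.map (Subtype.val : {a // a ∉ T} → α)) (fun m => (m.map w).prod) hinj]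
  simp [Multiset.map_map]

end multis

end partPI1

section partPI2

open IsDedekindDomain NumberField WithZero Polynomial
set_option linter.unusedSectionVars false

section zeta
open scoped ENNReal
open Filter Topology
variable {M : Type*} [Field M] [NumberField M]

/-- norm weight -/
noncomputable def wN (s : ℝ) (P : HeightOneSpectrum (𝓞 M)) : ℝ≥0∞ := (Ideal.absNorm P.asIdeal : ℝ≥0∞) ^ (-s)

/-- multiset to ideal -/
noncomputable def mI (m : Multiset (HeightOneSpectrum (𝓞 M))) : Ideal (𝓞 M) := (m.map HeightOneSpectrum.asIdeal).prod

lemma mI_ne (m : Multiset (HeightOneSpectrum (𝓞 M))) : mI m ≠ ⊥ := by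
  refine Multiset.prod_ne_zero ?_
  intro h
  obtain ⟨P, _, hP⟩ := Multiset.mem_map.mp h
  exact P.ne_bot hP

lemma mI_bij : Function.Bijective (fun m : Multiset (HeightOneSpectrum (𝓞 M)) => (⟨mI m, mI_ne m⟩ : {I : Ideal (𝓞 M) // I ≠ ⊥})) := by
  constructor
  · intro m m' h
    have h := congrArg Subtype.val h
    simp only at h
    have key : ∀ m : Multiset (HeightOneSpectrum (𝓞 M)), UniqueFactorizationMonoid.normalizedFactors (mI m) = m.map HeightOneSpectrum.asIdeal := by
      intro m
      apply UniqueFactorizationMonoid.normalizedFactors_prod_of_prime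
      intro p hp
      obtain ⟨P, _, rfl⟩ := Multiset.mem_map.mp hp
      exact P.prime
    have h2 := congrArg UniqueFactorizationMonoid.normalizedFactors h
    rw [key, key] at h2
    exact Multiset.map_injective (fun P Q h => HeightOneSpectrum.ext h) h2
  · rintro ⟨I, hI⟩
    have hp : ∀ p ∈ UniqueFactorizationMonoid.normalizedFactors I, Prime p := fun p hp =>
      UniqueFactorizationMonoid.prime_of_normalized_factor p hp
    refine ⟨(UniqueFactorizationMonoid.normalizedFactors I).pmap
      (fun p hp => (⟨p, Ideal.isPrime_of_prime hp, hp.ne_zero⟩ : HeightOneSpectrum (𝓞 M))) hp, ?_⟩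
    apply Subtype.ext
    simp only [mI]
    rw [Multiset.map_pmap, Multiset.pmap_eq_map, Multiset.map_id']
    exact associated_iff_eq.mp (UniqueFactorizationMonoid.prod_normalizedFactors hI)

lemma absNorm_pos (P : HeightOneSpectrum (𝓞 M)) : Ideal.absNorm P.asIdeal ≠ 0 := by
  rw [Ne, Ideal.absNorm_eq_zero_iff]; exact P.ne_bot

lemma prod_wN (s : ℝ) (m : Multiset (HeightOneSpectrum (𝓞 M))) : (m.map (wN s)).prod = (Ideal.absNorm (mI m) : ℝ≥0∞) ^ (-s) := by
  induction m using Multiset.induction_on with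
  | empty => simp [mI]
  | cons P m ih =>
    rw [Multiset.map_cons, Multiset.prod_cons, ih]
    simp only [mI, Multiset.map_cons, Multiset.prod_cons, map_mul, Nat.cast_mul, wN]
    rw [ENNReal.mul_rpow_of_ne_zero]
    · simpa using absNorm_pos P
    · have := mI_ne m
      exact Nat.cast_ne_zero.mpr (fun h => this (Ideal.absNorm_eq_zero_iff.mp h))

lemma HH_eq (s : ℝ) : HH (wN (M := M) s) = ∑' n : ℕ, ENNReal.ofReal
    (if n = 0 then 0 else (Nat.card {I : Ideal (𝓞 M) // Ideal.absNorm I = n} : ℝ) * (n : ℝ) ^ (-s)) := by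
  rw [HH]
  simp_rw [prod_wN]
  have hE : (∑' m : Multiset (HeightOneSpectrum (𝓞 M)), (Ideal.absNorm (mI m) : ℝ≥0∞) ^ (-s)) = ∑' I : {I : Ideal (𝓞 M) // I ≠ ⊥}, (Ideal.absNorm I.1 : ℝ≥0∞) ^ (-s) :=
    (Equiv.ofBijective _ (mI_bij (M := M))).tsum_eq (fun I : {I : Ideal (𝓞 M) // I ≠ ⊥} => (Ideal.absNorm I.1 : ℝ≥0∞) ^ (-s))
  rw [hE]
  rw [← (Equiv.sigmaFiberEquiv (fun I : {I : Ideal (𝓞 M) // I ≠ ⊥} => Ideal.absNorm I.1)).tsum_eq, ENNReal.tsum_sigma']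
  refine tsum_congr fun n => ?_
  have h1 : ∀ x : {I : {I : Ideal (𝓞 M) // I ≠ ⊥} // Ideal.absNorm I.1 = n},
    (Ideal.absNorm ((Equiv.sigmaFiberEquiv (fun I : {I : Ideal (𝓞 M) // I ≠ ⊥} => Ideal.absNorm I.1)) ⟨n, x⟩).1 : ℝ≥0∞) ^ (-s) = (n : ℝ≥0∞) ^ (-s) := by
    rintro ⟨x, rfl⟩; rfl
  rw [tsum_congr h1, ENNReal.tsum_const]
  by_cases hn : n = 0
  · subst hn
    have : IsEmpty {I : {I : Ideal (𝓞 M) // I ≠ ⊥} // Ideal.absNorm I.1 = 0} := by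
      refine ⟨fun x => x.1.2 (Ideal.absNorm_eq_zero_iff.mp x.2)⟩
    have h0 : ENat.card {I : {I : Ideal (𝓞 M) // I ≠ ⊥} // Ideal.absNorm I.1 = 0} = 0 := ENat.card_eq_zero_iff_empty _ |>.mpr this
    rw [h0]
    simp
  · rw [if_neg hn]
    have e : {I : {I : Ideal (𝓞 M) // I ≠ ⊥} // Ideal.absNorm I.1 = n} ≃ {I : Ideal (𝓞 M) // Ideal.absNorm I = n} :=
      { toFun := fun x => ⟨x.1.1, x.2⟩
        invFun := fun x => ⟨⟨x.1, fun h => hn (by rw [← x.2, h]; simp)⟩, x.2⟩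
        left_inv := fun x => rfl
        right_inv := fun x => rfl }
    have : Finite {I : Ideal (𝓞 M) // Ideal.absNorm I = n} := Ideal.finite_setOfPred_absNorm_eq n
    rw [ENat.card_congr e, ENat.card_eq_coe_natCard, ENNReal.ofReal_mul (by positivity), ENNReal.ofReal_natCast,
      ← ENNReal.ofReal_rpow_of_pos (by positivity), ENNReal.ofReal_natCast]
    simp

lemma HH_zeta (s : ℝ) (hs : dedekindZeta M s ≠ 0) : HH (wN (M := M) s) ≠ ∞ ∧ (((HH (wN (M := M) s)).toReal : ℝ) : ℂ) = dedekindZeta M s := by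
  set a : ℕ → ℂ := fun n ↦ (Nat.card {I : Ideal (𝓞 M) // Ideal.absNorm I = n} : ℂ) with ha
  set r : ℕ → ℝ := fun n => (if n = 0 then 0 else (Nat.card {I : Ideal (𝓞 M) // Ideal.absNorm I = n} : ℝ) * (n : ℝ) ^ (-s)) with hr
  have hterm : ∀ n, LSeries.term a s n = ((r n : ℝ) : ℂ) := by
    intro n
    by_cases hn : n = 0
    · simp [hn, hr]
    · rw [LSeries.term_of_ne_zero hn]
      simp only [hr, hn, if_false, ha]
      push_cast
      rw [Complex.ofReal_cpow (by positivity), div_eq_mul_inv, ← Complex.cpow_neg]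
      simp
  have hz : dedekindZeta M s = ∑' n, ((r n : ℝ) : ℂ) := by
    rw [dedekindZeta, LSeries]; exact tsum_congr hterm
  have hsum : Summable r := by
    by_contra h
    apply hs
    rw [hz]
    apply tsum_eq_zero_of_not_summable
    rwa [Complex.summable_ofReal]
  have hr0 : ∀ n, 0 ≤ r n := fun n => by simp only [hr]; split <;> positivity
  have h1 : HH (wN (M := M) s) = ENNReal.ofReal (∑' n, r n) := by
    rw [HH_eq, ENNReal.ofReal_tsum_of_nonneg hr0 hsum]
  rw [h1, hz]
  refine ⟨ENNReal.ofReal_ne_top, ?_⟩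
  rw [ENNReal.toReal_ofReal (tsum_nonneg hr0), Complex.ofReal_tsum]

lemma zeta_lim (M : Type*) [Field M] [NumberField M] :
    (∀ᶠ s : ℝ in 𝓝[>] 1, HH (wN (M := M) s) ≠ ∞) ∧
    Tendsto (fun s : ℝ => (s - 1) * (HH (wN (M := M) s)).toReal) (𝓝[>] 1) (𝓝 (dedekindZeta_residue M)) := by
  have h := tendsto_sub_one_mul_dedekindZeta_nhdsGT M
  have hne : ∀ᶠ s : ℝ in 𝓝[>] 1, dedekindZeta M s ≠ 0 := by
    have := h.eventually_ne (Complex.ofReal_ne_zero.mpr (dedekindZeta_residue_ne_zero M))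
    filter_upwards [this] with s hs h0
    apply hs; rw [h0, mul_zero]
  refine ⟨hne.mono fun s hs => (HH_zeta s hs).1, ?_⟩
  have h2 := (Complex.continuous_re.tendsto _).comp h
  rw [Complex.ofReal_re] at h2
  refine h2.congr' ?_
  filter_upwards [hne] with s hs
  rw [Function.comp, ← (HH_zeta s hs).2, ← Complex.ofReal_one, ← Complex.ofReal_sub, ← Complex.ofReal_mul, Complex.ofReal_re]

end zeta

end partPI2

section partPI3

open IsDedekindDomain NumberField WithZero Polynomial
set_option linter.unusedSectionVars false

section normle
variable {K M : Type*} [Field K] [NumberField K] [Field M] [NumberField M] [Algebra K M]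

lemma absNorm_cj (σ : M ≃ₐ[K] M) (P : HeightOneSpectrum (𝓞 M)) :
    Ideal.absNorm (cj σ P).asIdeal = Ideal.absNorm P.asIdeal := by
  rw [Ideal.absNorm_apply, Ideal.absNorm_apply, Submodule.cardQuot_apply, Submodule.cardQuot_apply]
  set e := (RingOfIntegers.mapAlgEquiv (k := K) σ).toRingEquiv with he
  refine Nat.card_congr (Ideal.quotientEquiv (cj σ P).asIdeal P.asIdeal e ?_).toEquiv
  have h1 : (cj σ P).asIdeal = Ideal.map e.symm P.asIdeal := (Ideal.map_symm e).symm
  rw [h1]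
  exact (Ideal.map_of_equiv e.symm).symm

lemma QE.absNorm_le {c : Kˣ} (q : QE K M (c : K)) (R : HeightOneSpectrum (𝓞 M)) (h : c ∈ Qv (dn K R)) :
    Ideal.absNorm R.asIdeal ≤ Ideal.absNorm (dn K R).asIdeal := by
  have hne := q.split R h
  have hd : ∀ P : HeightOneSpectrum (𝓞 M), P.asIdeal ∣ Ideal.map (algebraMap (𝓞 K) (𝓞 M)) (dn K P).asIdeal := by
    intro P
    rw [Ideal.dvd_iff_le, Ideal.map_le_iff_le_comap]
    exact le_rfl
  have h1 := hd R
  have h2 := hd (cj q.σ R)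
  rw [dn_cj] at h2
  have hcop : IsCoprime R.asIdeal (cj q.σ R).asIdeal := by
    rw [Ideal.isCoprime_iff_sup_eq]
    exact R.isMaximal.coprime_of_ne (cj q.σ R).isMaximal (fun h => hne (HeightOneSpectrum.ext h).symm)
  have h3 := map_dvd Ideal.absNorm (hcop.mul_dvd h1 h2)
  rw [map_mul, absNorm_cj, Ideal.absNorm_algebraMap, ← IsFractionRing.finrank_eq (𝓞 K) K (𝓞 M) M, q.hfin] at h3
  have h4 : Ideal.absNorm (dn K R).asIdeal ≠ 0 := absNorm_pos _
  have h5 := Nat.le_of_dvd (by positivity) h3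
  nlinarith

lemma QE.not_sq {a c : Kˣ} (q : QE K M (a : K)) (hc : ¬ IsSquare (c : K)) (hac : ¬ IsSquare ((a : K) * c)) :
    ¬ IsSquare (algebraMap K M c) := by
  rintro ⟨x, hx⟩
  have h1 : q.σ x * q.σ x = x * x := by
    rw [← map_mul, ← hx, AlgEquiv.commutes]
  rcases mul_self_eq_mul_self_iff.mp h1 with h | h
  · obtain ⟨u, rfl⟩ := (q.fixed x).mp h
    exact hc ⟨u, (algebraMap K M).injective (by rw [hx, map_mul])⟩
  · have : q.σ (x * q.δ) = x * q.δ := by rw [map_mul, h, q.hσ]; ring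
    obtain ⟨u, hu⟩ := (q.fixed _).mp this
    refine hac ⟨u, (algebraMap K M).injective ?_⟩
    rw [map_mul, map_mul, ← hu, hx, ← q.hδ]; ring

end normle

section Bl
open scoped ENNReal
open Filter Topology
variable {K M : Type*} [Field K] [NumberField K] [Field M] [NumberField M] [Algebra K M]

lemma wN_le_half (s : ℝ) (hs : 1 ≤ s) (P : HeightOneSpectrum (𝓞 M)) : wN s P ≤ 2⁻¹ := by
  have h1 : Ideal.absNorm P.asIdeal ≠ 1 := by
    rw [Ne, Ideal.absNorm_eq_one_iff]; exact P.isPrime.ne_top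
  have h0 := absNorm_pos P
  have h2 : 2 ≤ Ideal.absNorm P.asIdeal := by omega
  have h3 : (2 : ℝ≥0∞) ≤ (Ideal.absNorm P.asIdeal : ℝ≥0∞) := by exact_mod_cast h2
  rw [wN, ENNReal.rpow_neg, ENNReal.inv_le_inv]
  calc (2 : ℝ≥0∞) ≤ (Ideal.absNorm P.asIdeal : ℝ≥0∞) := h3
    _ = (Ideal.absNorm P.asIdeal : ℝ≥0∞) ^ (1:ℝ) := by simp
    _ ≤ _ := ENNReal.rpow_le_rpow_of_exponent_le (le_trans (by norm_num) h3) hs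

lemma QE.not_almost_all {c : Kˣ} (q : QE K M (c : K)) (T : Finset (HeightOneSpectrum (𝓞 K)))
    (h : ∀ P ∉ T, c ∈ Qv P) : False := by
  classical
  choose R hR using dn_surj (K := K) (M := M)
  have key : ∀ s : ℝ, 1 ≤ s → HH (wN (M := K) s) ≠ ∞ → 
     HH (wN (M := K) s) * HH (wN (M := K) s) ≤ (2 ^ T.card * 2 ^ T.card) * HH (wN (M := M) s) := by
    intro s hs hf
    have h1 := (HH_remove_finset (wN (M := K) s) T (fun a _ => wN_le_half s hs a) hf).trans
      (mul_le_mul_right (HH_subtype _ _) _)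
    have h2 : HH (fun a : {a // a ∉ T} => wN (M := K) s a) * HH (fun a : {a // a ∉ T} => wN (M := K) s a) ≤ HH (wN (M := M) s) := by
      have hle : ∀ a : {a // a ∉ T}, wN (M := K) s a ≤ wN s (R a) := by
        intro a
        rw [wN, wN, ENNReal.rpow_neg, ENNReal.rpow_neg, ENNReal.inv_le_inv]
        refine ENNReal.rpow_le_rpow ?_ (by linarith)
        have := q.absNorm_le (R a) (by rw [hR]; exact h _ a.2)
        rw [hR] at this
        exact_mod_cast this
      have hsp : ∀ a : {a // a ∉ T}, cj q.σ (R a) ≠ R a := fun a => q.split _ (by rw [hR]; exact h _ a.2)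
      have hd2 : ∀ a, dn K (cj q.σ (R a)) = a := fun a => by rw [dn_cj, hR]
      refine HH_sq _ _ (Sum.elim (fun a => R a) (fun a => cj q.σ (R a))) ?_ hle ?_
      · rintro (a | a) (b | b) hab <;> simp only [Sum.elim_inl, Sum.elim_inr] at hab <;>
          have h3 := congrArg (dn K) hab <;> simp only [hR, hd2] at h3 <;> have h3 := Subtype.ext h3 <;> subst h3
        · rfl
        · exact (hsp _ hab.symm).elim
        · exact (hsp _ hab).elim
        · rfl
      · intro a
        refine (hle a).trans (le_of_eq ?_)
        simp only [Sum.elim_inr, wN, absNorm_cj]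
    calc _ ≤ _ := mul_le_mul' h1 h1
      _ = (2 ^ T.card * 2 ^ T.card) * (HH (fun a : {a // a ∉ T} => wN (M := K) s a) * HH (fun a : {a // a ∉ T} => wN (M := K) s a)) := by ring
      _ ≤ _ := mul_le_mul_right h2 _
  obtain ⟨hK1, hK2⟩ := zeta_lim K
  obtain ⟨hM1, hM2⟩ := zeta_lim M
  have hev : ∀ᶠ s : ℝ in 𝓝[>] 1, ((s - 1) * (HH (wN (M := K) s)).toReal) * ((s - 1) * (HH (wN (M := K) s)).toReal) ≤
     (2 ^ T.card * 2 ^ T.card) * ((s - 1) * ((s - 1) * (HH (wN (M := M) s)).toReal)) := by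
    filter_upwards [hK1, hM1, self_mem_nhdsWithin] with s h1 h2 hs
    have hs : 1 < s := hs
    have h3 := ENNReal.toReal_mono (ENNReal.mul_ne_top (by finiteness) h2) (key s hs.le h1)
    rw [ENNReal.toReal_mul, ENNReal.toReal_mul, ENNReal.toReal_mul] at h3
    simp only [ENNReal.toReal_pow, ENNReal.toReal_ofNat] at h3
    nlinarith [mul_le_mul_of_nonneg_left h3 (mul_self_nonneg (s-1))]
  have hz : Tendsto (fun s : ℝ => s - 1) (𝓝[>] 1) (𝓝 0) := by
    have : Tendsto (fun s : ℝ => s - 1) (𝓝 1) (𝓝 (1 - 1)) := (continuous_id.sub continuous_const).tendsto 1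
    rw [sub_self] at this
    exact this.mono_left nhdsWithin_le_nhds
  have hlim := le_of_tendsto_of_tendsto (hK2.mul hK2) ((hz.mul hM2).const_mul (2 ^ T.card * 2 ^ T.card)) hev
  have hp := dedekindZeta_residue_pos K
  rw [zero_mul, mul_zero] at hlim
  nlinarith [mul_pos hp hp]

theorem lemmaB {K : Type*} [Field K] [NumberField K] {S : Finset (HeightOneSpectrum (𝓞 K))}
    (h2 : ∀ v ∉ S, v.valuation K 2 = 1) {a c : Kˣ} (ha : a ∈ SU S) (hc : c ∈ SU S)
    (ha' : ¬ IsSquare (a : K)) (hc' : ¬ IsSquare (c : K)) (hac : ¬ IsSquare ((a : K) * c)) :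
    ∃ w ∉ S, a ∈ Qv w ∧ c ∉ Qv w := by
  by_contra! hcon
  obtain ⟨L, _, _, _, ⟨q⟩⟩ := exists_QE (a : K) ha'
  have hL := q.not_sq hc' hac
  obtain ⟨F, _, _, _, ⟨q'⟩⟩ := exists_QE (algebraMap K L c) hL
  have q'' : QE L F ((Units.map (algebraMap K L : K →* L) c : Lˣ) : L) := q'
  refine q''.not_almost_all (up L S) fun P hP => ?_
  rw [mem_up] at hP
  by_cases h1 : a ∈ Qv (dn K P)
  · exact dn_Q P c (hcon _ hP h1)
  · by_cases h3 : c ∈ Qv (dn K P)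
    · exact dn_Q P c h3
    · have h4 := unit_mul_mem_Qv (dn K P) (h2 _ hP) a c (ha _ hP) (hc _ hP) h1 h3
      have h5 := dn_Q P _ h4
      rw [map_mul] at h5
      have h6 : Units.map (algebraMap K L : K →* L) a ∈ Qv P := by
        have : Units.map (algebraMap K L : K →* L) a = (Units.mk0 q.δ q.δ_ne) ^ 2 := by
          ext; simp [q.hδ]
        rw [this]; exact sq_mem_Qg _ _
      exact (Subgroup.mul_mem_cancel_left _ h6).mp h5
end Bl

end partPI3

section partPJ1

open IsDedekindDomain NumberField WithZero Polynomial
set_option linter.unusedSectionVars false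

section greedy
variable {K : Type*} [Field K] [NumberField K]

lemma sq_mem_SU {S : Finset (HeightOneSpectrum (𝓞 K))} {c : Kˣ} (hc : c ∈ SU S) (h : IsSquare (c : K)) :
    c ∈ (SU S).map (sqHom Kˣ) := by
  obtain ⟨d, hd⟩ := h
  have hd0 : d ≠ 0 := by rintro rfl; exact c.ne_zero (by rw [hd]; ring)
  refine ⟨Units.mk0 d hd0, ?_, ?_⟩
  · intro v hv
    have := hc v hv
    rw [hd, map_mul, ← pow_two] at this
    exact (pow_eq_one_iff_of_nonneg zero_le two_ne_zero).mp this
  · ext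
    change d ^ 2 = _
    rw [hd, pow_two]

/-- dual system of primes -/
def Dual (S : Finset (HeightOneSpectrum (𝓞 K))) (a : Kˣ) (T : Finset (HeightOneSpectrum (𝓞 K))) (x : HeightOneSpectrum (𝓞 K) → Kˣ) : Prop :=
  ∀ w ∈ T, w ∉ S ∧ a ∈ Qv w ∧ x w ∈ SU S ∧ x w ∉ Qv w ∧ ∀ w' ∈ T, w' ≠ w → x w ∈ Qv w'

lemma sq_le_Qv (S : Finset (HeightOneSpectrum (𝓞 K))) (w : HeightOneSpectrum (𝓞 K)) : (SU S).map (sqHom Kˣ) ≤ Qv w := by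
  rintro _ ⟨y, _, rfl⟩
  exact sq_mem_Qg _ _

lemma Dual.card_le {S : Finset (HeightOneSpectrum (𝓞 K))} {a : Kˣ} {T : Finset (HeightOneSpectrum (𝓞 K))}
    {x : HeightOneSpectrum (𝓞 K) → Kˣ} (h : Dual S a T x) : T.card ≤ Units.rank K + 1 + S.card := by
  have := indep_index T (fun w => Qv w) (SU S) ((SU S).map (sqHom Kˣ)) x (fun w hw => (h w hw).2.2.1)
    (fun w _ => sq_le_Qv S w) (fun w hw => (h w hw).2.2.2.1)
    (fun i hi j hj hij => (h i hi).2.2.2.2 j hj (Ne.symm hij)) (by rw [SU_sq_index]; positivity)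
  rw [SU_sq_index] at this
  exact (Nat.pow_le_pow_iff_right (by norm_num)).mp this

lemma Dual.extend {S : Finset (HeightOneSpectrum (𝓞 K))} (h2 : ∀ v ∉ S, v.valuation K 2 = 1) {a : Kˣ} {T : Finset (HeightOneSpectrum (𝓞 K))}
    (haS : a ∈ SU S) (ha : ¬ IsSquare (a : K))
    {x : HeightOneSpectrum (𝓞 K) → Kˣ} (h : Dual S a T x) {c : Kˣ} (hc : c ∈ SU S) (hcT : ∀ w ∈ T, c ∈ Qv w)
    (hc' : ¬ IsSquare (c : K)) (hac : ¬ IsSquare ((a : K) * c)) : ∃ T' x', Dual S a T' x' ∧ T'.card = T.card + 1 := by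
  classical
  obtain ⟨w, hw, haw, hcw⟩ := lemmaB (S := S ∪ T) (fun v hv => h2 v fun h => hv (Finset.mem_union_left _ h))
    (SU_mono Finset.subset_union_left haS) (SU_mono Finset.subset_union_left hc) ha hc' hac
  have hwS : w ∉ S := fun h => hw (Finset.mem_union_left _ h)
  have hwT : w ∉ T := fun h => hw (Finset.mem_union_right _ h)
  refine ⟨insert w T, fun u => if u = w then c else if x u ∈ Qv w then x u else x u * c, ?_, Finset.card_insert_of_notMem hwT⟩
  intro u hu
  rcases Finset.mem_insert.mp hu with rfl | hu
  · refine ⟨hwS, haw, ?_, ?_, ?_⟩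
    · simpa using hc
    · simpa using hcw
    · intro w' hw' hne
      simp only [if_true]
      exact hcT _ (Finset.mem_of_mem_insert_of_ne hw' hne)
  · have hne : u ≠ w := fun h => hwT (h ▸ hu)
    obtain ⟨h1, h2', h3, h4, h5⟩ := h u hu
    refine ⟨h1, h2', ?_, ?_, ?_⟩
    · simp only [hne, if_false]
      split
      · exact h3
      · exact mul_mem h3 hc
    · simp only [hne, if_false]
      split
      · exact h4
      · rw [Subgroup.mul_mem_cancel_right _ (hcT u hu)]; exact h4
    · intro w' hw' hne'
      simp only [hne, if_false]
      rcases Finset.mem_insert.mp hw' with rfl | hw'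
      · split
        · assumption
        · rename_i hx
          exact unit_mul_mem_Qv _ (h2 _ hwS) _ _ (h3 _ hwS) (hc _ hwS) hx hcw
      · split
        · exact h5 _ hw' hne'
        · exact mul_mem (h5 _ hw' hne') (hcT _ hw')

lemma exists_Dual {S : Finset (HeightOneSpectrum (𝓞 K))} (h2 : ∀ v ∉ S, v.valuation K 2 = 1) {a : Kˣ}
    (haS : a ∈ SU S) (ha : ¬ IsSquare (a : K)) :
    ∃ T x, Dual S a T x ∧ ∀ c ∈ SU S, (∀ w ∈ T, c ∈ Qv w) → IsSquare (c : K) ∨ IsSquare ((a : K) * c) := by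
  by_contra! hcon
  have key : ∀ n : ℕ, ∃ T x, Dual S a T x ∧ T.card = n := by
    intro n
    induction n with
    | zero => exact ⟨∅, fun _ => 1, fun w hw => by simp at hw, rfl⟩
    | succ n ih =>
      obtain ⟨T, x, h, rfl⟩ := ih
      obtain ⟨c, hc, hcT, hc', hac⟩ := hcon T x h
      exact h.extend h2 haS ha hc hcT hc' hac
  obtain ⟨T, x, h, hT⟩ := key (Units.rank K + 1 + S.card + 1)
  have := h.card_le
  omega

lemma relIndex_Qv {S : Finset (HeightOneSpectrum (𝓞 K))} {w : HeightOneSpectrum (𝓞 K)} (hw : w ∉ S) (h2 : w.valuation K 2 = 1) :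
    (Qv w).relIndex (SU S) ≠ 0 ∧ (Qv w).relIndex (SU S) ≤ 2 := by
  by_cases h : SU S ≤ Qv w
  · rw [Subgroup.relIndex_eq_one.mpr h]; simp
  · obtain ⟨x, hx, hxQ⟩ := SetLike.not_le_iff_exists.mp h
    have : (Qv w).relIndex (SU S) = 2 := by
      rw [Subgroup.relIndex, Subgroup.index_eq_two_iff]
      refine ⟨⟨x, hx⟩, fun b => ?_⟩
      simp only [Subgroup.mem_subgroupOf, Subgroup.coe_mul]
      by_cases hb : (b : Kˣ) ∈ Qv w
      · right
        refine ⟨hb, ?_⟩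
        rw [Subgroup.mul_mem_cancel_left _ hb]; exact hxQ
      · left
        exact ⟨unit_mul_mem_Qv _ h2 _ _ (b.2 _ hw) (hx _ hw) hb hxQ, hb⟩
    rw [this]; simp

lemma Dual.card_ge {S : Finset (HeightOneSpectrum (𝓞 K))} (h2 : ∀ v ∉ S, v.valuation K 2 = 1) {a : Kˣ} {T : Finset (HeightOneSpectrum (𝓞 K))}
    (haS : a ∈ SU S)
    {x : HeightOneSpectrum (𝓞 K) → Kˣ} (h : Dual S a T x)
    (hm : ∀ c ∈ SU S, (∀ w ∈ T, c ∈ Qv w) → IsSquare (c : K) ∨ IsSquare ((a : K) * c)) :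
    Units.rank K + 1 + S.card ≤ T.card + 1 := by
  classical
  have h1 : ∀ T' ⊆ T, (⨅ w ∈ T', Qv w).relIndex (SU S) ≠ 0 ∧ (⨅ w ∈ T', Qv w).relIndex (SU S) ≤ 2 ^ T'.card := by
    intro T'
    induction T' using Finset.induction_on with
    | empty => intro _; simp
    | insert w T' hw ih =>
      intro hsub
      obtain ⟨i1, i2⟩ := ih fun u hu => hsub (Finset.mem_insert_of_mem hu)
      have hwS := (h w (hsub (Finset.mem_insert_self _ _))).1
      obtain ⟨j1, j2⟩ := relIndex_Qv hwS (h2 w hwS)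
      rw [Finset.iInf_insert, Finset.card_insert_of_notMem hw]
      refine ⟨Subgroup.relIndex_inf_ne_zero j1 i1, (Subgroup.relIndex_inf_le).trans ?_⟩
      rw [pow_succ, mul_comm]
      exact Nat.mul_le_mul i2 j2
  obtain ⟨i1, i2⟩ := h1 T subset_rfl
  set I := ⨅ w ∈ T, Qv w with hI
  have hsqle : (SU S).map (sqHom Kˣ) ≤ SU S ⊓ I := by
    refine le_inf ?_ (le_iInf₂ fun w _ => sq_le_Qv S w)
    rintro _ ⟨y, hy, rfl⟩
    exact pow_mem hy 2
  have h3 := Subgroup.relIndex_mul_relIndex _ _ _ hsqle (inf_le_left : SU S ⊓ I ≤ SU S)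
  rw [inf_comm, Subgroup.inf_relIndex_right, SU_sq_index] at h3
  have h4 : ((SU S).map (sqHom Kˣ)).relIndex (I ⊓ SU S) ≤ 2 := by
    by_cases h5 : I ⊓ SU S ≤ (SU S).map (sqHom Kˣ)
    · rw [Subgroup.relIndex_eq_one.mpr h5]; simp
    · obtain ⟨y, hy, hyQ⟩ := SetLike.not_le_iff_exists.mp h5
      refine le_of_eq ?_
      have hcl : ∀ z ∈ I ⊓ SU S, z ∈ (SU S).map (sqHom Kˣ) ∨ a * z ∈ (SU S).map (sqHom Kˣ) := by
        intro z hz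
        rcases hm z hz.2 (fun w hw => (Subgroup.mem_iInf.mp ((Subgroup.mem_iInf.mp hz.1) w)) hw) with h6 | h6
        · exact Or.inl (sq_mem_SU hz.2 h6)
        · exact Or.inr (sq_mem_SU (mul_mem haS hz.2) (by simpa using h6))
      have hy' := (hcl y hy).resolve_left hyQ
      rw [Subgroup.relIndex, Subgroup.index_eq_two_iff]
      refine ⟨⟨y, hy⟩, fun b => ?_⟩
      simp only [Subgroup.mem_subgroupOf, Subgroup.coe_mul]
      by_cases hb : (b : Kˣ) ∈ (SU S).map (sqHom Kˣ)
      · right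
        refine ⟨hb, ?_⟩
        rw [Subgroup.mul_mem_cancel_left _ hb]; exact hyQ
      · left
        have hb' := (hcl b b.2).resolve_left hb
        refine ⟨?_, hb⟩
        have h7 : a * a ∈ (SU S).map (sqHom Kˣ) := ⟨a, haS, pow_two a⟩
        have h8 := mul_mem hb' hy'
        have h9 : a * b * (a * y) = (a * a) * (b * y) := by rw [mul_mul_mul_comm]
        rw [h9, Subgroup.mul_mem_cancel_left _ h7] at h8
        exact h8
  have h5 : 2 ^ (Units.rank K + 1 + S.card) ≤ 2 ^ (T.card + 1) := by
    rw [← h3, pow_succ, mul_comm]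
    exact Nat.mul_le_mul i2 h4
  exact (Nat.pow_le_pow_iff_right (by norm_num)).mp h5

lemma Dual.exists_p {S : Finset (HeightOneSpectrum (𝓞 K))} (hS : ClS S) (h2 : ∀ v ∉ S, v.valuation K 2 = 1) {a : Kˣ} {T : Finset (HeightOneSpectrum (𝓞 K))}
    {x : HeightOneSpectrum (𝓞 K) → Kˣ} (h : Dual S a T x) (w : HeightOneSpectrum (𝓞 K)) (hw : w ∈ T) [DecidableEq (HeightOneSpectrum (𝓞 K))] :
    ∃ p : Kˣ, p ∈ SU (S ∪ T) ∧ p ∉ Ev w ∧ ∀ w' ∈ T, w' ≠ w → p ∈ Qv w' := by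
  classical
  obtain ⟨π, hπ⟩ := exists_with_val hS (fun v => if v = w then -1 else 0) {w} (by intro v hv; simp at hv; simp [hv])
  set F := T.filter (fun u => u ≠ w ∧ π ∉ Qv u) with hF
  have hFT : ∀ u ∈ F, u ∈ T := fun u hu => (Finset.mem_filter.mp hu).1
  have hprod : ∏ u ∈ F, x u ∈ SU S := prod_mem fun u hu => (h u (hFT u hu)).2.2.1
  refine ⟨π * ∏ u ∈ F, x u, ?_, ?_, ?_⟩
  · refine mul_mem ?_ (SU_mono Finset.subset_union_left hprod)
    intro v hv
    have hvS : v ∉ S := fun h => hv (Finset.mem_union_left _ h)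
    have hvw : v ≠ w := fun h => hv (Finset.mem_union_right _ (h ▸ hw))
    rw [hπ v hvS]; simp [hvw]
  · apply not_mem_Ev
    have hwS := (h w hw).1
    rw [Units.val_mul, map_mul, hπ w hwS, hprod w hwS]; simp
  · intro w' hw' hne
    have hx : ∀ u ∈ F, u ≠ w' → x u ∈ Qv w' := fun u hu hne' => (h u (hFT u hu)).2.2.2.2 w' hw' (Ne.symm hne')
    by_cases hπQ : π ∈ Qv w'
    · refine mul_mem hπQ (prod_mem fun u hu => hx u hu ?_)
      rintro rfl
      exact (Finset.mem_filter.mp hu).2.2 hπQ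
    · have hwF : w' ∈ F := Finset.mem_filter.mpr ⟨hw', hne, hπQ⟩
      rw [← Finset.mul_prod_erase F x hwF, ← mul_assoc]
      refine mul_mem ?_ (prod_mem fun u hu => hx u (Finset.mem_of_mem_erase hu) (Finset.ne_of_mem_erase hu))
      obtain ⟨k1, k2, k3, k4, k5⟩ := h w' hw'
      exact unit_mul_mem_Qv _ (h2 _ k1) _ _ (by rw [hπ _ k1]; simp [hne]) (k3 _ k1) hπQ k4

lemma exT [IsTotallyComplex K] [DecidableEq (HeightOneSpectrum (𝓞 K))] {S : Finset (HeightOneSpectrum (𝓞 K))} (hS : ClS S) (h2 : ∀ v ∉ S, v.valuation K 2 = 1) {a : Kˣ}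
    (haS : a ∈ SU S) (ha : ¬ IsSquare (a : K)) :
    ∃ T : Finset (HeightOneSpectrum (𝓞 K)), Disjoint S T ∧ (∀ w ∈ T, a ∈ Qv w) ∧ Units.rank K + 1 + S.card ≤ T.card + 1 ∧
      ∀ c ∈ SU (S ∪ T), (∀ v ∈ S, c ∈ Qv v) → IsSquare (c : K) := by
  classical
  obtain ⟨T, x, h, hm⟩ := exists_Dual h2 haS ha
  refine ⟨T, Finset.disjoint_right.mpr fun w hw => (h w hw).1, fun w hw => (h w hw).2.1, h.card_ge h2 haS hm, ?_⟩
  intro c hc hcQ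
  by_contra hsq
  choose! p hp1 hp2 hp3 using h.exists_p hS h2
  obtain ⟨H, hH1, hH2, hH3, hH4⟩ := lemmaH hsq (hS.mono Finset.subset_union_left) (S := S ∪ T)
    (fun v hv => h2 v fun h => hv (Finset.mem_union_left _ h)) hc
  have hfil : ((S ∪ T).filter fun v => c ∉ Qv v) ⊆ T.filter fun v => c ∉ Qv v := by
    intro v hv
    rw [Finset.mem_filter] at hv ⊢
    refine ⟨(Finset.mem_union.mp hv.1).resolve_left fun h => hv.2 (hcQ v h), hv.2⟩
  have hle := Nat.pow_le_pow_right (n := 2) (by norm_num) (Finset.card_le_card hfil)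
  have hind := indep_index (T.filter fun v => c ∉ Qv v) (fun w => Qv w ⊔ Nm (c : K)) (SU (S ∪ T)) H
    (fun w => if c ∈ Ev w then p w else x w) ?_ (fun w _ => hH2.trans le_sup_right) ?_ ?_ hH3
  · have : 0 < H.relIndex (SU (S ∪ T)) := Nat.pos_of_ne_zero hH3
    omega
  · intro w hw
    have hwT := (Finset.mem_filter.mp hw).1
    split
    · exact hp1 w hwT
    · exact SU_mono Finset.subset_union_left (h w hwT).2.2.1
  · intro w hw
    obtain ⟨hwT, hcw⟩ := Finset.mem_filter.mp hw
    obtain ⟨k1, k2, k3, k4, k5⟩ := h w hwT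
    split
    · rename_i hE
      exact fun h' => hp2 w hwT (localA _ (h2 w k1) c hE hcw h')
    · rename_i hE
      exact fun h' => k4 (localB _ (h2 w k1) c hE h' ⟨1, by rw [k3 w k1]; simp⟩)
  · intro i hi j hj hij
    have hi := (Finset.mem_filter.mp hi).1
    have hj := (Finset.mem_filter.mp hj).1
    apply Subgroup.mem_sup_left
    split
    · exact hp3 i hi j hj (Ne.symm hij)
    · exact (h i hi).2.2.2.2 j hj (Ne.symm hij)

end greedy

end partPJ1

section partPJ2

open IsDedekindDomain NumberField WithZero Polynomial
set_option linter.unusedSectionVars false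

section core
variable {K : Type*} [Field K] [NumberField K]

theorem norm_of_local [IsTotallyComplex K] {S : Finset (HeightOneSpectrum (𝓞 K))} (hS : ClS S) (h2 : ∀ v ∉ S, v.valuation K 2 = 1) {a : Kˣ}
    (haS : a ∈ SU S) (ha : ¬ IsSquare (a : K)) (had : ∀ v : HeightOneSpectrum (𝓞 K), v.valuation K 2 ≠ 1 → a ∈ Qv v)
    {b : Kˣ} (hb : b ∈ SU S) (hbl : ∀ v ∈ S, a ∉ Qv v → b ∈ Qv v ⊔ Nm (a : K)) : b ∈ Nm (a : K) := by
  classical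
  obtain ⟨T, hST, haT, hcard, hsq⟩ := exT hS h2 haS ha
  have h2' : ∀ v ∉ S ∪ T, v.valuation K 2 = 1 := fun v hv => h2 v fun h => hv (Finset.mem_union_left _ h)
  obtain ⟨H, hH1, hH2, hH3, hH4⟩ := lemmaH ha (S := S ∪ T) (hS.mono Finset.subset_union_left) h2'
    (SU_mono Finset.subset_union_left haS)
  set J := (S ∪ T).filter (fun v => a ∉ Qv v) with hJ
  have hJS : ∀ v ∈ J, v ∈ S := fun v hv => by
    obtain ⟨h1, h3⟩ := Finset.mem_filter.mp hv
    exact (Finset.mem_union.mp h1).resolve_right fun h => h3 (haT v h)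
  have hJa : ∀ v ∈ J, a ∉ Qv v := fun v hv => (Finset.mem_filter.mp hv).2
  have hJ2 : ∀ v ∈ J, v.valuation K 2 = 1 := fun v hv => by
    by_contra h; exact hJa v hv (had v h)
  set E := SU (S ∪ T) with hE
  set Q : Subgroup Kˣ := ⨅ v ∈ S, Qv v with hQ
  set N : Subgroup Kˣ := ⨅ v ∈ J, (Qv v ⊔ Nm (a : K)) with hN
  obtain ⟨q1, q2⟩ := index_bound S (fun v hv => by by_contra h; exact hv (h2 v h))
  have hQN : Q ≤ N := le_iInf₂ fun v hv => (iInf₂_le v (hJS v hv)).trans le_sup_left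
  have hN0 : N.index ≠ 0 := fun h => q1 (Nat.eq_zero_of_zero_dvd (h ▸ Subgroup.index_dvd_of_le hQN))
  -- lower bound for the index of N
  have hNi : 2 ^ J.card ≤ N.index := by
    have hx : ∀ i ∈ J, ∃ x : Kˣ, x ∉ Qv i ⊔ Nm (a : K) ∧ ∀ j ∈ J, i ≠ j → x ∈ Qv j := by
      intro i hi
      obtain ⟨y, hy⟩ := exists_nonnorm i (hJ2 i hi) a (hJa i hi)
      obtain ⟨x, hx⟩ := approx J (fun v => if v = i then y else 1)
      refine ⟨x, fun h => hy ?_, fun j hj hij => ?_⟩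
      · have h1 := hx i hi
        simp only [if_true] at h1
        have h3 : (Qv i ⊔ Nm (a : K)) ≥ Qv i := le_sup_left
        have h4 := mul_mem (inv_mem (h3 h1)) h
        simpa using h4
      · have h1 := hx j hj
        simpa [Ne.symm hij] using h1
    choose! x hx1 hx2 using hx
    have := indep_index J (fun v => Qv v ⊔ Nm (a : K)) ⊤ N x (fun _ _ => Subgroup.mem_top _)
      (fun v hv => iInf₂_le v hv) hx1 (fun i hi j hj hij => Subgroup.mem_sup_left (hx2 i hi j hj hij))
      (by rwa [Subgroup.relIndex_top_right])
    rwa [Subgroup.relIndex_top_right] at this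
  -- E ⊔ Q has index at most two
  have hEQ : (E ⊔ Q).index ≤ 2 := by
    have e1 : Q.relIndex (E ⊔ Q) * (E ⊔ Q).index = Q.index := Subgroup.relIndex_mul_index le_sup_right
    rw [Subgroup.relIndex_sup_right] at e1
    have e2 : Q.relIndex E ≠ 0 := fun h => q1 (by rw [← e1, h, zero_mul])
    have e3 : Q ⊓ E ≤ E.map (sqHom Kˣ) := by
      intro c hc
      refine sq_mem_SU hc.2 (hsq c hc.2 fun v hv => (Subgroup.mem_iInf.mp ((Subgroup.mem_iInf.mp hc.1) v)) hv)
    have e4 := Subgroup.relIndex_le_of_le_left e3 (by rwa [Subgroup.inf_relIndex_right] : (Q ⊓ E).relIndex E ≠ 0)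
    rw [Subgroup.inf_relIndex_right, SU_sq_index, Finset.card_union_of_disjoint hST] at e4
    have e5 := rank_add_one (K := K)
    have e6 : 2 ^ (2 * S.card + Module.finrank ℚ K) ≤ 2 * 2 ^ (Units.rank K + 1 + (S.card + T.card)) := by
      rw [← pow_succ']
      exact Nat.pow_le_pow_right (by norm_num) (by omega)
    have e7 : Q.relIndex E * (E ⊔ Q).index ≤ Q.relIndex E * 2 := by
      rw [e1]; linarith
    exact Nat.le_of_mul_le_mul_left e7 (Nat.pos_of_ne_zero e2)
  have hEQ0 : (E ⊔ Q).index ≠ 0 := fun h => q1 (Nat.eq_zero_of_zero_dvd (h ▸ Subgroup.index_dvd_of_le le_sup_right))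
  have hEN : (E ⊔ N).index ≤ 2 := by
    refine le_trans (Nat.le_of_dvd (Nat.pos_of_ne_zero hEQ0) (Subgroup.index_dvd_of_le (sup_le_sup_left hQN E))) hEQ
  have n1 : N.relIndex (E ⊔ N) * (E ⊔ N).index = N.index := Subgroup.relIndex_mul_index le_sup_right
  rw [Subgroup.relIndex_sup_right] at n1
  have hHN : H ≤ N ⊓ E := le_inf (le_iInf₂ fun v _ => hH2.trans le_sup_right) hH1
  have n2 := Subgroup.relIndex_mul_relIndex _ _ _ hHN inf_le_right
  rw [Subgroup.inf_relIndex_right] at n2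
  have n3 : N.relIndex E ≠ 0 := fun h => hN0 (by rw [← n1, h, zero_mul])
  have n4 : H.relIndex (N ⊓ E) = 1 := by
    have p1 : H.relIndex (N ⊓ E) ≠ 0 := fun h => hH3 (by rw [← n2, h, zero_mul])
    have p2 : N.index ≤ N.relIndex E * 2 := by rw [← n1]; exact Nat.mul_le_mul_left _ hEN
    have p3 : H.relIndex (N ⊓ E) * N.relIndex E ≤ 1 * N.relIndex E := by rw [n2]; omega
    have := Nat.le_of_mul_le_mul_right p3 (Nat.pos_of_ne_zero n3)
    omega
  have n5 := Subgroup.relIndex_eq_one.mp n4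
  refine hH2 (n5 ⟨?_, SU_mono Finset.subset_union_left hb⟩)
  refine Subgroup.mem_iInf.mpr fun v => Subgroup.mem_iInf.mpr fun hv => hbl v (hJS v hv) (hJa v hv)

lemma four_sq_zero_K {u w : K} (h : (-2 : K) = u ^ 2 + 3 * w ^ 2) : ∃ x y : K, x ^ 2 + y ^ 2 + 1 = 0 := by
  by_cases h0 : (w + 1) ^ 2 + (w - 1) ^ 2 = 0
  · by_cases h1 : w - 1 = 0
    · exfalso
      have : w = 1 := by linear_combination h1
      rw [this] at h0; norm_num at h0
    · refine ⟨(w + 1) / (w - 1), 0, ?_⟩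
      field_simp
      linear_combination h0
  · refine ⟨(u * (w + 1) + w * (w - 1)) / ((w + 1) ^ 2 + (w - 1) ^ 2), (u * (w - 1) - w * (w + 1)) / ((w + 1) ^ 2 + (w - 1) ^ 2), ?_⟩
    field_simp
    linear_combination (-((w + 1) ^ 2 + (w - 1) ^ 2)) * h

lemma local_two (v : HeightOneSpectrum (𝓞 K)) (h2 : v.valuation K 2 = 1) (b a : Kˣ) (hb : (b : K) = -2) (ha : (a : K) = -3) :
    b ∈ Qv v ⊔ Nm (a : K) := by
  have h4 : v.valuation K 4 = 1 := by rw [val_four, h2, one_pow]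
  by_cases h3 : v.valuation K 3 < 1
  · apply Subgroup.mem_sup_left
    refine ⟨1, ?_⟩
    rw [hb, h4, show (-2 : K) * 1 ^ 2 - 1 = -3 by ring, Valuation.map_neg]
    exact h3
  · have h31 : v.valuation K 3 = 1 := le_antisymm (by simpa using val_nat_le_one (v.valuation K) 3) (not_lt.mp h3)
    have h3' : (3 : 𝓞 K ⧸ v.asIdeal) ≠ 0 := by
      intro h
      have h5 : (3 : 𝓞 K) ∈ v.asIdeal := by
        rw [← Ideal.Quotient.eq_zero_iff_mem]; exact (map_ofNat (Ideal.Quotient.mk v.asIdeal) 3).trans h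
      apply h3
      have := (v.valuation_lt_one_iff_mem (K := K) (3 : 𝓞 K)).mpr h5
      change v.valuation K (algebraMap (𝓞 K) K 3) < 1 at this
      rwa [map_ofNat (algebraMap (𝓞 K) K)] at this
    have hfin : Finite (𝓞 K ⧸ v.asIdeal) := inferInstance
    let _ := Fintype.ofFinite (𝓞 K ⧸ v.asIdeal)
    obtain ⟨x, y, hxy⟩ := FiniteField.exists_root_sum_quadratic (R := 𝓞 K ⧸ v.asIdeal) (f := C 1 * X ^ 2 + C 0 * X + C 0) (g := C 3 * X ^ 2 + C 0 * X + C 2)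
      (degree_quadratic one_ne_zero) (degree_quadratic h3') (FiniteField.odd_card_of_char_ne_two (ringChar_ne_two v h2))
    obtain ⟨x, rfl⟩ := Ideal.Quotient.mk_surjective x
    obtain ⟨y, rfl⟩ := Ideal.Quotient.mk_surjective y
    have hmem : x ^ 2 + 3 * y ^ 2 + 2 ∈ v.asIdeal := by
      rw [← Ideal.Quotient.eq_zero_iff_mem]
      simp at hxy
      simp only [map_add, map_mul, map_pow, map_ofNat]
      linear_combination hxy
    have hlt := (v.valuation_lt_one_iff_mem (K := K) _).mpr hmem
    simp only [map_add, map_mul, map_pow, map_ofNat] at hlt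
    set x' := algebraMap (𝓞 K) K x
    set y' := algebraMap (𝓞 K) K y
    have hz1 : v.valuation K (x' ^ 2 + 3 * y' ^ 2) = 1 := by
      have h5 : v.valuation K (-2 : K) = 1 := by rw [Valuation.map_neg, h2]
      have := Valuation.map_add_eq_of_lt_right (v.valuation K) (x := x' ^ 2 + 3 * y' ^ 2 + 2) (y := (-2 : K)) (by rw [h5]; exact hlt)
      rw [h5] at this
      rw [← this]; ring_nf
    have hz0 : x' ^ 2 + 3 * y' ^ 2 ≠ 0 := by intro h; rw [h, map_zero] at hz1; exact zero_ne_one hz1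
    have k1 : Units.mk0 _ hz0 ∈ Nm (a : K) := ⟨x', y', by rw [ha, Units.val_mk0]; ring⟩
    have k2 : b * (Units.mk0 _ hz0)⁻¹ ∈ Qv v := by
      apply Qg_of_near
      rw [map_mul, h4, Units.val_mk0, hz1, hb, Valuation.map_sub_swap, mul_one]
      rwa [sub_neg_eq_add]
    have := mul_mem (Subgroup.mem_sup_left k2 : _ ∈ Qv v ⊔ Nm (a : K)) (Subgroup.mem_sup_right k1)
    simpa using this

lemma dyadic_three (v : HeightOneSpectrum (𝓞 K)) (h2 : v.valuation K 2 ≠ 1) (θ : K) (hθ : v.valuation K (θ ^ 2 + θ + 1) < 1) 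
    (a : Kˣ) (ha : (a : K) = -3) : a ∈ Qv v := by
  have h2' : v.valuation K 2 < 1 := lt_of_le_of_ne (by simpa using val_nat_le_one (v.valuation K) 2) h2
  have h4 : v.valuation K 4 < 1 := by rw [val_four]; exact pow_lt_one₀ zero_le h2' two_ne_zero
  have h40 : v.valuation K 4 ≠ 0 := by rw [Valuation.ne_zero_iff]; norm_num
  set ε := θ ^ 2 + θ + 1 with hε
  have h1 : v.valuation K ((2 * θ + 1) ^ 2) = 1 := by
    apply val_eq_one_of_sub_lt
    rw [show (2 * θ + 1) ^ 2 - 1 = 4 * (ε - 1) by rw [hε]; ring, map_mul]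
    have : v.valuation K (ε - 1) ≤ 1 := (Valuation.map_sub _ _ _).trans (max_le hθ.le (by simp))
    exact mul_lt_one_of_lt_of_le h4 this
  have h0 : (2 * θ + 1) ≠ 0 := by intro h; rw [h] at h1; simp at h1
  have h5 : a * ((Units.mk0 _ h0) ^ 2)⁻¹ ∈ Qv v := by
    apply Qg_of_near
    rw [Units.val_pow_eq_pow_val, Units.val_mk0, map_mul, h1, ha, mul_one, show -3 - (2 * θ + 1) ^ 2 = -(4 * ε) by rw [hε]; ring,
      Valuation.map_neg, map_mul]
    exact mul_lt_of_lt_one_right (zero_lt_iff.mpr h40) hθ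
  have := mul_mem h5 (sq_mem_Qg (v.valuation K) (Units.mk0 _ h0))
  simpa using this

theorem core [IsTotallyComplex K] (θ : K)
    (hθ : ∀ v : HeightOneSpectrum (𝓞 K), v.valuation K 2 ≠ 1 → v.valuation K (θ ^ 2 + θ + 1) < 1) :
    ∃ x y : K, x ^ 2 + y ^ 2 + 1 = 0 := by
  classical
  by_cases hsq : IsSquare (-3 : K)
  · obtain ⟨s, hs⟩ := hsq
    refine ⟨(-1 + s) / 2, (-1 - s) / 2, ?_⟩
    field_simp
    linear_combination (-2) * hs
  · obtain ⟨S₀, hS₀⟩ := exists_ClS (K := K)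
    obtain ⟨S₂, hS₂⟩ := exists_SU (Units.mk0 (-2 : K) (by norm_num))
    obtain ⟨S₃, hS₃⟩ := exists_SU (Units.mk0 (-3 : K) (by norm_num))
    have hs2 : S₂ ⊆ S₀ ∪ S₂ ∪ S₃ := fun v hv => by simp [hv]
    have h2 : ∀ v ∉ S₀ ∪ S₂ ∪ S₃, v.valuation K 2 = 1 := by
      intro v hv
      have := (SU_mono hs2 hS₂) v hv
      rwa [Units.val_mk0, Valuation.map_neg] at this
    have had := fun v hv => dyadic_three v hv θ (hθ v hv) (Units.mk0 (-3 : K) (by norm_num)) rfl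
    obtain ⟨u, w, h⟩ := norm_of_local (S := S₀ ∪ S₂ ∪ S₃) (hS₀.mono fun v hv => by simp [hv]) h2
      (a := Units.mk0 (-3 : K) (by norm_num)) (SU_mono (fun v hv => by simp [hv]) hS₃) hsq had
      (b := Units.mk0 (-2 : K) (by norm_num)) (SU_mono hs2 hS₂)
      (fun v _ hv => local_two v (by by_contra h; exact hv (had v h)) _ _ rfl rfl)
    refine four_sq_zero_K (u := u) (w := w) ?_
    rw [Units.val_mk0, Units.val_mk0] at h
    rw [h]; ring

end core

end partPJ2

section partPK

open IsDedekindDomain NumberField WithZero Polynomial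
set_option linter.unusedSectionVars false

section top
open Filter Topology

lemma lc_pos_of_pos (g : ℝ[X]) (h : ∀ t, 0 < g.eval t) : 0 < g.leadingCoeff := by
  by_contra hl
  rw [not_lt] at hl
  by_cases hd : 0 < g.degree
  · have := g.tendsto_atBot_of_leadingCoeff_nonpos hd hl
    obtain ⟨t, ht⟩ := (this.eventually (eventually_lt_atBot 0)).exists
    exact absurd (h t) (not_lt.mpr ht.le)
  · have := eq_C_of_degree_le_zero (not_lt.mp hd)
    have h0 := h 0
    rw [this] at h0 hl
    simp at h0 hl
    linarith

lemma quad_pos (t : ℝ) : 0 < t ^ 2 + t + 1 := by nlinarith [sq_nonneg (t + 1/2)]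

lemma exists_eps (f : ℝ[X]) (k : ℕ) (hd : f.natDegree = 4 * k) (h : ∀ t, 0 < f.eval t) :
    ∃ ε : ℝ, 0 < ε ∧ ∀ t, ε * (t ^ 2 + t + 1) ^ (2 * k) ≤ f.eval t := by
  have hlc := lc_pos_of_pos f h
  set q : ℝ[X] := (X ^ 2 + X + 1) ^ (2 * k) with hq
  have hmon : (X ^ 2 + X + 1 : ℝ[X]).Monic := by monicity!
  have hnd : (X ^ 2 + X + 1 : ℝ[X]).natDegree = 2 := by compute_degree!
  have hqm : q.Monic := hmon.pow _
  have hqd : q.natDegree = 4 * k := by rw [hq, hmon.natDegree_pow, hnd]; ring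
  have hqe : ∀ t, q.eval t = (t ^ 2 + t + 1) ^ (2 * k) := fun t => by simp [hq]
  have hqp : ∀ t, 0 < q.eval t := fun t => by rw [hqe]; exact pow_pos (quad_pos t) _
  have hf0 : f ≠ 0 := fun h0 => by simp [h0] at hlc
  have htop : Tendsto (fun t => f.eval t / q.eval t) atTop (𝓝 f.leadingCoeff) := by
    have := div_tendsto_leadingCoeff_div_of_degree_eq f q (by
      rw [degree_eq_natDegree hf0, degree_eq_natDegree hqm.ne_zero, hd, hqd])
    rwa [hqm.leadingCoeff, div_one] at this
  have hbot : Tendsto (fun t => f.eval t / q.eval t) atBot (𝓝 f.leadingCoeff) := by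
    have hnX : (-X : ℝ[X]).natDegree = 1 := by simp
    have l1 : (f.comp (-X)).leadingCoeff = f.leadingCoeff := by
      rw [leadingCoeff_comp (by simp), hd]; simp [pow_mul]; norm_num
    have l2 : (q.comp (-X)).leadingCoeff = 1 := by
      rw [leadingCoeff_comp (by simp), hqd, hqm.leadingCoeff]; simp [pow_mul]; norm_num
    have m1 : f.comp (-X) ≠ 0 := fun h0 => by rw [h0, leadingCoeff_zero] at l1; exact hlc.ne l1
    have m2 : q.comp (-X) ≠ 0 := fun h0 => by rw [h0, leadingCoeff_zero] at l2; exact zero_ne_one l2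
    have := div_tendsto_leadingCoeff_div_of_degree_eq (f.comp (-X)) (q.comp (-X)) (by
      rw [degree_eq_natDegree m1, degree_eq_natDegree m2, natDegree_comp, natDegree_comp, hd, hqd])
    rw [l1, l2, div_one] at this
    have := this.comp tendsto_neg_atBot_atTop
    refine this.congr fun t => ?_
    simp [eval_comp]
  have hco : ∀ᶠ t in cocompact ℝ, f.leadingCoeff / 2 < f.eval t / q.eval t := by
    rw [cocompact_eq_atBot_atTop, eventually_sup]
    exact ⟨hbot.eventually (lt_mem_nhds (by linarith)), htop.eventually (lt_mem_nhds (by linarith))⟩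
  obtain ⟨s, hs, hs'⟩ := mem_cocompact.mp hco
  have hcont : Continuous (fun t => f.eval t / q.eval t) := f.continuous.div q.continuous fun t => (hqp t).ne'
  have key : ∃ ε : ℝ, 0 < ε ∧ ∀ t, ε ≤ f.eval t / q.eval t := by
    rcases s.eq_empty_or_nonempty with rfl | hne
    · exact ⟨_, half_pos hlc, fun t => le_of_lt (hs' (by simp : t ∈ (∅ : Set ℝ)ᶜ))⟩
    · obtain ⟨t₀, _, ht₀⟩ := hs.exists_isMinOn hne hcont.continuousOn
      refine ⟨min (f.leadingCoeff / 2) (f.eval t₀ / q.eval t₀), lt_min (half_pos hlc) (div_pos (h _) (hqp _)), fun t => ?_⟩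
      by_cases ht : t ∈ s
      · exact (min_le_right _ _).trans (ht₀ ht)
      · exact (min_le_left _ _).trans (le_of_lt (hs' ht))
  obtain ⟨ε, h1, h2⟩ := key
  refine ⟨ε, h1, fun t => ?_⟩
  rw [← hqe]
  exact (le_div_iff₀ (hqp t)).mp (h2 t)

lemma val_aeval_le {K Γ : Type*} [Field K] [LinearOrderedCommGroupWithZero Γ] (V : Valuation K Γ) (f : ℤ[X]) (θ : K) (m : Γ) (hm : 1 ≤ m) (h : V θ ≤ m) :
    V (aeval θ f) ≤ m ^ f.natDegree := by
  rw [aeval_eq_sum_range]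
  refine Valuation.map_sum_le V fun i hi => ?_
  rw [Finset.mem_range, Nat.lt_succ_iff] at hi
  have hc : V ((f.coeff i : ℤ) : K) ≤ 1 := by
    rcases Int.eq_nat_or_neg (f.coeff i) with ⟨n, hn | hn⟩ <;> rw [hn]
    · simpa using val_nat_le_one V n
    · simpa using val_nat_le_one V n
  rw [zsmul_eq_mul, map_mul, map_pow]
  calc _ ≤ 1 * m ^ i := mul_le_mul' hc (pow_le_pow_left₀ zero_le h i)
    _ = m ^ i := one_mul _
    _ ≤ _ := pow_le_pow_right₀ hm hi

lemma val_quad_lt {K Γ : Type*} [Field K] [LinearOrderedCommGroupWithZero Γ] (V : Valuation K Γ) (f : ℤ[X]) (θ : K) (k ℓ : ℕ) (hk : 1 ≤ k) (hℓ : 1 ≤ ℓ)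
    (hd : f.natDegree = 4 * k) (h2 : V 2 < 1) (heq : 2 ^ (2 * ℓ) * aeval θ f = (θ ^ 2 + θ + 1) ^ (2 * k)) : V (θ ^ 2 + θ + 1) < 1 := by
  have h2l : V 2 ^ (2 * ℓ) < 1 := pow_lt_one₀ zero_le h2 (by omega)
  have hV := congrArg V heq
  rw [map_mul, map_pow, map_pow] at hV
  by_cases hθ : V θ ≤ 1
  · have h1 := val_aeval_le V f θ 1 le_rfl hθ
    rw [one_pow] at h1
    have h3 : V (θ ^ 2 + θ + 1) ^ (2 * k) < 1 := by rw [← hV]; exact mul_lt_one_of_lt_of_le h2l h1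
    by_contra hc
    exact absurd h3 (not_lt.mpr (one_le_pow₀ (not_lt.mp hc)))
  · rw [not_le] at hθ
    have h1 := val_aeval_le V f θ (V θ) hθ.le le_rfl
    exfalso
    have hθ2 : V θ < V (θ ^ 2) := by
      rw [map_pow, pow_two]; exact lt_mul_of_one_lt_left (zero_lt_one.trans hθ) hθ
    have h3 : V (θ ^ 2 + θ + 1) = V θ ^ 2 := by
      rw [add_assoc, Valuation.map_add_eq_of_lt_left, map_pow]
      refine Valuation.map_add_lt _ hθ2 ?_
      rw [map_one]; exact hθ.trans hθ2
    rw [h3, ← pow_mul, show 2 * (2 * k) = 4 * k by ring] at hV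
    rw [hd] at h1
    have h4 : 0 < V θ ^ (4 * k) := pow_pos (zero_lt_one.trans hθ) _
    have h5 : V 2 ^ (2 * ℓ) * V (aeval θ f) < V θ ^ (4 * k) :=
      calc _ ≤ V 2 ^ (2 * ℓ) * V θ ^ (4 * k) := mul_le_mul_right h1 _
        _ < 1 * V θ ^ (4 * k) := mul_lt_mul_of_pos_right h2l h4
        _ = _ := one_mul _
    exact h5.ne hV

end top

theorem deg4k_minus_cyclotomic_power_sum_of_four_squares
    (f : Polynomial ℤ) (k : ℕ) (hk : 1 ≤ k) (hdeg : f.natDegree = 4 * k)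
    (hsf : ∀ p : Polynomial ℤ, 0 < p.natDegree → ¬ p ^ 2 ∣ f)
    (hpos : ∀ t : ℝ, 0 < Polynomial.aeval t f) :
    ∃ ℓ₀ : ℕ, ∀ ℓ : ℕ, ℓ₀ ≤ ℓ →
      ∃ p₁ p₂ p₃ p₄ : Polynomial ℚ,
        f.map (Int.castRingHom ℚ) -
            C ((1 : ℚ) / 2 ^ (2 * ℓ)) * (X ^ 2 + X + 1) ^ (2 * k) =
          p₁ ^ 2 + p₂ ^ 2 + p₃ ^ 2 + p₄ ^ 2 := by
  have hev : ∀ t : ℝ, (f.map (Int.castRingHom ℝ)).eval t = aeval t f := fun t => by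
    rw [eval_map, aeval_def]; rfl
  obtain ⟨ε, hε, hfε⟩ := exists_eps (f.map (Int.castRingHom ℝ)) k
    (by rw [natDegree_map_eq_of_injective (RingHom.injective_int _), hdeg]) (fun t => by rw [hev]; exact hpos t)
  obtain ⟨n, hn⟩ := exists_pow_lt_of_lt_one hε (by norm_num : (1 / 4 : ℝ) < 1)
  refine ⟨n + 1, fun ℓ hℓ => ?_⟩
  have hlt : (1 : ℝ) / 2 ^ (2 * ℓ) < ε := by
    refine lt_of_le_of_lt ?_ hn
    rw [pow_mul, ← one_div_pow]
    norm_num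
    exact pow_le_pow_of_le_one (by norm_num) (by norm_num) (by omega)
  set g : ℚ[X] := f.map (Int.castRingHom ℚ) - C ((1 : ℚ) / 2 ^ (2 * ℓ)) * (X ^ 2 + X + 1) ^ (2 * k) with hg
  have haev : ∀ {R : Type} [Field R] [Algebra ℚ R] (t : R), aeval t g = aeval t f - algebraMap ℚ R (1 / 2 ^ (2 * ℓ)) * (t ^ 2 + t + 1) ^ (2 * k) := by
    intro R _ _ t
    have : aeval t (f.map (Int.castRingHom ℚ)) = aeval t f := by
      have := aeval_map_algebraMap (A := ℚ) t f
      simpa using this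
    rw [hg, map_sub, this, map_mul, aeval_C]
    simp
  have hgpos : ∀ t : ℝ, 0 < aeval t g := by
    intro t
    rw [haev]
    have h1 := hfε t
    rw [hev] at h1
    have h2 : 0 < (t ^ 2 + t + 1) ^ (2 * k) := pow_pos (quad_pos t) _
    have h3 : algebraMap ℚ ℝ (1 / 2 ^ (2 * ℓ)) = (1 : ℝ) / 2 ^ (2 * ℓ) := by simp
    rw [h3]
    nlinarith [mul_lt_mul_of_pos_right hlt h2]
  have hlc : 0 < g.leadingCoeff := by
    have := lc_pos_of_pos (g.map (algebraMap ℚ ℝ)) (fun t => by rw [eval_map_algebraMap]; exact hgpos t)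
    rw [leadingCoeff_map] at this
    simpa using this
  have hmain : IsS4 g := by
    refine isS4_poly g hlc fun p hp hpg => ?_
    have : Fact (Irreducible p) := ⟨hp⟩
    have hfd : FiniteDimensional ℚ (AdjoinRoot p) := (AdjoinRoot.powerBasis hp.ne_zero).finite
    have : NumberField (AdjoinRoot p) := { to_charZero := algebraRat.charZero _, to_finiteDimensional := hfd }
    have hroot : aeval (AdjoinRoot.root p) g = 0 := by
      obtain ⟨r, hr⟩ := hpg
      have h0 : aeval (AdjoinRoot.root p) p = 0 := by
        have h1 : algebraMap ℚ (AdjoinRoot p) = AdjoinRoot.of p := Subsingleton.elim _ _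
        rw [aeval_def, h1]
        exact AdjoinRoot.eval₂_root p
      rw [hr, map_mul, h0, zero_mul]
    have htc : IsTotallyComplex (AdjoinRoot p) := by
      refine ⟨fun v => ?_⟩
      rw [← InfinitePlace.not_isReal_iff_isComplex]
      intro hv
      let φ : AdjoinRoot p →+* ℝ := InfinitePlace.embedding_of_isReal hv
      have h1 := congrArg φ hroot
      rw [map_zero] at h1
      have h2 : φ (aeval (AdjoinRoot.root p) g) = aeval (φ (AdjoinRoot.root p)) g := by
        exact (aeval_algHom_apply φ.toRatAlgHom (AdjoinRoot.root p) g).symm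
      rw [h2] at h1
      exact (hgpos _).ne' h1
    set θ := AdjoinRoot.root p with hθ
    rw [haev, sub_eq_zero] at hroot
    obtain ⟨x, y, hxy⟩ := core θ (fun v hv => by
      refine val_quad_lt (v.valuation _) f θ k ℓ hk (by omega) hdeg (lt_of_le_of_ne (by simpa using val_nat_le_one (v.valuation (AdjoinRoot p)) 2) hv) ?_
      rw [hroot, ← mul_assoc]
      have : (2 : AdjoinRoot p) ^ (2 * ℓ) * algebraMap ℚ (AdjoinRoot p) (1 / 2 ^ (2 * ℓ)) = 1 := by
        rw [map_div₀, map_pow, map_one, map_ofNat]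
        field_simp
      rw [this, one_mul])
    obtain ⟨A, rfl⟩ := AdjoinRoot.mk_surjective x
    obtain ⟨B, rfl⟩ := AdjoinRoot.mk_surjective y
    refine ⟨A, B, ?_⟩
    rw [← AdjoinRoot.mk_eq_zero]
    simpa using hxy
  obtain ⟨a, b, c, d, h⟩ := hmain
  exact ⟨a, b, c, d, h⟩

end partPK
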